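/- arXiv:2201.03461 — 2 statements merged into one kernel-verified Lean document; each statement's English description precedes it below -/
import Mathlib

section
/- For all positive integers m and n, E[Loops(H_{1/2}(m,n))] = Σ_{L ∈ 𝐋, height(L) ≤ m, width(L) ≤ n} 2^{−(width(L)+height(L)+2)} · (m+1−height(L)) · (n+1−width(L)). -/
/-- A stitch is a unit segment of the grid: `vert i j` is the vertical segment from
`(i,j)` to `(i,j+1)`; `horiz i j` is the horizontal segment from `(i,j)` to `(i+1,j)`. -/
inductive Stitch : Type
  | vert : ℤ → ℤ → Stitch
  | horiz : ℤ → ℤ → Stitch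
  deriving DecidableEq

/-- Membership of a stitch in the hitomezashi pattern with labels `ε` (vertical lines)
and `η` (horizontal lines). -/
def Stitch.InPattern (ε η : ℤ → ZMod 2) : Stitch → Prop
  | .vert i j => (j : ZMod 2) = ε i
  | .horiz i j => (i : ZMod 2) = η j

/-- The stitch as a subset of the plane. -/
def Stitch.seg : Stitch → Set (ℝ × ℝ)
  | .vert i j => segment ℝ ((i : ℝ), (j : ℝ)) ((i : ℝ), (j : ℝ) + 1)
  | .horiz i j => segment ℝ ((i : ℝ), (j : ℝ)) ((i : ℝ) + 1, (j : ℝ))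

/-- The union of the segments of a set of stitches. -/
def curveOf (S : Set Stitch) : Set (ℝ × ℝ) := ⋃ s ∈ S, s.seg

/-- `C` is a simple closed curve: it is homeomorphic to a circle. -/
def IsCircle (C : Set (ℝ × ℝ)) : Prop :=
  Nonempty (C ≃ₜ Metric.sphere (0 : ℝ × ℝ) 1)

/-- The interior of a closed curve `C`: the union of the bounded connected
components of its complement. -/
def intOf (C : Set (ℝ × ℝ)) : Set (ℝ × ℝ) :=
  {p | p ∉ C ∧ Bornology.IsBounded (connectedComponentIn Cᶜ p)}

/-- The exterior of a closed curve `C`: the union of the unbounded connected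
components of its complement. -/
def extOf (C : Set (ℝ × ℝ)) : Set (ℝ × ℝ) :=
  {p | p ∉ C ∧ ¬ Bornology.IsBounded (connectedComponentIn Cᶜ p)}

/-- The open unit cell with southwest corner `(i,j)`. -/
def cell (i j : ℤ) : Set (ℝ × ℝ) :=
  Set.Ioo (i : ℝ) ((i : ℝ) + 1) ×ˢ Set.Ioo (j : ℝ) ((j : ℝ) + 1)

/-- A hitomezashi loop in the pattern with labels `ε`, `η`: a (finite) set of stitches
of the pattern whose union is a simple closed curve. -/
structure HLoop (ε η : ℤ → ZMod 2) where
  stitches : Finset Stitch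
  inPattern : ∀ s ∈ stitches, s.InPattern ε η
  isCircle : IsCircle (curveOf ↑stitches)

/-- The stitch lies inside the `m × n` grid `[0,n] × [0,m]`. -/
def Stitch.inGrid (m n : ℕ) : Stitch → Prop
  | .vert i j => 0 ≤ i ∧ i ≤ (n : ℤ) ∧ 0 ≤ j ∧ j + 1 ≤ (m : ℤ)
  | .horiz i j => 0 ≤ i ∧ i + 1 ≤ (n : ℤ) ∧ 0 ≤ j ∧ j ≤ (m : ℤ)

/-- The number of hitomezashi loops all of whose stitches are stitches of the
`m × n` hitomezashi pattern with labels `ε`, `η`. -/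
noncomputable def LoopsCount (m n : ℕ) (ε η : ℤ → ZMod 2) : ℕ :=
  Nat.card {S : Finset Stitch // IsCircle (curveOf ↑S) ∧
    ∀ s ∈ S, s.InPattern ε η ∧ s.inGrid m n}

/-- Extend labels on `{0, …, N}` to all of `ℤ` (by `0` outside; only the values on
`{0, …, N}` are relevant for stitches inside the grid). -/
def extendLabels (N : ℕ) (f : Fin (N+1) → ZMod 2) : ℤ → ZMod 2 :=
  fun i => if h : 0 ≤ i ∧ i ≤ (N : ℤ) then f ⟨i.toNat, by omega⟩ else 0

/-- The expected number of loops in the random `m × n` hitomezashi pattern whose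
`m + n + 2` labels are independent and uniform on `{0,1}`. -/
noncomputable def ELoops (m n : ℕ) : ℝ :=
  (∑ f : Fin (n+1) → ZMod 2, ∑ g : Fin (m+1) → ZMod 2,
    (LoopsCount m n (extendLabels n f) (extendLabels m g) : ℝ)) / 2 ^ (m + n + 2)

def Stitch.minX : Stitch → ℤ
  | .vert i _ => i
  | .horiz i _ => i

def Stitch.maxX : Stitch → ℤ
  | .vert i _ => i
  | .horiz i _ => i + 1

def Stitch.minY : Stitch → ℤ
  | .vert _ j => j
  | .horiz _ j => j

def Stitch.maxY : Stitch → ℤ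
  | .vert _ j => j + 1
  | .horiz _ j => j

/-- The width of a finite set of stitches: difference between the maximal and minimal
x-coordinates of its points. -/
noncomputable def loopW (S : Finset Stitch) : ℤ :=
  sSup {x : ℤ | ∃ s ∈ S, x = s.maxX} - sInf {x : ℤ | ∃ s ∈ S, x = s.minX}

/-- The height of a finite set of stitches: difference between the maximal and minimal
y-coordinates of its points. -/
noncomputable def loopH (S : Finset Stitch) : ℤ :=
  sSup {y : ℤ | ∃ s ∈ S, y = s.maxY} - sInf {y : ℤ | ∃ s ∈ S, y = s.minY}

/-- `S` is a hitomezashi loop normalized so that its minimal x- and y-coordinates are `0`.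
Normalized loops are canonical representatives for the set `𝐋` of hitomezashi loops
modulo translation. -/
def IsNormLoop (S : Finset Stitch) : Prop :=
  (∃ ε η : ℤ → ZMod 2, ∀ s ∈ S, s.InPattern ε η) ∧
  IsCircle (curveOf ↑S) ∧
  sInf {x : ℤ | ∃ s ∈ S, x = s.minX} = 0 ∧
  sInf {y : ℤ | ∃ s ∈ S, y = s.minY} = 0

/-- The constant `c = Σ_{L ∈ 𝐋} 2^{-(width(L)+height(L)+2)}`. -/
noncomputable def loopConst : ℝ :=
  ∑' S : {S : Finset Stitch // IsNormLoop S}, (2 : ℝ) ^ (-(loopW S.1 + loopH S.1 + 2))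

theorem isPreconnected_sphere_diff_singleton {E : Type*} [NormedAddCommGroup E] [NormedSpace ℝ E]
    {p : E} (hp : ‖p‖ = 1) : IsPreconnected (Metric.sphere (0 : E) 1 \ {p}) := by
  have hp0 : p ≠ 0 := by rintro rfl; simp at hp
  set R : Set E := {x | ∀ t : ℝ, 0 ≤ t → x ≠ t • p} with hR
  have hstar : StarConvex ℝ (-p) R := by
    intro x hx a b ha hb hab t ht h
    rcases hb.eq_or_lt with rfl | hb
    · obtain rfl : a = 1 := by linarith
      have : (t + 1) • p = 0 := by
        rw [add_smul, ← h]; simp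
      rcases smul_eq_zero.1 this with h | h
      · linarith
      · exact hp0 h
    · refine hx ((t + a) / b) (by positivity) ?_
      have : b • x = (t + a) • p := by
        rw [add_smul, ← h]; simp
      rw [div_eq_inv_mul, mul_smul, ← this, smul_smul, inv_mul_cancel₀ hb.ne', one_smul]
  have hconn : IsPreconnected R := by
    refine isPreconnected_of_forall (-p) fun y hy => ⟨segment ℝ (-p) y, ?_, left_mem_segment _ _ _,
      right_mem_segment _ _ _, (convex_segment _ _).isPreconnected⟩
    exact hstar.segment_subset hy
  have hne : ∀ x ∈ R, x ≠ 0 := fun x hx h => hx 0 le_rfl (by simpa using h)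
  have hcont : ContinuousOn (fun x : E => ‖x‖⁻¹ • x) R :=
    ContinuousOn.smul (continuousOn_id.norm.inv₀ fun x hx => norm_ne_zero_iff.2 (hne x hx))
      continuousOn_id
  convert hconn.image _ hcont using 1
  ext x
  simp only [Set.mem_sdiff, mem_sphere_zero_iff_norm, Set.mem_singleton_iff, Set.mem_image]
  constructor
  · rintro ⟨h1, h2⟩
    refine ⟨x, fun t ht h => h2 ?_, by simp [h1]⟩
    rw [h, norm_smul, hp, Real.norm_of_nonneg ht, mul_one] at h1
    simpa [h1] using h
  · rintro ⟨y, hy, rfl⟩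
    have h0 : ‖y‖ ≠ 0 := norm_ne_zero_iff.2 (hne y hy)
    refine ⟨by simp [norm_smul, h0], fun h => hy ‖y‖ (norm_nonneg _) ?_⟩
    rw [← h, smul_smul, mul_inv_cancel₀ h0, one_smul]

theorem IsCircle.isConnected {C : Set (ℝ × ℝ)} (hC : IsCircle C) : IsConnected C := by
  obtain ⟨e⟩ := hC
  have : ConnectedSpace (Metric.sphere (0 : ℝ × ℝ) 1) :=
    isConnected_iff_connectedSpace.1 (isConnected_sphere (by
      rw [rank_prod', Module.rank_self, one_add_one_eq_two]; exact Cardinal.one_lt_two) 0 zero_le_one)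
  have : ConnectedSpace C := e.symm.surjective.connectedSpace e.symm.continuous
  exact isConnected_iff_connectedSpace.2 this

theorem IsCircle.isPreconnected_diff_singleton {C : Set (ℝ × ℝ)} (hC : IsCircle C) {p : ℝ × ℝ}
    (hp : p ∈ C) : IsPreconnected (C \ {p}) := by
  obtain ⟨e⟩ := hC
  have h := isPreconnected_sphere_diff_singleton (mem_sphere_zero_iff_norm.1 (e ⟨p, hp⟩).2)
  have h' : IsPreconnected ({e ⟨p, hp⟩}ᶜ : Set (Metric.sphere (0 : ℝ × ℝ) 1)) := by
    rw [← Topology.IsInducing.subtypeVal.isPreconnected_image]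
    rwa [Set.compl_eq_univ_sdiff, Set.image_sdiff Subtype.val_injective, Set.image_univ,
      Subtype.range_coe, Set.image_singleton]
  have := h'.image (fun y => (e.symm y : ℝ × ℝ)) (by fun_prop)
  convert this using 1
  ext x
  simp only [Set.mem_image, Set.mem_compl_iff, Set.mem_singleton_iff, Set.mem_sdiff]
  constructor
  · rintro ⟨h1, h2⟩
    refine ⟨e ⟨x, h1⟩, fun h => h2 ?_, by simp⟩
    simpa using h
  · rintro ⟨y, hy, rfl⟩
    refine ⟨(e.symm y).2, fun h => hy ?_⟩
    rw [← e.apply_symm_apply y]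
    exact congrArg e (Subtype.ext h)

theorem IsCircle.not_crosses_sphere_once {C : Set (ℝ × ℝ)} (hC : IsCircle C) {v p q : ℝ × ℝ}
    {r : ℝ} (hr : 0 < r) (hv : v ∈ C) (hp : p ∈ C) (hpr : dist p v = r) (hq : q ∈ C)
    (hqr : r < dist q v) : ∃ x ∈ C, dist x v = r ∧ x ≠ p := by
  by_contra! hcon
  have hpre := hC.isPreconnected_diff_singleton hp
  have := hpre (Metric.ball v r) (Metric.closedBall v r)ᶜ Metric.isOpen_ball
    Metric.isClosed_closedBall.isOpen_compl ?_ ⟨v, ⟨hv, ?_⟩, by simpa⟩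
    ⟨q, ⟨hq, ?_⟩, by simpa⟩
  · obtain ⟨x, -, h1, h2⟩ := this
    exact h2 (Metric.ball_subset_closedBall h1)
  · rintro x ⟨hx, hxp⟩
    rcases lt_trichotomy (dist x v) r with h | h | h
    · exact Or.inl h
    · exact absurd (hcon x hx h) hxp
    · exact Or.inr (by simpa using h)
  · rintro rfl; simp at hpr; exact hr.ne hpr
  · rintro rfl; exact hqr.ne' hpr

theorem Stitch.mem_seg_vert {i j : ℤ} {p : ℝ × ℝ} :
    p ∈ (Stitch.vert i j).seg ↔ p.1 = i ∧ (j : ℝ) ≤ p.2 ∧ p.2 ≤ j + 1 := by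
  obtain ⟨x, y⟩ := p
  rw [Stitch.seg, ← Prod.image_mk_segment_right, segment_eq_Icc (by linarith)]
  simp only [Set.mem_image, Set.mem_Icc, Prod.mk.injEq]
  grind

theorem Stitch.mem_seg_horiz {i j : ℤ} {p : ℝ × ℝ} :
    p ∈ (Stitch.horiz i j).seg ↔ p.2 = j ∧ (i : ℝ) ≤ p.1 ∧ p.1 ≤ i + 1 := by
  obtain ⟨x, y⟩ := p
  rw [Stitch.seg, ← Prod.image_mk_segment_left, segment_eq_Icc (by linarith)]
  simp only [Set.mem_image, Set.mem_Icc, Prod.mk.injEq]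
  grind

theorem mem_curveOf {S : Set Stitch} {p : ℝ × ℝ} : p ∈ curveOf S ↔ ∃ s ∈ S, p ∈ s.seg := by
  simp [curveOf]

theorem dist_le_iff_of_prod {p v : ℝ × ℝ} {r : ℝ} :
    dist p v ≤ r ↔ |p.1 - v.1| ≤ r ∧ |p.2 - v.2| ≤ r := by
  rw [Prod.dist_eq, sup_le_iff, Real.dist_eq, Real.dist_eq]

/-- The points at sup-distance `1/2` from a lattice point on a stitch of the grid are the
midpoints of the stitches incident to it. -/
theorem Stitch.eq_midpoint_of_dist_eq_half {s : Stitch} {a b : ℤ} {p : ℝ × ℝ} (hp : p ∈ s.seg)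
    (hd : dist p ((a : ℝ), (b : ℝ)) = 1 / 2) :
    (s = .vert a b ∧ p = ((a : ℝ), (b : ℝ) + 1 / 2)) ∨
    (s = .vert a (b - 1) ∧ p = ((a : ℝ), (b : ℝ) - 1 / 2)) ∨
    (s = .horiz a b ∧ p = ((a : ℝ) + 1 / 2, (b : ℝ))) ∨
    (s = .horiz (a - 1) b ∧ p = ((a : ℝ) - 1 / 2, (b : ℝ))) := by
  obtain ⟨x, y⟩ := p
  obtain ⟨h1, h2⟩ := dist_le_iff_of_prod.1 hd.le
  have h3 : |x - a| = 1 / 2 ∨ |y - b| = 1 / 2 := by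
    rw [Prod.dist_eq, Real.dist_eq, Real.dist_eq] at hd
    exact (max_choice |x - a| |y - b|).imp (fun h => h.symm.trans hd) (fun h => h.symm.trans hd)
  rw [abs_le] at h1 h2
  dsimp only at h1 h2
  rcases s with ⟨i, j⟩ | ⟨i, j⟩
  · obtain ⟨rfl, h4, h5⟩ := mem_seg_vert.1 hp
    dsimp only at h1 h4 h5
    obtain rfl : i = a := by
      have h6 : (i : ℝ) < a + 1 := by linarith
      have h7 : (a : ℝ) < i + 1 := by linarith
      norm_cast at h6 h7; omega
    have h8 : |y - b| = 1 / 2 := by simpa using h3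
    have h6 : (j : ℝ) < b + 1 := by linarith
    have h7 : (b : ℝ) < j + 2 := by linarith
    norm_cast at h6 h7
    rcases eq_or_eq_neg_of_abs_eq h8 with h8 | h8
    · left
      have h9 : (b : ℝ) < j + 1 := by linarith
      norm_cast at h9
      obtain rfl : j = b := by omega
      exact ⟨rfl, Prod.ext rfl (by simp only; linarith)⟩
    · right; left
      have h9 : (j : ℝ) < b := by linarith
      norm_cast at h9
      obtain rfl : j = b - 1 := by omega
      exact ⟨rfl, Prod.ext rfl (by simp only; linarith)⟩
  · obtain ⟨rfl, h4, h5⟩ := mem_seg_horiz.1 hp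
    dsimp only at h1 h4 h5
    obtain rfl : j = b := by
      have h6 : (j : ℝ) < b + 1 := by linarith
      have h7 : (b : ℝ) < j + 1 := by linarith
      norm_cast at h6 h7; omega
    have h8 : |x - a| = 1 / 2 := by simpa using h3
    have h6 : (i : ℝ) < a + 1 := by linarith
    have h7 : (a : ℝ) < i + 2 := by linarith
    norm_cast at h6 h7
    rcases eq_or_eq_neg_of_abs_eq h8 with h8 | h8
    · right; right; left
      have h9 : (a : ℝ) < i + 1 := by linarith
      norm_cast at h9
      obtain rfl : i = a := by omega
      exact ⟨rfl, Prod.ext (by simp only; linarith) rfl⟩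
    · right; right; right
      have h9 : (i : ℝ) < a := by linarith
      norm_cast at h9
      obtain rfl : i = a - 1 := by omega
      exact ⟨rfl, Prod.ext (by simp only; linarith) rfl⟩

/-- Every stitch of a loop has, at each of its endpoints, another stitch of the loop. -/
theorem exists_stitch_at_lattice_point {S : Set Stitch} (hS : IsCircle (curveOf S)) {s : Stitch}
    (hs : s ∈ S) {a b : ℤ}
    (hab : s = .vert a b ∨ s = .vert a (b - 1) ∨ s = .horiz a b ∨ s = .horiz (a - 1) b) :
    ∃ t ∈ S, t ≠ s ∧
      (t = .vert a b ∨ t = .vert a (b - 1) ∨ t = .horiz a b ∨ t = .horiz (a - 1) b) := by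
  obtain ⟨u, v, huv, hsv, hsp, hsq⟩ : ∃ u v : ℝ, max |u| |v| = 1 ∧ ((a : ℝ), (b : ℝ)) ∈ s.seg ∧
      ((a : ℝ) + u / 2, (b : ℝ) + v / 2) ∈ s.seg ∧ ((a : ℝ) + u, (b : ℝ) + v) ∈ s.seg := by
    rcases hab with rfl | rfl | rfl | rfl
    · refine ⟨0, 1, by norm_num, ?_⟩
      simp only [Stitch.mem_seg_vert]; norm_num
    · refine ⟨0, -1, by norm_num, ?_⟩
      simp only [Stitch.mem_seg_vert]; push_cast
      refine ⟨⟨trivial, ?_, ?_⟩, ⟨?_, ?_, ?_⟩, ?_, ?_, ?_⟩ <;> linarith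
    · refine ⟨1, 0, by norm_num, ?_⟩
      simp only [Stitch.mem_seg_horiz]; norm_num
    · refine ⟨-1, 0, by norm_num, ?_⟩
      simp only [Stitch.mem_seg_horiz]; push_cast
      refine ⟨⟨trivial, ?_, ?_⟩, ⟨?_, ?_, ?_⟩, ?_, ?_, ?_⟩ <;> linarith
  have hdist : ∀ c : ℝ, 0 ≤ c → dist ((a : ℝ) + u * c, (b : ℝ) + v * c) ((a : ℝ), (b : ℝ)) = c := by
    intro c hc
    simp only [Prod.dist_eq, Real.dist_eq, add_sub_cancel_left, abs_mul, abs_of_nonneg hc]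
    rw [← max_mul_of_nonneg _ _ hc, huv, one_mul]
  have hp := hdist (1 / 2) (by norm_num)
  have hq := hdist 1 (by norm_num)
  rw [mul_one, mul_one] at hq
  rw [mul_one_div, mul_one_div] at hp
  obtain ⟨x, hx, hxv, hxp⟩ := hS.not_crosses_sphere_once one_half_pos (mem_curveOf.2 ⟨s, hs, hsv⟩)
    (mem_curveOf.2 ⟨s, hs, hsp⟩) hp (mem_curveOf.2 ⟨s, hs, hsq⟩) (by rw [hq]; norm_num)
  obtain ⟨t, ht, hxt⟩ := mem_curveOf.1 hx
  have h1 := Stitch.eq_midpoint_of_dist_eq_half hxt hxv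
  refine ⟨t, ht, ?_, by tauto⟩
  rintro rfl
  have h2 := Stitch.eq_midpoint_of_dist_eq_half hsp hp
  refine hxp ?_
  rcases h1 with ⟨rfl, rfl⟩ | ⟨rfl, rfl⟩ | ⟨rfl, rfl⟩ | ⟨rfl, rfl⟩ <;> simp at h2 ⊢ <;> grind

theorem intCast_zmod_two_ne (i : ℤ) : ((i - 1 : ℤ) : ZMod 2) ≠ i := by
  push_cast
  simp [sub_eq_self]

theorem exists_vert_of_horiz {S : Set Stitch} (hS : IsCircle (curveOf S)) {ε η : ℤ → ZMod 2}
    (hpat : ∀ s ∈ S, s.InPattern ε η) {a b : ℤ}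
    (h : Stitch.horiz a b ∈ S ∨ Stitch.horiz (a - 1) b ∈ S) : ∃ j, Stitch.vert a j ∈ S := by
  obtain ⟨s, hs, hab⟩ : ∃ s ∈ S, s = .horiz a b ∨ s = .horiz (a - 1) b := by grind
  obtain ⟨t, ht, hne, hts⟩ := exists_stitch_at_lattice_point hS hs (Or.inr (Or.inr hab))
  rcases hts with rfl | rfl | hts
  · exact ⟨_, ht⟩
  · exact ⟨_, ht⟩
  · have h1 := hpat _ hs
    have h2 := hpat _ ht
    have h3 := intCast_zmod_two_ne a
    rcases hab with rfl | rfl <;> rcases hts with rfl | rfl <;>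
      simp only [Stitch.InPattern] at h1 h2 <;> grind

theorem exists_horiz_of_vert {S : Set Stitch} (hS : IsCircle (curveOf S)) {ε η : ℤ → ZMod 2}
    (hpat : ∀ s ∈ S, s.InPattern ε η) {a b : ℤ}
    (h : Stitch.vert a b ∈ S ∨ Stitch.vert a (b - 1) ∈ S) : ∃ i, Stitch.horiz i b ∈ S := by
  obtain ⟨s, hs, hab⟩ : ∃ s ∈ S, s = .vert a b ∨ s = .vert a (b - 1) := by grind
  obtain ⟨t, ht, hne, hts⟩ := exists_stitch_at_lattice_point hS hs (by tauto)
  rw [← or_assoc] at hts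
  rcases hts with hts | rfl | rfl
  · have h1 := hpat _ hs
    have h2 := hpat _ ht
    have h3 := intCast_zmod_two_ne b
    rcases hab with rfl | rfl <;> rcases hts with rfl | rfl <;>
      simp only [Stitch.InPattern] at h1 h2 <;> grind
  · exact ⟨_, ht⟩
  · exact ⟨_, ht⟩

theorem exists_vert_of_mem_Icc {S : Set Stitch} (hS : IsCircle (curveOf S)) {ε η : ℤ → ZMod 2}
    (hpat : ∀ s ∈ S, s.InPattern ε η) {s t : Stitch} (hs : s ∈ S) (ht : t ∈ S) {k : ℤ}
    (h1 : s.minX ≤ k) (h2 : k ≤ t.maxX) : ∃ j, Stitch.vert k j ∈ S := by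
  have hconn := hS.isConnected.isPreconnected.image Prod.fst continuous_fst.continuousOn
  have h3 : ((s.minX : ℤ) : ℝ) ∈ Prod.fst '' curveOf S := by
    rcases s with ⟨i, j⟩ | ⟨i, j⟩
    · exact ⟨(i, j), mem_curveOf.2 ⟨_, hs, by simp [Stitch.mem_seg_vert]⟩, rfl⟩
    · exact ⟨(i, j), mem_curveOf.2 ⟨_, hs, by simp [Stitch.mem_seg_horiz]⟩, rfl⟩
  have h4 : ((t.maxX : ℤ) : ℝ) ∈ Prod.fst '' curveOf S := by
    rcases t with ⟨i, j⟩ | ⟨i, j⟩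
    · exact ⟨(i, j), mem_curveOf.2 ⟨_, ht, by simp [Stitch.mem_seg_vert]⟩, rfl⟩
    · exact ⟨(i + 1, j), mem_curveOf.2 ⟨_, ht, by simp [Stitch.mem_seg_horiz]⟩,
        by simp [Stitch.maxX]⟩
  obtain ⟨⟨x, y⟩, hp, hk⟩ := hconn.ordConnected.out h3 h4
    (show (k : ℝ) ∈ Set.Icc _ _ from ⟨by exact_mod_cast h1, by exact_mod_cast h2⟩)
  obtain rfl : x = k := hk
  obtain ⟨⟨i, j⟩ | ⟨i, j⟩, hr, hpr⟩ := mem_curveOf.1 hp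
  · have := (Stitch.mem_seg_vert.1 hpr).1
    dsimp only at this
    norm_cast at this
    subst this
    exact ⟨j, hr⟩
  · obtain ⟨-, h5, h6⟩ := Stitch.mem_seg_horiz.1 hpr
    dsimp only at h5 h6
    norm_cast at h5 h6
    refine exists_vert_of_horiz hS hpat (b := j) ?_
    rcases (show i = k ∨ i = k - 1 by omega) with rfl | rfl
    · exact Or.inl hr
    · exact Or.inr hr

theorem exists_horiz_of_mem_Icc {S : Set Stitch} (hS : IsCircle (curveOf S)) {ε η : ℤ → ZMod 2}
    (hpat : ∀ s ∈ S, s.InPattern ε η) {s t : Stitch} (hs : s ∈ S) (ht : t ∈ S) {k : ℤ}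
    (h1 : s.minY ≤ k) (h2 : k ≤ t.maxY) : ∃ i, Stitch.horiz i k ∈ S := by
  have hconn := hS.isConnected.isPreconnected.image Prod.snd continuous_snd.continuousOn
  have h3 : ((s.minY : ℤ) : ℝ) ∈ Prod.snd '' curveOf S := by
    rcases s with ⟨i, j⟩ | ⟨i, j⟩
    · exact ⟨(i, j), mem_curveOf.2 ⟨_, hs, by simp [Stitch.mem_seg_vert]⟩, rfl⟩
    · exact ⟨(i, j), mem_curveOf.2 ⟨_, hs, by simp [Stitch.mem_seg_horiz]⟩, rfl⟩
  have h4 : ((t.maxY : ℤ) : ℝ) ∈ Prod.snd '' curveOf S := by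
    rcases t with ⟨i, j⟩ | ⟨i, j⟩
    · exact ⟨(i, j + 1), mem_curveOf.2 ⟨_, ht, by simp [Stitch.mem_seg_vert]⟩,
        by simp [Stitch.maxY]⟩
    · exact ⟨(i, j), mem_curveOf.2 ⟨_, ht, by simp [Stitch.mem_seg_horiz]⟩, rfl⟩
  obtain ⟨⟨x, y⟩, hp, hk⟩ := hconn.ordConnected.out h3 h4
    (show (k : ℝ) ∈ Set.Icc _ _ from ⟨by exact_mod_cast h1, by exact_mod_cast h2⟩)
  obtain rfl : y = k := hk
  obtain ⟨⟨i, j⟩ | ⟨i, j⟩, hr, hpr⟩ := mem_curveOf.1 hp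
  · obtain ⟨-, h5, h6⟩ := Stitch.mem_seg_vert.1 hpr
    dsimp only at h5 h6
    norm_cast at h5 h6
    refine exists_horiz_of_vert hS hpat (a := i) ?_
    rcases (show j = k ∨ j = k - 1 by omega) with rfl | rfl
    · exact Or.inl hr
    · exact Or.inr hr
  · have := (Stitch.mem_seg_horiz.1 hpr).1
    dsimp only at this
    norm_cast at this
    subst this
    exact ⟨i, hr⟩

theorem IsCircle.image {C : Set (ℝ × ℝ)} (hC : IsCircle C) (e : ℝ × ℝ ≃ₜ ℝ × ℝ) :
    IsCircle (e '' C) :=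
  hC.map fun f => (e.image C).symm.trans f

theorem IsCircle.nonempty_of_curveOf {S : Finset Stitch} (hS : IsCircle (curveOf ↑S)) :
    S.Nonempty := by
  obtain ⟨p, hp⟩ := hS.isConnected.nonempty
  obtain ⟨s, hs, -⟩ := mem_curveOf.1 hp
  exact ⟨s, hs⟩

/-- Translation of stitches by an integer vector. -/
def Stitch.shift (a c : ℤ) : Stitch ≃ Stitch where
  toFun
    | .vert i j => .vert (i + a) (j + c)
    | .horiz i j => .horiz (i + a) (j + c)
  invFun
    | .vert i j => .vert (i - a) (j - c)
    | .horiz i j => .horiz (i - a) (j - c)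
  left_inv s := by cases s <;> simp
  right_inv s := by cases s <;> simp

theorem Stitch.mem_seg_shift {a c : ℤ} {s : Stitch} {p : ℝ × ℝ} :
    p ∈ (shift a c s).seg ↔ p - ((a : ℝ), (c : ℝ)) ∈ s.seg := by
  cases s <;> simp only [shift, Equiv.coe_fn_mk, mem_seg_vert, mem_seg_horiz, Prod.fst_sub,
    Prod.snd_sub] <;> push_cast <;> grind

theorem Stitch.inPattern_shift {a c : ℤ} {s : Stitch} {ε η : ℤ → ZMod 2}
    (h : s.InPattern ε η) :
    (shift a c s).InPattern (fun i => ε (i - a) + c) (fun j => η (j - c) + a) := by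
  cases s <;> simpa [shift, InPattern] using h

@[simp] theorem Stitch.minX_shift (a c : ℤ) (s : Stitch) : (shift a c s).minX = s.minX + a := by
  cases s <;> rfl

@[simp] theorem Stitch.minY_shift (a c : ℤ) (s : Stitch) : (shift a c s).minY = s.minY + c := by
  cases s <;> rfl

@[simp] theorem Stitch.maxX_shift (a c : ℤ) (s : Stitch) : (shift a c s).maxX = s.maxX + a := by
  cases s <;> simp [shift, maxX]; ring

@[simp] theorem Stitch.maxY_shift (a c : ℤ) (s : Stitch) : (shift a c s).maxY = s.maxY + c := by
  cases s <;> simp [shift, maxY]; ring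

/-- Translation of finite sets of stitches by an integer vector. -/
def shiftLoop (a c : ℤ) (S : Finset Stitch) : Finset Stitch :=
  S.map (Stitch.shift a c).toEmbedding

theorem mem_shiftLoop {a c : ℤ} {S : Finset Stitch} {t : Stitch} :
    t ∈ shiftLoop a c S ↔ ∃ s ∈ S, Stitch.shift a c s = t := by
  simp only [shiftLoop, Finset.mem_map, Equiv.coe_toEmbedding]

theorem shiftLoop_shiftLoop (a c a' c' : ℤ) (S : Finset Stitch) :
    shiftLoop a c (shiftLoop a' c' S) = shiftLoop (a' + a) (c' + c) S := by
  rw [shiftLoop, shiftLoop, shiftLoop, Finset.map_map]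
  congr 1
  ext s
  cases s <;> simp [Stitch.shift, add_assoc]

theorem shiftLoop_zero (S : Finset Stitch) : shiftLoop 0 0 S = S := by
  ext s
  rw [mem_shiftLoop]
  have h : ∀ s, Stitch.shift 0 0 s = s := fun s => by cases s <;> simp [Stitch.shift]
  simp [h]

theorem isCircle_shiftLoop {S : Finset Stitch} (hS : IsCircle (curveOf ↑S)) (a c : ℤ) :
    IsCircle (curveOf ↑(shiftLoop a c S)) := by
  convert hS.image (Homeomorph.addRight ((a : ℝ), (c : ℝ))) using 1
  ext p
  rw [Homeomorph.image_eq_preimage_symm, Set.mem_preimage, mem_curveOf, mem_curveOf]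
  simp only [Finset.mem_coe, mem_shiftLoop, exists_exists_and_eq_and, Stitch.mem_seg_shift,
    sub_eq_add_neg]
  rfl

theorem exists_pattern_shiftLoop {S : Finset Stitch}
    (hS : ∃ ε η : ℤ → ZMod 2, ∀ s ∈ S, s.InPattern ε η) (a c : ℤ) :
    ∃ ε η : ℤ → ZMod 2, ∀ s ∈ shiftLoop a c S, s.InPattern ε η := by
  obtain ⟨ε, η, h⟩ := hS
  refine ⟨fun i => ε (i - a) + c, fun j => η (j - c) + a, fun t ht => ?_⟩
  obtain ⟨s, hs, rfl⟩ := mem_shiftLoop.1 ht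
  exact Stitch.inPattern_shift (h s hs)

/-- Least x-coordinate of a set of stitches. -/
noncomputable def loopLeft (S : Finset Stitch) : ℤ := sInf {x : ℤ | ∃ s ∈ S, x = s.minX}

/-- Greatest x-coordinate of a set of stitches. -/
noncomputable def loopRight (S : Finset Stitch) : ℤ := sSup {x : ℤ | ∃ s ∈ S, x = s.maxX}

/-- Least y-coordinate of a set of stitches. -/
noncomputable def loopBot (S : Finset Stitch) : ℤ := sInf {y : ℤ | ∃ s ∈ S, y = s.minY}

/-- Greatest y-coordinate of a set of stitches. -/
noncomputable def loopTop (S : Finset Stitch) : ℤ := sSup {y : ℤ | ∃ s ∈ S, y = s.maxY}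

theorem loopW_eq (S : Finset Stitch) : loopW S = loopRight S - loopLeft S := rfl

theorem loopH_eq (S : Finset Stitch) : loopH S = loopTop S - loopBot S := rfl

theorem eq_sInf_iff {S : Finset Stitch} (hS : S.Nonempty) (f : Stitch → ℤ) {b : ℤ} :
    sInf {x : ℤ | ∃ s ∈ S, x = f s} = b ↔ (∃ s ∈ S, b = f s) ∧ ∀ s ∈ S, b ≤ f s := by
  have key : ∀ {b}, ((∃ s ∈ S, b = f s) ∧ ∀ s ∈ S, b ≤ f s) →
      sInf {x : ℤ | ∃ s ∈ S, x = f s} = b := fun h =>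
    IsLeast.csInf_eq ⟨h.1, by rintro _ ⟨s, hs, rfl⟩; exact h.2 s hs⟩
  refine ⟨?_, key⟩
  rintro rfl
  obtain ⟨s, hs, h⟩ := S.exists_min_image f hS
  have h' : (∃ t ∈ S, f s = f t) ∧ ∀ t ∈ S, f s ≤ f t := ⟨⟨s, hs, rfl⟩, h⟩
  rwa [key h']

theorem eq_sSup_iff {S : Finset Stitch} (hS : S.Nonempty) (f : Stitch → ℤ) {b : ℤ} :
    sSup {x : ℤ | ∃ s ∈ S, x = f s} = b ↔ (∃ s ∈ S, b = f s) ∧ ∀ s ∈ S, f s ≤ b := by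
  have key : ∀ {b}, ((∃ s ∈ S, b = f s) ∧ ∀ s ∈ S, f s ≤ b) →
      sSup {x : ℤ | ∃ s ∈ S, x = f s} = b := fun h =>
    IsGreatest.csSup_eq ⟨h.1, by rintro _ ⟨s, hs, rfl⟩; exact h.2 s hs⟩
  refine ⟨?_, key⟩
  rintro rfl
  obtain ⟨s, hs, h⟩ := S.exists_max_image f hS
  have h' : (∃ t ∈ S, f s = f t) ∧ ∀ t ∈ S, f t ≤ f s := ⟨⟨s, hs, rfl⟩, h⟩
  rwa [key h']

theorem loopLeft_spec {S : Finset Stitch} (hS : S.Nonempty) :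
    (∃ s ∈ S, loopLeft S = s.minX) ∧ ∀ s ∈ S, loopLeft S ≤ s.minX :=
  (eq_sInf_iff hS Stitch.minX).1 rfl

theorem loopBot_spec {S : Finset Stitch} (hS : S.Nonempty) :
    (∃ s ∈ S, loopBot S = s.minY) ∧ ∀ s ∈ S, loopBot S ≤ s.minY :=
  (eq_sInf_iff hS Stitch.minY).1 rfl

theorem loopRight_spec {S : Finset Stitch} (hS : S.Nonempty) :
    (∃ s ∈ S, loopRight S = s.maxX) ∧ ∀ s ∈ S, s.maxX ≤ loopRight S :=
  (eq_sSup_iff hS Stitch.maxX).1 rfl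

theorem loopTop_spec {S : Finset Stitch} (hS : S.Nonempty) :
    (∃ s ∈ S, loopTop S = s.maxY) ∧ ∀ s ∈ S, s.maxY ≤ loopTop S :=
  (eq_sSup_iff hS Stitch.maxY).1 rfl

theorem shiftLoop_nonempty {S : Finset Stitch} (hS : S.Nonempty) (a c : ℤ) :
    (shiftLoop a c S).Nonempty := by
  simpa [shiftLoop] using hS

theorem loopLeft_shiftLoop {S : Finset Stitch} (hS : S.Nonempty) (a c : ℤ) :
    loopLeft (shiftLoop a c S) = loopLeft S + a := by
  refine (eq_sInf_iff (shiftLoop_nonempty hS a c) _).2 ?_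
  simpa [mem_shiftLoop] using loopLeft_spec hS

theorem loopBot_shiftLoop {S : Finset Stitch} (hS : S.Nonempty) (a c : ℤ) :
    loopBot (shiftLoop a c S) = loopBot S + c := by
  refine (eq_sInf_iff (shiftLoop_nonempty hS a c) _).2 ?_
  simpa [mem_shiftLoop] using loopBot_spec hS

theorem loopRight_shiftLoop {S : Finset Stitch} (hS : S.Nonempty) (a c : ℤ) :
    loopRight (shiftLoop a c S) = loopRight S + a := by
  refine (eq_sSup_iff (shiftLoop_nonempty hS a c) _).2 ?_
  simpa [mem_shiftLoop] using loopRight_spec hS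

theorem loopTop_shiftLoop {S : Finset Stitch} (hS : S.Nonempty) (a c : ℤ) :
    loopTop (shiftLoop a c S) = loopTop S + c := by
  refine (eq_sSup_iff (shiftLoop_nonempty hS a c) _).2 ?_
  simpa [mem_shiftLoop] using loopTop_spec hS

theorem loopW_shiftLoop {S : Finset Stitch} (hS : S.Nonempty) (a c : ℤ) :
    loopW (shiftLoop a c S) = loopW S := by
  rw [loopW_eq, loopW_eq, loopLeft_shiftLoop hS, loopRight_shiftLoop hS]; ring

theorem loopH_shiftLoop {S : Finset Stitch} (hS : S.Nonempty) (a c : ℤ) :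
    loopH (shiftLoop a c S) = loopH S := by
  rw [loopH_eq, loopH_eq, loopBot_shiftLoop hS, loopTop_shiftLoop hS]; ring

theorem forall_inGrid_iff {S : Finset Stitch} (hS : S.Nonempty) (m n : ℕ) :
    (∀ s ∈ S, s.inGrid m n) ↔
    0 ≤ loopLeft S ∧ loopRight S ≤ n ∧ 0 ≤ loopBot S ∧ loopTop S ≤ m := by
  obtain ⟨⟨s1, hs1, h1⟩, h1'⟩ := loopLeft_spec hS
  obtain ⟨⟨s2, hs2, h2⟩, h2'⟩ := loopRight_spec hS
  obtain ⟨⟨s3, hs3, h3⟩, h3'⟩ := loopBot_spec hS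
  obtain ⟨⟨s4, hs4, h4⟩, h4'⟩ := loopTop_spec hS
  have key : ∀ s : Stitch, s.inGrid m n ↔
      0 ≤ s.minX ∧ s.maxX ≤ n ∧ 0 ≤ s.minY ∧ s.maxY ≤ m := by
    intro s
    cases s <;> simp only [Stitch.inGrid, Stitch.minX, Stitch.maxX, Stitch.minY, Stitch.maxY]
  simp only [key]
  refine ⟨fun h => ⟨h1 ▸ (h _ hs1).1, h2 ▸ (h _ hs2).2.1, h3 ▸ (h _ hs3).2.2.1,
    h4 ▸ (h _ hs4).2.2.2⟩, fun h s hs => ⟨h.1.trans (h1' s hs), (h2' s hs).trans h.2.1,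
    h.2.2.1.trans (h3' s hs), (h4' s hs).trans h.2.2.2⟩⟩

theorem loopLeft_le_loopRight {S : Finset Stitch} (hS : S.Nonempty) :
    loopLeft S ≤ loopRight S := by
  obtain ⟨s, hs⟩ := hS
  have h1 := (loopLeft_spec ⟨s, hs⟩).2 s hs
  have h2 := (loopRight_spec ⟨s, hs⟩).2 s hs
  have h3 : s.minX ≤ s.maxX := by cases s <;> simp [Stitch.minX, Stitch.maxX]
  omega

theorem loopBot_le_loopTop {S : Finset Stitch} (hS : S.Nonempty) :
    loopBot S ≤ loopTop S := by
  obtain ⟨s, hs⟩ := hS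
  have h1 := (loopBot_spec ⟨s, hs⟩).2 s hs
  have h2 := (loopTop_spec ⟨s, hs⟩).2 s hs
  have h3 : s.minY ≤ s.maxY := by cases s <;> simp [Stitch.minY, Stitch.maxY]
  omega

theorem extendLabels_of_mem {N : ℕ} (f : Fin (N + 1) → ZMod 2) {i : ℤ} (h0 : 0 ≤ i) (hN : i ≤ N) :
    extendLabels N f i = f ⟨i.toNat, by omega⟩ := by
  rw [extendLabels, dif_pos ⟨h0, hN⟩]

theorem card_labels_prescribed_on_Icc (N : ℕ) (e : ℤ → ZMod 2) {a b : ℤ} (h0 : 0 ≤ a)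
    (hab : a ≤ b) (hb : b ≤ N) :
    ((Finset.univ.filter fun f : Fin (N + 1) → ZMod 2 =>
      ∀ k : ℤ, a ≤ k → k ≤ b → extendLabels N f k = e k).card : ℝ) =
      2 ^ (N + 1) * (2 : ℝ) ^ (-(b - a + 1)) := by
  classical
  set K : Finset (Fin (N + 1)) := Finset.univ.filter fun k => a ≤ (k : ℤ) ∧ (k : ℤ) ≤ b with hK
  have hset : (Finset.univ.filter fun f : Fin (N + 1) → ZMod 2 =>
      ∀ k : ℤ, a ≤ k → k ≤ b → extendLabels N f k = e k) =
      Fintype.piFinset fun k : Fin (N + 1) => if k ∈ K then {e k} else Finset.univ := by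
    ext f
    simp only [Finset.mem_filter, Finset.mem_univ, true_and, Fintype.mem_piFinset, hK]
    constructor
    · intro h k
      split_ifs with hk
      · have := h k hk.1 hk.2
        rw [extendLabels_of_mem f (by omega) (by omega)] at this
        simpa using this
      · simp
    · intro h k h1 h2
      have h3 := h ⟨k.toNat, by omega⟩
      rw [extendLabels_of_mem f (by omega) (by omega)]
      have h4 : ((k.toNat : ℕ) : ℤ) = k := Int.toNat_of_nonneg (by omega)
      simpa [h4, h1, h2] using h3
  have hKcard : K.card = (b - a + 1).toNat := by
    rw [show (b - a + 1).toNat = (Finset.Icc a b).card by rw [Int.card_Icc]; congr 1; ring]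
    refine Finset.card_bij (fun k _ => (k : ℤ)) ?_ ?_ ?_
    · intro k hk
      simpa [hK] using hk
    · intro k _ l _ h
      exact Fin.ext (by exact_mod_cast h)
    · intro k hk
      rw [Finset.mem_Icc] at hk
      refine ⟨⟨k.toNat, by omega⟩, ?_, ?_⟩
      · simp only [hK, Finset.mem_filter, Finset.mem_univ, true_and]; omega
      · simp only; omega
  have hcard : (Fintype.piFinset fun k : Fin (N + 1) =>
      if k ∈ K then {e k} else Finset.univ).card * 2 ^ K.card = 2 ^ (N + 1) := by
    rw [Fintype.card_piFinset]
    have h1 : ∀ k : Fin (N + 1), (if k ∈ K then ({e k} : Finset (ZMod 2)) else Finset.univ).card =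
        if k ∈ K then 1 else 2 := by
      intro k
      split_ifs <;> simp
    simp only [h1]
    rw [← Finset.prod_const, Finset.prod_ite, Finset.prod_const_one, one_mul, Finset.prod_const,
      Finset.prod_const, ← pow_add, Finset.filter_not, Finset.filter_mem_eq_inter,
      Finset.univ_inter, Finset.card_sdiff_add_card_eq_card (Finset.subset_univ _)]
    simp
  rw [hset, zpow_neg, ← div_eq_mul_inv, eq_div_iff (by positivity)]
  rw [← Int.toNat_of_nonneg (show 0 ≤ b - a + 1 by omega), ← hKcard, zpow_natCast]
  exact_mod_cast hcard

/-- The labels of the grid lines met by a loop are all determined by the loop. -/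
theorem inPattern_iff_labels {S : Finset Stitch} (hS : IsCircle (curveOf ↑S)) {ε η : ℤ → ZMod 2}
    (hpat : ∀ s ∈ S, s.InPattern ε η) (ε' η' : ℤ → ZMod 2) :
    (∀ s ∈ S, s.InPattern ε' η') ↔
      (∀ k, loopLeft S ≤ k → k ≤ loopRight S → ε' k = ε k) ∧
      (∀ k, loopBot S ≤ k → k ≤ loopTop S → η' k = η k) := by
  have hne := hS.nonempty_of_curveOf
  obtain ⟨⟨s1, hs1, h1⟩, h1'⟩ := loopLeft_spec hne
  obtain ⟨⟨s2, hs2, h2⟩, h2'⟩ := loopRight_spec hne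
  obtain ⟨⟨s3, hs3, h3⟩, h3'⟩ := loopBot_spec hne
  obtain ⟨⟨s4, hs4, h4⟩, h4'⟩ := loopTop_spec hne
  constructor
  · refine fun h => ⟨fun k ha hb => ?_, fun k ha hb => ?_⟩
    · obtain ⟨j, hj⟩ := exists_vert_of_mem_Icc hS hpat hs1 hs2 (h1 ▸ ha) (h2 ▸ hb)
      exact (h _ hj).symm.trans (hpat _ hj)
    · obtain ⟨i, hi⟩ := exists_horiz_of_mem_Icc hS hpat hs3 hs4 (h3 ▸ ha) (h4 ▸ hb)
      exact (h _ hi).symm.trans (hpat _ hi)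
  · rintro ⟨hε, hη⟩ (⟨i, j⟩ | ⟨i, j⟩) hs
    · exact (hpat _ hs).trans (hε i (h1' _ hs) (h2' _ hs)).symm
    · exact (hpat _ hs).trans (hη j (h3' _ hs) (h4' _ hs)).symm

theorem card_labels_of_loop {m n : ℕ} {S : Finset Stitch} (hS : IsCircle (curveOf ↑S))
    (hpat : ∃ ε η : ℤ → ZMod 2, ∀ s ∈ S, s.InPattern ε η) (hgrid : ∀ s ∈ S, s.inGrid m n) :
    open Classical in
    ∑ f : Fin (n + 1) → ZMod 2, ∑ g : Fin (m + 1) → ZMod 2,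
      (if ∀ s ∈ S, s.InPattern (extendLabels n f) (extendLabels m g) then (1 : ℝ) else 0) =
      2 ^ (m + n + 2) * (2 : ℝ) ^ (-(loopW S + loopH S + 2)) := by
  classical
  obtain ⟨ε, η, hpat⟩ := hpat
  have hne := hS.nonempty_of_curveOf
  obtain ⟨g1, g2, g3, g4⟩ := (forall_inGrid_iff hne m n).1 hgrid
  simp only [inPattern_iff_labels hS hpat, ite_and]
  have hf := card_labels_prescribed_on_Icc n ε g1 (loopLeft_le_loopRight hne) g2
  have hg := card_labels_prescribed_on_Icc m η g3 (loopBot_le_loopTop hne) g4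
  rw [← Finset.sum_boole] at hf hg
  have h1 : ∀ (p q : Prop) [Decidable p] [Decidable q],
      (if p then if q then (1 : ℝ) else 0 else 0) =
      (if p then 1 else 0) * (if q then 1 else 0) := by
    intro p q _ _; split_ifs <;> simp
  simp only [h1, ← Finset.mul_sum, ← Finset.sum_mul]
  rw [hf, hg, mul_mul_mul_comm, ← pow_add, ← zpow_add₀ two_ne_zero, loopW_eq, loopH_eq]
  congr 2 <;> ring

theorem finite_loops_inGrid (m n : ℕ) :
    {S : Finset Stitch | (∃ ε η : ℤ → ZMod 2, ∀ s ∈ S, s.InPattern ε η) ∧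
      IsCircle (curveOf ↑S) ∧ ∀ s ∈ S, s.inGrid m n}.Finite := by
  have hgrid : {s : Stitch | s.inGrid m n}.Finite := by
    refine (((Set.finite_Icc 0 (n : ℤ)).prod (Set.finite_Icc 0 (m : ℤ))).image
      (fun p => Stitch.vert p.1 p.2) |>.union
      (((Set.finite_Icc 0 (n : ℤ)).prod (Set.finite_Icc 0 (m : ℤ))).image
      (fun p => Stitch.horiz p.1 p.2))).subset ?_
    rintro (⟨i, j⟩ | ⟨i, j⟩) h
    · exact Or.inl ⟨(i, j), by simp [Stitch.inGrid] at h ⊢; omega, rfl⟩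
    · exact Or.inr ⟨(i, j), by simp [Stitch.inGrid] at h ⊢; omega, rfl⟩
  refine hgrid.toFinset.powerset.finite_toSet.subset fun S hS => ?_
  rw [Finset.mem_coe, Finset.mem_powerset]
  exact fun s hs => hgrid.mem_toFinset.2 (hS.2.2 s hs)

/-- Linearity of expectation: each loop of the grid contributes its probability. -/
theorem ELoops_eq_sum (m n : ℕ) :
    ELoops m n = ∑ S ∈ (finite_loops_inGrid m n).toFinset,
      (2 : ℝ) ^ (-(loopW S + loopH S + 2)) := by
  classical
  have hcount : ∀ ε η : ℤ → ZMod 2, (LoopsCount m n ε η : ℝ) =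
      ∑ S ∈ (finite_loops_inGrid m n).toFinset,
        if ∀ s ∈ S, s.InPattern ε η then (1 : ℝ) else 0 := by
    intro ε η
    rw [Finset.sum_boole, LoopsCount]
    congr 1
    refine Nat.subtype_card _ fun S => ?_
    simp only [Finset.mem_filter, Set.Finite.mem_toFinset, Set.mem_ofPred_eq]
    constructor
    · rintro ⟨⟨-, h1, h2⟩, h3⟩
      exact ⟨h1, fun s hs => ⟨h3 s hs, h2 s hs⟩⟩
    · rintro ⟨h1, h2⟩
      exact ⟨⟨⟨ε, η, fun s hs => (h2 s hs).1⟩, h1, fun s hs => (h2 s hs).2⟩,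
        fun s hs => (h2 s hs).1⟩
  rw [ELoops, div_eq_iff (by positivity), Finset.sum_mul]
  simp only [hcount]
  rw [Finset.sum_congr rfl fun f _ => Finset.sum_comm, Finset.sum_comm]
  refine Finset.sum_congr rfl fun S hS => ?_
  obtain ⟨h1, h2, h3⟩ := (finite_loops_inGrid m n).mem_toFinset.1 hS
  rw [card_labels_of_loop h2 h1 h3, mul_comm]

theorem isNormLoop_iff {S : Finset Stitch} : IsNormLoop S ↔
    (∃ ε η : ℤ → ZMod 2, ∀ s ∈ S, s.InPattern ε η) ∧ IsCircle (curveOf ↑S) ∧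
      loopLeft S = 0 ∧ loopBot S = 0 := Iff.rfl

theorem finite_normLoops (m n : ℕ) :
    {S : Finset Stitch | IsNormLoop S ∧ loopH S ≤ (m : ℤ) ∧ loopW S ≤ (n : ℤ)}.Finite := by
  refine (finite_loops_inGrid m n).subset ?_
  rintro S ⟨hS, hH, hW⟩
  obtain ⟨h1, h2, h3, h4⟩ := isNormLoop_iff.1 hS
  rw [loopW_eq] at hW
  rw [loopH_eq] at hH
  refine ⟨h1, h2, (forall_inGrid_iff h2.nonempty_of_curveOf m n).2 ⟨?_, ?_, ?_, ?_⟩⟩ <;> omega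

/-- The translate of a set of stitches whose minimal coordinates are `0`. -/
noncomputable def normalizeLoop (S : Finset Stitch) : Finset Stitch :=
  shiftLoop (-loopLeft S) (-loopBot S) S

theorem normalizeLoop_mem {m n : ℕ} {S : Finset Stitch}
    (hS : S ∈ (finite_loops_inGrid m n).toFinset) :
    normalizeLoop S ∈ (finite_normLoops m n).toFinset := by
  obtain ⟨h1, h2, h3⟩ := (finite_loops_inGrid m n).mem_toFinset.1 hS
  have hne := h2.nonempty_of_curveOf
  obtain ⟨g1, g2, g3, g4⟩ := (forall_inGrid_iff hne m n).1 h3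
  rw [Set.Finite.mem_toFinset, Set.mem_ofPred_eq, isNormLoop_iff, normalizeLoop,
    loopLeft_shiftLoop hne, loopBot_shiftLoop hne, loopW_shiftLoop hne, loopH_shiftLoop hne,
    loopW_eq, loopH_eq]
  exact ⟨⟨exists_pattern_shiftLoop h1 _ _, isCircle_shiftLoop h2 _ _, by omega, by omega⟩,
    by omega, by omega⟩

theorem card_translates {m n : ℕ} {L : Finset Stitch}
    (hL : L ∈ (finite_normLoops m n).toFinset) :
    (((finite_loops_inGrid m n).toFinset.filter fun S => normalizeLoop S = L).card : ℝ) =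
      ((m : ℝ) + 1 - loopH L) * ((n : ℝ) + 1 - loopW L) := by
  obtain ⟨hL, hH, hW⟩ := (finite_normLoops m n).mem_toFinset.1 hL
  obtain ⟨h1, h2, h3, h4⟩ := isNormLoop_iff.1 hL
  have hne := h2.nonempty_of_curveOf
  have hcard : ((finite_loops_inGrid m n).toFinset.filter fun S => normalizeLoop S = L).card =
      (Finset.Icc 0 (m - loopH L) ×ˢ Finset.Icc 0 (n - loopW L)).card := by
    symm
    refine Finset.card_bij (fun p _ => shiftLoop p.2 p.1 L) ?_ ?_ ?_
    · rintro ⟨c, a⟩ hp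
      simp only [Finset.mem_product, Finset.mem_Icc, loopW_eq, loopH_eq] at hp
      simp only [Finset.mem_filter, Set.Finite.mem_toFinset, Set.mem_ofPred_eq,
        forall_inGrid_iff (shiftLoop_nonempty hne a c), loopLeft_shiftLoop hne,
        loopRight_shiftLoop hne, loopBot_shiftLoop hne, loopTop_shiftLoop hne]
      refine ⟨⟨exists_pattern_shiftLoop h1 _ _, isCircle_shiftLoop h2 _ _, ?_⟩, ?_⟩
      · omega
      · rw [normalizeLoop, shiftLoop_shiftLoop, loopLeft_shiftLoop hne, loopBot_shiftLoop hne,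
          h3, h4]
        simpa using shiftLoop_zero L
    · rintro ⟨c, a⟩ - ⟨c', a'⟩ - h
      have ha := congrArg loopLeft h
      have hc := congrArg loopBot h
      simp only [loopLeft_shiftLoop hne, loopBot_shiftLoop hne, add_right_inj] at ha hc
      rw [ha, hc]
    · intro S hS
      obtain ⟨hSmem, rfl⟩ := Finset.mem_filter.1 hS
      obtain ⟨-, k2, k3⟩ := (finite_loops_inGrid m n).mem_toFinset.1 hSmem
      have hne' := k2.nonempty_of_curveOf
      obtain ⟨g1, g2, g3, g4⟩ := (forall_inGrid_iff hne' m n).1 k3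
      refine ⟨(loopBot S, loopLeft S), ?_, ?_⟩
      · simp only [Finset.mem_product, Finset.mem_Icc]
        rw [normalizeLoop, loopW_shiftLoop hne', loopH_shiftLoop hne', loopW_eq, loopH_eq]
        omega
      · simp only [normalizeLoop, shiftLoop_shiftLoop]
        simpa using shiftLoop_zero S
  have htoNat : ∀ z : ℤ, 0 ≤ z → (z.toNat : ℝ) = z := fun z hz => by
    exact_mod_cast congrArg (Int.cast : ℤ → ℝ) (Int.toNat_of_nonneg hz)
  rw [hcard, Finset.card_product, Int.card_Icc, Int.card_Icc, Nat.cast_mul,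
    htoNat _ (by omega), htoNat _ (by omega)]
  push_cast
  ring

/-- Exact formula for the expected number of loops in the random
`m × n` hitomezashi pattern: it equals the sum, over loops `L ∈ 𝐋` (modulo translation)
with `height(L) ≤ m` and `width(L) ≤ n`, of
`2^{-(width(L)+height(L)+2)} (m+1-height(L)) (n+1-width(L))`. -/
theorem hitomezashi_exact_expected_loops (m n : ℕ) (hm : 0 < m) (hn : 0 < n) :
    ELoops m n =
      ∑' S : {S : Finset Stitch // IsNormLoop S ∧ loopH S ≤ (m : ℤ) ∧ loopW S ≤ (n : ℤ)},
        (2 : ℝ) ^ (-(loopW S.1 + loopH S.1 + 2)) *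
          ((m : ℝ) + 1 - (loopH S.1 : ℝ)) * ((n : ℝ) + 1 - (loopW S.1 : ℝ)) := by
  have htsum := Finset.tsum_subtype' (finite_normLoops m n).toFinset fun S : Finset Stitch =>
    (2 : ℝ) ^ (-(loopW S + loopH S + 2)) *
      ((m : ℝ) + 1 - (loopH S : ℝ)) * ((n : ℝ) + 1 - (loopW S : ℝ))
  rw [Set.Finite.coe_toFinset] at htsum
  refine Eq.trans ?_ htsum.symm
  rw [ELoops_eq_sum, ← Finset.sum_fiberwise_of_maps_to fun S hS => normalizeLoop_mem hS]
  refine Finset.sum_congr rfl fun L hL => ?_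
  rw [mul_assoc, ← card_translates hL, mul_comm, ← nsmul_eq_mul]
  refine Finset.sum_eq_card_nsmul fun S hS => ?_
  obtain ⟨hSmem, rfl⟩ := Finset.mem_filter.1 hS
  have hne := ((finite_loops_inGrid m n).mem_toFinset.1 hSmem).2.1.nonempty_of_curveOf
  rw [normalizeLoop, loopW_shiftLoop hne, loopH_shiftLoop hne]
end

section
/- The constant c := Σ_{L ∈ 𝐋} 2^{−(width(L)+height(L)+2)}, where the sum ranges over hitomezashi loops modulo translation, equals (π² − 9)/12. -/
namespace Hitomezashi

/-! ### Topology of grid curves -/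

theorem mem_seg_vert {i j : ℤ} {p : ℝ × ℝ} :
    p ∈ (Stitch.vert i j).seg ↔ p.1 = i ∧ (j : ℝ) ≤ p.2 ∧ p.2 ≤ j + 1 := by
  rw [Stitch.seg, ← Prod.image_mk_segment_right, segment_eq_Icc (by linarith)]
  constructor
  · rintro ⟨y, hy, rfl⟩
    exact ⟨rfl, hy⟩
  · rintro ⟨h1, h2⟩
    exact ⟨p.2, h2, by rw [← h1]⟩

theorem mem_seg_horiz {i j : ℤ} {p : ℝ × ℝ} :
    p ∈ (Stitch.horiz i j).seg ↔ p.2 = j ∧ (i : ℝ) ≤ p.1 ∧ p.1 ≤ i + 1 := by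
  rw [Stitch.seg, ← Prod.image_mk_segment_left, segment_eq_Icc (by linarith)]
  constructor
  · rintro ⟨y, hy, rfl⟩
    exact ⟨rfl, hy⟩
  · rintro ⟨h1, h2⟩
    exact ⟨p.1, h2, by rw [← h1]⟩

theorem isClosed_seg (s : Stitch) : IsClosed s.seg := by
  cases s with
  | vert i j =>
    have : (Stitch.vert i j).seg = {p : ℝ × ℝ | p.1 = i ∧ (j : ℝ) ≤ p.2 ∧ p.2 ≤ j + 1} :=
      Set.ext fun p => mem_seg_vert
    rw [this]
    exact (isClosed_eq continuous_fst continuous_const).inter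
      ((isClosed_le continuous_const continuous_snd).inter
        (isClosed_le continuous_snd continuous_const))
  | horiz i j =>
    have : (Stitch.horiz i j).seg = {p : ℝ × ℝ | p.2 = j ∧ (i : ℝ) ≤ p.1 ∧ p.1 ≤ i + 1} :=
      Set.ext fun p => mem_seg_horiz
    rw [this]
    exact (isClosed_eq continuous_snd continuous_const).inter
      ((isClosed_le continuous_const continuous_fst).inter
        (isClosed_le continuous_fst continuous_const))

theorem isClosed_curveOf {S : Set Stitch} (hS : S.Finite) : IsClosed (curveOf S) :=
  hS.isClosed_biUnion fun s _ => isClosed_seg s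

/-- The sphere of `ℝ × ℝ` (for the sup norm) is homeomorphic to the unit circle. -/
noncomputable def circleHomeoSphere : Circle ≃ₜ Metric.sphere (0 : ℝ × ℝ) 1 :=
  let φ := Complex.equivRealProdCLM
  Continuous.homeoOfEquivCompactToT2 (f :=
    { toFun := fun z => ⟨(‖φ z‖)⁻¹ • φ z, by
        have : φ (z : ℂ) ≠ 0 := by simp
        rw [mem_sphere_zero_iff_norm, norm_smul, norm_inv, norm_norm,
          inv_mul_cancel₀ (norm_ne_zero_iff.2 this)]⟩
      invFun := fun p => ⟨((‖φ.symm p.1‖)⁻¹ : ℝ) • φ.symm p.1, by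
        have : φ.symm p.1 ≠ 0 := by
          have := ne_zero_of_mem_unit_sphere p
          simpa using this
        rw [Submonoid.unitSphere]
        refine mem_sphere_zero_iff_norm.2 ?_
        rw [norm_smul, norm_inv, norm_norm, inv_mul_cancel₀ (norm_ne_zero_iff.2 this)]⟩
      left_inv := by
        intro z
        have h0 : ‖φ (z : ℂ)‖ ≠ 0 := by simp
        apply Circle.ext
        change ((‖φ.symm ((‖φ z‖)⁻¹ • φ z)‖)⁻¹ : ℝ) • φ.symm ((‖φ z‖)⁻¹ • φ z) = (z : ℂ)
        rw [map_smul, φ.symm_apply_apply, norm_smul, norm_inv, norm_norm, Circle.norm_coe,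
          mul_one, inv_inv, smul_smul, mul_inv_cancel₀ h0, one_smul]
      right_inv := by
        intro p
        have hp : ‖p.1‖ = 1 := mem_sphere_zero_iff_norm.1 p.2
        have h0 : ‖φ.symm p.1‖ ≠ 0 := by
          have := ne_zero_of_mem_unit_sphere p
          simpa using this
        apply Subtype.ext
        change (‖φ (((‖φ.symm p.1‖)⁻¹ : ℝ) • φ.symm p.1)‖)⁻¹ •
          φ (((‖φ.symm p.1‖)⁻¹ : ℝ) • φ.symm p.1) = p.1
        rw [map_smul, φ.apply_symm_apply, norm_smul, norm_inv, norm_norm, hp,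
          mul_one, inv_inv, smul_smul, mul_inv_cancel₀ h0, one_smul] })
    (by
      refine Continuous.subtype_mk ?_ _
      have hc : Continuous fun z : Circle => φ (z : ℂ) :=
        φ.continuous.comp continuous_subtype_val
      exact (hc.norm.inv₀ fun z => by simp).smul hc)

theorem isCircle_iff {C : Set (ℝ × ℝ)} {T : ℝ} (hT : T ≠ 0) :
    IsCircle C ↔ Nonempty (AddCircle T ≃ₜ C) := by
  let e := (AddCircle.homeomorphCircle hT).trans circleHomeoSphere
  exact ⟨fun ⟨f⟩ => ⟨e.trans f.symm⟩, fun ⟨f⟩ => ⟨f.symm.trans e⟩⟩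

theorem isPreconnected_compl_singleton_addCircle (x : AddCircle (1 : ℝ)) :
    IsPreconnected ({x}ᶜ : Set (AddCircle (1 : ℝ))) := by
  have : Fact (0 < (1 : ℝ)) := ⟨one_pos⟩
  obtain ⟨a, rfl⟩ := QuotientAddGroup.mk_surjective x
  have : ({(a : AddCircle (1 : ℝ))}ᶜ : Set (AddCircle (1 : ℝ))) =
      (fun t : ℝ => (t : AddCircle (1 : ℝ))) '' Set.Ioo a (a + 1) := by
    ext y
    constructor
    · intro hy
      have : y ∈ ((↑) : ℝ → AddCircle (1 : ℝ)) '' Set.Ico a (a + 1) := by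
        rw [AddCircle.coe_image_Ico_eq]; trivial
      obtain ⟨t, ht, rfl⟩ := this
      refine ⟨t, ⟨lt_of_le_of_ne ht.1 ?_, ht.2⟩, rfl⟩
      rintro rfl
      exact hy rfl
    · rintro ⟨t, ht, rfl⟩ h
      have h' : (t : AddCircle (1 : ℝ)) = a := h
      have := (AddCircle.coe_eq_coe_iff_of_mem_Ico (p := (1 : ℝ)) (a := a) (x := t) (y := a)
        ⟨ht.1.le, ht.2⟩ ⟨le_rfl, by linarith⟩).1 h'
      exact absurd this ht.1.ne'
  rw [show (QuotientAddGroup.mk a : AddCircle (1 : ℝ)) = (a : AddCircle (1 : ℝ)) from rfl, this]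
  exact isPreconnected_Ioo.image _ (AddCircle.continuous_mk' 1).continuousOn

theorem IsCircle.isConnected {C : Set (ℝ × ℝ)} (hC : IsCircle C) : IsConnected C := by
  have : Fact (0 < (1 : ℝ)) := ⟨one_pos⟩
  obtain ⟨f⟩ := (isCircle_iff one_ne_zero).1 hC
  have : ConnectedSpace C := f.surjective.connectedSpace f.continuous
  exact isConnected_iff_connectedSpace.2 this

theorem IsCircle.isPreconnected_diff {C : Set (ℝ × ℝ)} (hC : IsCircle C) {m : ℝ × ℝ}
    (hm : m ∈ C) : IsPreconnected (C \ {m}) := by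
  obtain ⟨f⟩ := (isCircle_iff one_ne_zero).1 hC
  have h := isPreconnected_compl_singleton_addCircle (f.symm ⟨m, hm⟩)
  have h2 := h.image (fun x => (f x : ℝ × ℝ))
    (continuous_subtype_val.comp f.continuous).continuousOn
  convert h2 using 1
  ext p
  constructor
  · rintro ⟨hp, hpm⟩
    refine ⟨f.symm ⟨p, hp⟩, ?_, by simp⟩
    intro h
    apply hpm
    have := f.symm.injective h
    exact congrArg Subtype.val this
  · rintro ⟨x, hx, rfl⟩
    refine ⟨(f x).2, ?_⟩
    intro h
    apply hx
    rw [Set.mem_singleton_iff, ← f.symm_apply_apply x]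
    congr 1
    exact Subtype.ext h

/-- `IsEnd s a b` says that the vertex `(a, b)` is an endpoint of `s`. -/
def IsEnd : Stitch → ℤ → ℤ → Prop
  | .vert i j, a, b => a = i ∧ (b = j ∨ b = j + 1)
  | .horiz i j, a, b => b = j ∧ (a = i ∨ a = i + 1)

theorem isEnd_iff {s : Stitch} {a b : ℤ} : IsEnd s a b ↔ ((a : ℝ), (b : ℝ)) ∈ s.seg := by
  cases s with
  | vert i j =>
    rw [mem_seg_vert]
    dsimp only [IsEnd]
    norm_cast
    omega
  | horiz i j =>
    rw [mem_seg_horiz]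
    dsimp only [IsEnd]
    norm_cast
    omega

theorem eq_or_common_end {s t : Stitch} {p : ℝ × ℝ} (hs : p ∈ s.seg) (ht : p ∈ t.seg) :
    s = t ∨ ∃ a b, IsEnd s a b ∧ IsEnd t a b := by
  cases s with
  | vert i j =>
    cases t with
    | vert i' j' =>
      rw [mem_seg_vert] at hs ht
      obtain ⟨h1, h2, h3⟩ := hs
      obtain ⟨h4, h5, h6⟩ := ht
      have e1 : i = i' := by exact_mod_cast h1.symm.trans h4
      have e2 : j ≤ j' + 1 := by exact_mod_cast h2.trans h6
      have e3 : j' ≤ j + 1 := by exact_mod_cast h5.trans h3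
      subst e1
      obtain h | h | h : j = j' ∨ j' = j + 1 ∨ j = j' + 1 := by omega
      · left; rw [h]
      · exact Or.inr ⟨i, j', by simp [IsEnd, h]⟩
      · exact Or.inr ⟨i, j, by simp [IsEnd, h]⟩
    | horiz i' j' =>
      rw [mem_seg_vert] at hs
      rw [mem_seg_horiz] at ht
      obtain ⟨h1, h2, h3⟩ := hs
      obtain ⟨h4, h5, h6⟩ := ht
      rw [h4] at h2 h3
      rw [h1] at h5 h6
      norm_cast at h2 h3 h5 h6
      exact Or.inr ⟨i, j', by simp only [IsEnd, true_and]; omega⟩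
  | horiz i j =>
    cases t with
    | vert i' j' =>
      rw [mem_seg_vert] at ht
      rw [mem_seg_horiz] at hs
      obtain ⟨h1, h2, h3⟩ := hs
      obtain ⟨h4, h5, h6⟩ := ht
      rw [h4] at h2 h3
      rw [h1] at h5 h6
      norm_cast at h2 h3 h5 h6
      exact Or.inr ⟨i', j, by simp only [IsEnd, true_and]; omega⟩
    | horiz i' j' =>
      rw [mem_seg_horiz] at hs ht
      obtain ⟨h1, h2, h3⟩ := hs
      obtain ⟨h4, h5, h6⟩ := ht
      have e1 : j = j' := by exact_mod_cast h1.symm.trans h4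
      have e2 : i ≤ i' + 1 := by exact_mod_cast h2.trans h6
      have e3 : i' ≤ i + 1 := by exact_mod_cast h5.trans h3
      subst e1
      obtain h | h | h : i = i' ∨ i' = i + 1 ∨ i = i' + 1 := by omega
      · left; rw [h]
      · exact Or.inr ⟨i', j, by simp [IsEnd, h]⟩
      · exact Or.inr ⟨i, j, by simp [IsEnd, h]⟩

/-- A vertex property preserved along the stitches of a closed curve holds at all of its
vertices or at none. -/
theorem forall_or_forall_not_of_isCircle {S : Finset Stitch} (hC : IsCircle (curveOf ↑S))
    (P : ℤ → ℤ → Prop) (hV : ∀ i j, .vert i j ∈ S → (P i j ↔ P i (j + 1)))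
    (hH : ∀ i j, .horiz i j ∈ S → (P i j ↔ P (i + 1) j)) :
    (∀ s ∈ S, ∀ a b, IsEnd s a b → P a b) ∨ (∀ s ∈ S, ∀ a b, IsEnd s a b → ¬ P a b) := by
  have key : ∀ s ∈ S, ∀ a b, IsEnd s a b → (P a b ↔ P s.minX s.minY) := by
    intro s hs a b h
    cases s with
    | vert i j =>
      obtain ⟨rfl, rfl | rfl⟩ := h
      · rfl
      · exact (hV _ _ hs).symm
    | horiz i j =>
      obtain ⟨rfl, rfl | rfl⟩ := h
      · rfl
      · exact (hH _ _ hs).symm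
  by_contra hcon
  push Not at hcon
  obtain ⟨⟨s, hs, a, b, hab, hPs⟩, t, ht, c, d, hcd, hPt⟩ := hcon
  rw [key s hs a b hab] at hPs
  rw [key t ht c d hcd] at hPt
  have hpre := isPreconnected_closed_iff.1 (IsCircle.isConnected hC).isPreconnected
    (curveOf {s | s ∈ S ∧ P s.minX s.minY}) (curveOf {s | s ∈ S ∧ ¬ P s.minX s.minY})
    (isClosed_curveOf (S.finite_toSet.subset fun s h => h.1))
    (isClosed_curveOf (S.finite_toSet.subset fun s h => h.1))
    (by
      intro p hp
      obtain ⟨r, hr, hpr⟩ := Set.mem_iUnion₂.1 hp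
      by_cases h : P r.minX r.minY
      · exact Or.inl (Set.mem_iUnion₂.2 ⟨r, ⟨hr, h⟩, hpr⟩)
      · exact Or.inr (Set.mem_iUnion₂.2 ⟨r, ⟨hr, h⟩, hpr⟩))
    ⟨(c, d), Set.mem_iUnion₂.2 ⟨t, ht, isEnd_iff.1 hcd⟩,
      Set.mem_iUnion₂.2 ⟨t, ⟨ht, hPt⟩, isEnd_iff.1 hcd⟩⟩
    ⟨(a, b), Set.mem_iUnion₂.2 ⟨s, hs, isEnd_iff.1 hab⟩,
      Set.mem_iUnion₂.2 ⟨s, ⟨hs, hPs⟩, isEnd_iff.1 hab⟩⟩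
  obtain ⟨p, -, h1, h2⟩ := hpre
  obtain ⟨s', ⟨hs', hPs'⟩, hp1⟩ := Set.mem_iUnion₂.1 h1
  obtain ⟨t', ⟨ht', hPt'⟩, hp2⟩ := Set.mem_iUnion₂.1 h2
  obtain rfl | ⟨x, y, hx, hy⟩ := eq_or_common_end hp1 hp2
  · exact hPt' hPs'
  · exact hPt' ((key t' ht' x y hy).1 ((key s' hs' x y hx).2 hPs'))

theorem one_le_dist_of_not_isEnd {t : Stitch} {a b : ℤ} (h : ¬ IsEnd t a b) {p : ℝ × ℝ}
    (hp : p ∈ t.seg) : 1 ≤ dist p ((a : ℝ), (b : ℝ)) := by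
  rw [Prod.dist_eq, Real.dist_eq, Real.dist_eq, le_max_iff]
  cases t with
  | vert i j =>
    rw [mem_seg_vert] at hp
    obtain ⟨h1, h2, h3⟩ := hp
    simp only [IsEnd] at h
    by_cases hi : a = i
    · right
      obtain hb | hb : b + 1 ≤ j ∨ j + 2 ≤ b := by omega
      · have : (b : ℝ) + 1 ≤ j := by exact_mod_cast hb
        rw [le_abs]; left; dsimp only; linarith
      · have : (j : ℝ) + 2 ≤ b := by exact_mod_cast hb
        rw [le_abs]; right; dsimp only; linarith
    · left
      rw [h1, ← Int.cast_sub, ← Int.cast_abs]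
      exact_mod_cast Int.one_le_abs (by omega)
  | horiz i j =>
    rw [mem_seg_horiz] at hp
    obtain ⟨h1, h2, h3⟩ := hp
    simp only [IsEnd] at h
    by_cases hi : b = j
    · left
      obtain hb | hb : a + 1 ≤ i ∨ i + 2 ≤ a := by omega
      · have : (a : ℝ) + 1 ≤ i := by exact_mod_cast hb
        rw [le_abs]; left; dsimp only; linarith
      · have : (i : ℝ) + 2 ≤ a := by exact_mod_cast hb
        rw [le_abs]; right; dsimp only; linarith
    · right
      rw [h1, ← Int.cast_sub, ← Int.cast_abs]
      exact_mod_cast Int.one_le_abs (by omega)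

theorem exists_dist_eq {e : Stitch} {a b : ℤ} (h : IsEnd e a b) :
    (∃ u ∈ e.seg, dist u ((a : ℝ), (b : ℝ)) = 1) ∧
    ∃ m ∈ e.seg, dist m ((a : ℝ), (b : ℝ)) = 1 / 2 ∧
      ∀ p ∈ e.seg, dist p ((a : ℝ), (b : ℝ)) = 1 / 2 → p = m := by
  cases e with
  | vert i j =>
    have hd : ∀ p ∈ (Stitch.vert i j).seg, dist p ((a : ℝ), (b : ℝ)) = |p.2 - b| := by
      intro p hp
      rw [mem_seg_vert] at hp
      rw [Prod.dist_eq, Real.dist_eq, Real.dist_eq, hp.1, h.1]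
      simp
    have hu : ((i : ℝ), ((j + (j + 1 - b) : ℤ) : ℝ)) ∈ (Stitch.vert i j).seg := by
      rw [← isEnd_iff]
      obtain ⟨-, h | h⟩ := h <;> (simp only [IsEnd, true_and]; omega)
    have hm : ((i : ℝ), (j : ℝ) + 1 / 2) ∈ (Stitch.vert i j).seg := by
      rw [mem_seg_vert]; dsimp only; refine ⟨rfl, ?_, ?_⟩ <;> linarith
    refine ⟨⟨_, hu, ?_⟩, _, hm, ?_, ?_⟩
    · rw [hd _ hu]
      obtain ⟨-, rfl | rfl⟩ := h <;> simp
    · rw [hd _ hm]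
      obtain ⟨-, rfl | rfl⟩ := h
      · simp
      · push_cast
        rw [show (j : ℝ) + 1 / 2 - (j + 1) = -(1 / 2) by ring, abs_neg, abs_of_pos (by norm_num)]
    · intro p hp hp2
      rw [hd _ hp] at hp2
      rw [mem_seg_vert] at hp
      refine Prod.ext hp.1 ?_
      obtain ⟨-, rfl | rfl⟩ := h
      · rw [abs_of_nonneg (by linarith [hp.2.1])] at hp2
        dsimp only; linarith
      · push_cast at hp2
        rw [abs_of_nonpos (by linarith [hp.2.2])] at hp2
        dsimp only; linarith
  | horiz i j =>
    have hd : ∀ p ∈ (Stitch.horiz i j).seg, dist p ((a : ℝ), (b : ℝ)) = |p.1 - a| := by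
      intro p hp
      rw [mem_seg_horiz] at hp
      rw [Prod.dist_eq, Real.dist_eq, Real.dist_eq, hp.1, h.1]
      simp
    have hu : (((i + (i + 1 - a) : ℤ) : ℝ), (j : ℝ)) ∈ (Stitch.horiz i j).seg := by
      rw [← isEnd_iff]
      obtain ⟨-, h | h⟩ := h <;> (simp only [IsEnd, true_and]; omega)
    have hm : ((i : ℝ) + 1 / 2, (j : ℝ)) ∈ (Stitch.horiz i j).seg := by
      rw [mem_seg_horiz]; dsimp only; refine ⟨rfl, ?_, ?_⟩ <;> linarith
    refine ⟨⟨_, hu, ?_⟩, _, hm, ?_, ?_⟩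
    · rw [hd _ hu]
      obtain ⟨-, rfl | rfl⟩ := h <;> simp
    · rw [hd _ hm]
      obtain ⟨-, rfl | rfl⟩ := h
      · simp
      · push_cast
        rw [show (i : ℝ) + 1 / 2 - (i + 1) = -(1 / 2) by ring, abs_neg, abs_of_pos (by norm_num)]
    · intro p hp hp2
      rw [hd _ hp] at hp2
      rw [mem_seg_horiz] at hp
      refine Prod.ext ?_ hp.1
      obtain ⟨-, rfl | rfl⟩ := h
      · rw [abs_of_nonneg (by linarith [hp.2.1])] at hp2
        dsimp only; linarith
      · push_cast at hp2
        rw [abs_of_nonpos (by linarith [hp.2.2])] at hp2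
        dsimp only; linarith

/-- A closed curve has no dangling stitch. -/
theorem exists_ne_isEnd_of_isCircle {S : Finset Stitch} (hC : IsCircle (curveOf ↑S))
    {e : Stitch} (he : e ∈ S) {a b : ℤ} (hab : IsEnd e a b) :
    ∃ t ∈ S, t ≠ e ∧ IsEnd t a b := by
  by_contra hcon
  push Not at hcon
  set v : ℝ × ℝ := ((a : ℝ), (b : ℝ)) with hv
  obtain ⟨⟨u, hu, hud⟩, m, hm, hmd, hmu⟩ := exists_dist_eq hab
  have hmem : ∀ {p}, p ∈ e.seg → p ∈ curveOf ↑S := fun hp => Set.mem_iUnion₂.2 ⟨e, he, hp⟩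
  have hvm : v ≠ m := by
    rintro rfl
    rw [dist_self] at hmd; norm_num at hmd
  have hum : u ≠ m := by
    rintro rfl
    rw [hud] at hmd; norm_num at hmd
  have hpre := IsCircle.isPreconnected_diff hC (hmem hm)
    {p | dist p v < 1 / 2} {p | 1 / 2 < dist p v}
    (isOpen_lt (continuous_id.dist continuous_const) continuous_const)
    (isOpen_lt continuous_const (continuous_id.dist continuous_const))
    (by
      rintro p ⟨hp, hpm⟩
      obtain ⟨t, ht, hpt⟩ := Set.mem_iUnion₂.1 hp
      rcases lt_trichotomy (dist p v) (1 / 2) with h | h | h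
      · exact Or.inl h
      · exfalso
        by_cases hte : t = e
        · subst hte
          exact hpm (hmu p hpt h)
        · have := one_le_dist_of_not_isEnd (hcon t ht hte) hpt
          rw [h] at this
          norm_num at this
      · exact Or.inr h)
    ⟨v, ⟨hmem (isEnd_iff.1 hab), hvm⟩, by simp⟩
    ⟨u, ⟨hmem hu, hum⟩, by rw [Set.mem_ofPred_eq, hud]; norm_num⟩
  obtain ⟨p, -, h1, h2⟩ := hpre
  exact lt_asymm (show dist p v < 1 / 2 from h1) (show 1 / 2 < dist p v from h2)

theorem even_iff_of_inPattern {ε η : ℤ → ZMod 2} {S : Finset Stitch}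
    (hS : ∀ s ∈ S, s.InPattern ε η) (hC : IsCircle (curveOf ↑S)) (i j : ℤ) :
    (.vert i j ∈ S ∨ .vert i (j - 1) ∈ S) ↔ (.horiz i j ∈ S ∨ .horiz (i - 1) j ∈ S) := by
  have ne1 : ∀ x : ZMod 2, x - 1 ≠ x := by decide
  constructor
  · intro h
    obtain ⟨e, he, hends⟩ : ∃ e ∈ S, (e = .vert i j ∨ e = .vert i (j - 1)) := by
      rcases h with h | h
      · exact ⟨_, h, Or.inl rfl⟩
      · exact ⟨_, h, Or.inr rfl⟩
    obtain ⟨t, ht, hte, hab⟩ := exists_ne_isEnd_of_isCircle hC he (a := i) (b := j)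
      (by rcases hends with rfl | rfl <;> simp [IsEnd])
    cases t with
    | vert i' j' =>
      exfalso
      obtain ⟨rfl, hj⟩ := hab
      have h1 := hS _ ht
      have h2 := hS _ he
      have hj : j' = j ∨ j' = j - 1 := by omega
      rcases hends with rfl | rfl <;> rcases hj with rfl | rfl
      · exact hte rfl
      · simp only [Stitch.InPattern, Int.cast_sub, Int.cast_one] at h1 h2
        exact ne1 _ (h1.trans h2.symm)
      · simp only [Stitch.InPattern, Int.cast_sub, Int.cast_one] at h1 h2
        exact ne1 _ (h2.trans h1.symm)
      · exact hte rfl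
    | horiz i' j' =>
      obtain ⟨rfl, rfl | rfl⟩ := hab
      · exact Or.inl ht
      · right; simpa using ht
  · intro h
    obtain ⟨e, he, hends⟩ : ∃ e ∈ S, (e = .horiz i j ∨ e = .horiz (i - 1) j) := by
      rcases h with h | h
      · exact ⟨_, h, Or.inl rfl⟩
      · exact ⟨_, h, Or.inr rfl⟩
    obtain ⟨t, ht, hte, hab⟩ := exists_ne_isEnd_of_isCircle hC he (a := i) (b := j)
      (by rcases hends with rfl | rfl <;> simp [IsEnd])
    cases t with
    | horiz i' j' =>
      exfalso
      obtain ⟨rfl, hj⟩ := hab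
      have h1 := hS _ ht
      have h2 := hS _ he
      have hj : i' = i ∨ i' = i - 1 := by omega
      rcases hends with rfl | rfl <;> rcases hj with rfl | rfl
      · exact hte rfl
      · simp only [Stitch.InPattern, Int.cast_sub, Int.cast_one] at h1 h2
        exact ne1 _ (h1.trans h2.symm)
      · simp only [Stitch.InPattern, Int.cast_sub, Int.cast_one] at h1 h2
        exact ne1 _ (h2.trans h1.symm)
      · exact hte rfl
    | vert i' j' =>
      obtain ⟨rfl, rfl | rfl⟩ := hab
      · exact Or.inl ht
      · right; simpa using ht

/-- A lattice point as a point of the plane. -/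
def toPt (v : ℤ × ℤ) : ℝ × ℝ := (v.1, v.2)

/-- The `ℓ¹`-distance from a point of the plane to a lattice point. -/
def dist₁ (p : ℝ × ℝ) (v : ℤ × ℤ) : ℝ := |p.1 - v.1| + |p.2 - v.2|

/-- `v'` is a neighbour of `v` in the grid. -/
def UnitStep (v v' : ℤ × ℤ) : Prop :=
  v' = (v.1 + 1, v.2) ∨ v' = (v.1 - 1, v.2) ∨ v' = (v.1, v.2 + 1) ∨ v' = (v.1, v.2 - 1)

theorem one_le_abs_sub {a c : ℤ} (h : c ≠ a) : (1 : ℝ) ≤ |(a : ℝ) - c| := by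
  rw [← Int.cast_sub, ← Int.cast_abs]
  exact_mod_cast Int.one_le_abs (by omega)

theorem one_le_abs_add_sub {a c : ℤ} {f : ℝ} (hf0 : 0 ≤ f) (hf1 : f ≤ 1) (h : c ≠ a)
    (h' : c ≠ a + 1) : 1 ≤ |(a : ℝ) + f - c| := by
  obtain hc | hc : c + 1 ≤ a ∨ a + 2 ≤ c := by omega
  · have : (c : ℝ) + 1 ≤ a := by exact_mod_cast hc
    rw [le_abs]; left; linarith
  · have : (a : ℝ) + 2 ≤ c := by exact_mod_cast hc
    rw [le_abs]; right; linarith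

theorem one_le_abs_sub_sub {a c : ℤ} {f : ℝ} (hf0 : 0 ≤ f) (hf1 : f ≤ 1) (h : c ≠ a)
    (h' : c ≠ a - 1) : 1 ≤ |(a : ℝ) - f - c| := by
  obtain hc | hc : c + 2 ≤ a ∨ a + 1 ≤ c := by omega
  · have : (c : ℝ) + 2 ≤ a := by exact_mod_cast hc
    rw [le_abs]; left; linarith
  · have : (a : ℝ) + 1 ≤ c := by exact_mod_cast hc
    rw [le_abs]; right; linarith

theorem dist₁_lineMap {v v' : ℤ × ℤ} (h : UnitStep v v') {f : ℝ} (hf0 : 0 ≤ f) (hf1 : f ≤ 1) :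
    dist₁ (AffineMap.lineMap (toPt v) (toPt v') f) v = f ∧
    dist₁ (AffineMap.lineMap (toPt v) (toPt v') f) v' = 1 - f ∧
    ∀ w, w ≠ v → w ≠ v' → 1 ≤ dist₁ (AffineMap.lineMap (toPt v) (toPt v') f) w := by
  obtain ⟨a, b⟩ := v
  rw [AffineMap.lineMap_apply]
  rcases h with rfl | rfl | rfl | rfl
  all_goals
    simp only [dist₁, toPt, vsub_eq_sub, vadd_eq_add, Prod.smul_fst, Prod.smul_snd, Prod.fst_add,
      Prod.snd_add, Prod.fst_sub, Prod.snd_sub, smul_eq_mul, Int.cast_add, Int.cast_sub,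
      Int.cast_one, Prod.forall, ne_eq, Prod.mk.injEq, not_and]
    ring_nf
    refine ⟨?_, ?_, ?_⟩
  · simp [abs_of_nonneg hf0]
  · rw [abs_zero, zero_add, show -1 + f = -(1 - f) by ring, abs_neg, abs_of_nonneg (by linarith)]
  · intro c d h1 h2
    by_cases hd : d = b
    · have := one_le_abs_add_sub hf0 hf1 (fun h => h1 h hd) (fun h => h2 (by omega) hd)
      have h4 := abs_nonneg ((b : ℝ) - d)
      rw [show f + (a : ℝ) - c = a + f - c by ring]
      linarith
    · have h3 := one_le_abs_sub hd
      have h4 := abs_nonneg (f + (a : ℝ) - c)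
      linarith
  · simp [abs_of_nonneg hf0]
  · rw [abs_zero, zero_add, abs_of_nonneg (by linarith)]
  · intro c d h1 h2
    by_cases hd : d = b
    · have := one_le_abs_sub_sub hf0 hf1 (fun h => h1 h hd) (fun h => h2 (by omega) hd)
      have h4 := abs_nonneg ((b : ℝ) - d)
      rw [show -f + (a : ℝ) - c = a - f - c by ring]
      linarith
    · have h3 := one_le_abs_sub hd
      have h4 := abs_nonneg (-f + (a : ℝ) - c)
      linarith
  · simp [abs_of_nonneg hf0]
  · rw [abs_zero, zero_add, show -1 + f = -(1 - f) by ring, abs_neg, abs_of_nonneg (by linarith)]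
  · intro c d h1 h2
    by_cases hc : c = a
    · have := one_le_abs_add_sub hf0 hf1 (fun h => h1 hc h) (fun h => h2 hc (by omega))
      have h4 := abs_nonneg ((a : ℝ) - c)
      rw [show f + (b : ℝ) - d = b + f - d by ring]
      linarith
    · have h3 := one_le_abs_sub hc
      have h4 := abs_nonneg (f + (b : ℝ) - d)
      linarith
  · simp [abs_of_nonneg hf0]
  · rw [abs_zero, zero_add, abs_of_nonneg (by linarith)]
  · intro c d h1 h2
    by_cases hc : c = a
    · have := one_le_abs_sub_sub hf0 hf1 (fun h => h1 hc h) (fun h => h2 hc (by omega))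
      have h4 := abs_nonneg ((a : ℝ) - c)
      rw [show -f + (b : ℝ) - d = b - f - d by ring]
      linarith
    · have h3 := one_le_abs_sub hc
      have h4 := abs_nonneg (-f + (b : ℝ) - d)
      linarith

/-- The piecewise affine path through a sequence of lattice points. -/
noncomputable def polyPath (u : ℤ → ℤ × ℤ) (t : ℝ) : ℝ × ℝ :=
  AffineMap.lineMap (toPt (u ⌊t⌋)) (toPt (u (⌊t⌋ + 1))) (Int.fract t)

theorem polyPath_eq (u : ℤ → ℤ × ℤ) (m : ℤ) {t : ℝ} (h0 : m ≤ t) (h1 : t ≤ m + 1) :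
    polyPath u t = AffineMap.lineMap (toPt (u m)) (toPt (u (m + 1))) (t - m) := by
  rcases h1.lt_or_eq with h1 | rfl
  · have : ⌊t⌋ = m := Int.floor_eq_iff.2 ⟨h0, h1⟩
    rw [polyPath, Int.fract, this]
  · have : ⌊(m : ℝ) + 1⌋ = m + 1 := by
      rw [Int.floor_add_one, Int.floor_intCast]
    rw [polyPath, Int.fract, this]
    simp

theorem continuous_polyPath (u : ℤ → ℤ × ℤ) : Continuous (polyPath u) := by
  refine LocallyFinite.continuous (f := fun m : ℤ => Set.Icc (m : ℝ) (m + 1)) ?_ ?_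
    (fun _ => isClosed_Icc) ?_
  · intro x
    refine ⟨Set.Ioo (x - 1) (x + 1), Ioo_mem_nhds (by linarith) (by linarith), ?_⟩
    refine (Set.finite_Icc (⌊x⌋ - 3) (⌊x⌋ + 3)).subset ?_
    rintro m ⟨y, ⟨h1, h2⟩, h3, h4⟩
    have h5 := Int.floor_le x
    have h6 := Int.lt_floor_add_one x
    have a1 : ((⌊x⌋ - 3 : ℤ) : ℝ) ≤ m := by push_cast; linarith
    have a2 : (m : ℝ) ≤ ((⌊x⌋ + 3 : ℤ) : ℝ) := by push_cast; linarith
    exact ⟨by exact_mod_cast a1, by exact_mod_cast a2⟩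
  · rw [Set.eq_univ_iff_forall]
    intro t
    exact Set.mem_iUnion.2 ⟨⌊t⌋, Int.floor_le t, (Int.lt_floor_add_one t).le⟩
  · intro m
    refine ContinuousOn.congr (f := fun t : ℝ =>
      AffineMap.lineMap (toPt (u m)) (toPt (u (m + 1))) (t - m)) ?_
      fun t ht => polyPath_eq u m ht.1 ht.2
    exact (AffineMap.lineMap_continuous.comp (continuous_id.sub continuous_const)).continuousOn

theorem range_polyPath (u : ℤ → ℤ × ℤ) :
    Set.range (polyPath u) = ⋃ a, segment ℝ (toPt (u a)) (toPt (u (a + 1))) := by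
  ext p
  simp only [Set.mem_range, Set.mem_iUnion, segment_eq_image_lineMap]
  constructor
  · rintro ⟨t, rfl⟩
    exact ⟨⌊t⌋, Int.fract t, ⟨Int.fract_nonneg t, (Int.fract_lt_one t).le⟩, rfl⟩
  · rintro ⟨m, f, hf, rfl⟩
    refine ⟨m + f, ?_⟩
    rw [polyPath_eq u m (by linarith [hf.1]) (by linarith [hf.2])]
    congr 1
    ring

theorem polyPath_eq_polyPath {N : ℕ} (hN : 3 ≤ N) {u : ℤ → ℤ × ℤ}
    (hu : ∀ a b, u a = u b ↔ (N : ℤ) ∣ a - b) (hstep : ∀ a, UnitStep (u a) (u (a + 1)))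
    {t t' : ℝ} (h : polyPath u t = polyPath u t') :
    u ⌊t⌋ = u ⌊t'⌋ ∧ Int.fract t = Int.fract t' := by
  obtain ⟨h1, h2, -⟩ := dist₁_lineMap (hstep ⌊t⌋) (Int.fract_nonneg t) (Int.fract_lt_one t).le
  obtain ⟨h4, h5, h6⟩ :=
    dist₁_lineMap (hstep ⌊t'⌋) (Int.fract_nonneg t') (Int.fract_lt_one t').le
  change dist₁ (polyPath u t) _ = _ at h1 h2
  change dist₁ (polyPath u t') _ = _ at h4 h5
  change ∀ w, w ≠ u ⌊t'⌋ → w ≠ u (⌊t'⌋ + 1) → 1 ≤ dist₁ (polyPath u t') w at h6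
  rw [h] at h1 h2
  have f0 := Int.fract_nonneg t
  have f1 := Int.fract_lt_one t
  have f0' := Int.fract_nonneg t'
  have f1' := Int.fract_lt_one t'
  by_cases e1 : u ⌊t⌋ = u ⌊t'⌋
  · rw [e1] at h1
    exact ⟨e1, by linarith⟩
  exfalso
  have e2 : u ⌊t⌋ = u (⌊t'⌋ + 1) := by
    by_contra hne
    linarith [h6 _ e1 hne]
  rw [e2] at h1
  have e3 : u (⌊t⌋ + 1) ≠ u (⌊t'⌋ + 1) := by
    intro h7
    exact e1 ((hu _ _).2 (by simpa using (hu _ _).1 h7))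
  have e4 : u (⌊t⌋ + 1) = u ⌊t'⌋ := by
    by_contra hne
    linarith [h6 _ hne e3]
  rw [hu] at e2 e4
  have h8 := dvd_sub e4 e2
  rw [show ⌊t⌋ + 1 - ⌊t'⌋ - (⌊t⌋ - (⌊t'⌋ + 1)) = 2 by ring] at h8
  have := Int.le_of_dvd (by norm_num) h8
  omega

/-- A simple closed lattice path is a topological circle. -/
theorem isCircle_of_cycle {N : ℕ} (hN : 3 ≤ N) {u : ℤ → ℤ × ℤ}
    (hu : ∀ a b, u a = u b ↔ (N : ℤ) ∣ a - b) (hstep : ∀ a, UnitStep (u a) (u (a + 1))) :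
    IsCircle (⋃ a, segment ℝ (toPt (u a)) (toPt (u (a + 1)))) := by
  have hN0 : (0 : ℝ) < N := by exact_mod_cast (by omega : 0 < N)
  have : Fact ((0 : ℝ) < N) := ⟨hN0⟩
  have hper : Function.Periodic (polyPath u) (N : ℝ) := by
    intro t
    have e : ∀ m : ℤ, u (m + N) = u m := fun m => (hu _ _).2 (by simp)
    have e1 : ⌊t + (N : ℝ)⌋ = ⌊t⌋ + N := Int.floor_add_natCast t N
    have e2 : Int.fract (t + (N : ℝ)) = Int.fract t := Int.fract_add_natCast t N
    rw [polyPath, polyPath, e1, e2, e, add_right_comm, e]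
  rw [← range_polyPath, isCircle_iff hN0.ne']
  let F : AddCircle (N : ℝ) → Set.range (polyPath u) :=
    fun x => ⟨hper.lift x, by
      obtain ⟨t, rfl⟩ := QuotientAddGroup.mk_surjective x
      exact ⟨t, rfl⟩⟩
  have hF : Continuous F := by
    refine Continuous.subtype_mk ?_ _
    exact continuous_quot_lift _ (continuous_polyPath u)
  have hbij : Function.Bijective F := by
    constructor
    · intro x y hxy
      obtain ⟨t, rfl⟩ := QuotientAddGroup.mk_surjective x
      obtain ⟨t', rfl⟩ := QuotientAddGroup.mk_surjective y
      have h : polyPath u t = polyPath u t' := congrArg Subtype.val hxy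
      obtain ⟨h1, h2⟩ := polyPath_eq_polyPath hN hu hstep h
      obtain ⟨c, hc⟩ := (hu _ _).1 h1
      refine (QuotientAddGroup.eq.2 ?_)
      refine ⟨-c, ?_⟩
      have e1 := Int.floor_add_fract t
      have e2 := Int.floor_add_fract t'
      have e3 : (⌊t⌋ : ℝ) - ⌊t'⌋ = N * c := by exact_mod_cast hc
      change (-c) • (N : ℝ) = -t + t'
      rw [zsmul_eq_mul]
      push_cast
      linarith
    · rintro ⟨_, t, rfl⟩
      exact ⟨(t : AddCircle (N : ℝ)), rfl⟩
  exact ⟨Continuous.homeoOfEquivCompactToT2 (f := Equiv.ofBijective F hbij) hF⟩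

/-! ### Combinatorics of loops -/

/-- The value of `F` at the cell between the two pattern stitches that meet at `(i, j)`. -/
def cornerVal {α : Type*} (ε η : ℤ → ZMod 2) (F : ℤ → ℤ → α) (i j : ℤ) : α :=
  F (if (i : ZMod 2) = η j then i else i - 1) (if (j : ZMod 2) = ε i then j else j - 1)

theorem cornerVal_vert {α : Type*} {ε : ℤ → ZMod 2} (η : ℤ → ZMod 2) {F : ℤ → ℤ → α} {i j : ℤ}
    (hp : (j : ZMod 2) = ε i) (hF : F i j = F (i - 1) j) :
    cornerVal ε η F i j = F i j ∧ cornerVal ε η F i (j + 1) = F i j := by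
  have ne1 : ∀ x : ZMod 2, x + 1 ≠ x := by decide
  have hp' : ((j + 1 : ℤ) : ZMod 2) ≠ ε i := by
    rw [← hp]; push_cast; exact ne1 _
  constructor
  · simp only [cornerVal, if_pos hp]
    split_ifs
    · rfl
    · exact hF.symm
  · simp only [cornerVal, if_neg hp', add_sub_cancel_right]
    split_ifs
    · rfl
    · exact hF.symm

theorem cornerVal_swap {α : Type*} (ε η : ℤ → ZMod 2) (F : ℤ → ℤ → α) (i j : ℤ) :
    cornerVal ε η F i j = cornerVal η ε (fun a b => F b a) j i := rfl

theorem cornerVal_horiz {α : Type*} {η : ℤ → ZMod 2} (ε : ℤ → ZMod 2) {F : ℤ → ℤ → α} {i j : ℤ}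
    (hp : (i : ZMod 2) = η j) (hF : F i j = F i (j - 1)) :
    cornerVal ε η F i j = F i j ∧ cornerVal ε η F (i + 1) j = F i j := by
  rw [cornerVal_swap, cornerVal_swap]
  exact cornerVal_vert ε hp (F := fun a b => F b a) hF

/-- A connected set of pattern stitches with even degrees inside the box `[0, w] × [0, h]`;
`V i j` and `H i j` say that the vertical (resp. horizontal) stitch based at `(i, j)` belongs
to the set. -/
structure GridCurve (ε η : ℤ → ZMod 2) (V H : ℤ → ℤ → Prop) (w h : ℤ) : Prop where
  patV : ∀ i j, V i j → (j : ZMod 2) = ε i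
  patH : ∀ i j, H i j → (i : ZMod 2) = η j
  even : ∀ i j, (V i j ∨ V i (j - 1)) ↔ (H i j ∨ H (i - 1) j)
  rangeV : ∀ i j, V i j → 0 ≤ i ∧ i ≤ w ∧ 0 ≤ j ∧ j < h
  rangeH : ∀ i j, H i j → 0 ≤ i ∧ i < w ∧ 0 ≤ j ∧ j ≤ h
  conn : ∀ P : ℤ → ℤ → Prop, (∀ i j, V i j → (P i j ↔ P i (j + 1))) →
    (∀ i j, H i j → (P i j ↔ P (i + 1) j)) →
    ((∀ i j, V i j → P i j) ∧ ∀ i j, H i j → P i j) ∨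
    ((∀ i j, V i j → ¬ P i j) ∧ ∀ i j, H i j → ¬ P i j)

/-- A grid curve whose bounding box is `[0, w] × [0, h]`. -/
structure GridLoop (ε η : ℤ → ZMod 2) (V H : ℤ → ℤ → Prop) (w h : ℤ) : Prop extends
    GridCurve ε η V H w h where
  left : ∃ j, V 0 j
  right : ∃ j, V w j
  bot : ∃ i, H i 0
  top : ∃ i, H i h

namespace GridCurve

variable {ε η : ℤ → ZMod 2} {V H : ℤ → ℤ → Prop} {w h : ℤ}

theorem swap (L : GridCurve ε η V H w h) :
    GridCurve η ε (fun i j => H j i) (fun i j => V j i) h w where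
  patV i j := L.patH j i
  patH i j := L.patV j i
  even i j := (L.even j i).symm
  rangeV i j hij := by have := L.rangeH j i hij; omega
  rangeH i j hij := by have := L.rangeV j i hij; omega
  conn P hV hH := by
    have := L.conn (fun i j => P j i) (fun i j => hH j i) (fun i j => hV j i)
    rcases this with h | h
    · exact Or.inl ⟨fun i j => h.2 j i, fun i j => h.1 j i⟩
    · exact Or.inr ⟨fun i j => h.2 j i, fun i j => h.1 j i⟩

/-- The interior of a loop, as a `ZMod 2`-valued function on the cells. -/
theorem exists_interior (L : GridCurve ε η V H w h) :
    ∃ I : ℤ → ℤ → ZMod 2, (∀ i j, V i j → I i j = I (i - 1) j + 1) ∧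
      (∀ i j, ¬ V i j → I i j = I (i - 1) j) ∧
      (∀ i j, H i j → I i j = I i (j - 1) + 1) ∧
      (∀ i j, ¬ H i j → I i j = I i (j - 1)) ∧
      ∀ i j, (i < 0 ∨ w ≤ i ∨ j < 0 ∨ h ≤ j) → I i j = 0 := by
  classical
  have two : ∀ x : ZMod 2, x + x = 0 := by decide
  have ne1 : ∀ x : ZMod 2, x - 1 ≠ x := by decide
  let v : ℤ → ℤ → ZMod 2 := fun i j => if V i j then 1 else 0
  let g : ℤ → ℤ → ZMod 2 := fun i j => if H i j then 1 else 0
  have hvg : ∀ i j, v i j + v i (j - 1) = g i j + g (i - 1) j := by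
    intro i j
    have h1 := L.even i j
    have h2 : ¬ (V i j ∧ V i (j - 1)) := by
      rintro ⟨h3, h4⟩
      have h3 := L.patV _ _ h3
      have h4 := L.patV _ _ h4
      push_cast at h4
      exact ne1 _ (h4.trans h3.symm)
    have h2' : ¬ (H i j ∧ H (i - 1) j) := by
      rintro ⟨h3, h4⟩
      have h3 := L.patH _ _ h3
      have h4 := L.patH _ _ h4
      push_cast at h4
      exact ne1 _ (h4.trans h3.symm)
    simp only [v, g]
    by_cases a1 : V i j <;> by_cases a2 : V i (j - 1) <;> by_cases a3 : H i j <;>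
      by_cases a4 : H (i - 1) j <;> simp_all
  let I : ℤ → ℤ → ZMod 2 := fun i j => ∑ a ∈ Finset.Icc 0 i, v a j
  have neg : ∀ i j, i < 0 → I i j = 0 := by
    intro i j hi
    simp [I, Finset.Icc_eq_empty_of_lt hi]
  have hv : ∀ i j, I i j = I (i - 1) j + v i j := by
    intro i j
    by_cases hi : 0 ≤ i
    · have : Finset.Icc 0 i = insert i (Finset.Icc 0 (i - 1)) := by
        ext x; simp only [Finset.mem_insert, Finset.mem_Icc]; omega
      simp only [I]
      rw [this, Finset.sum_insert (by simp), add_comm]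
    · rw [neg i j (by omega), neg (i - 1) j (by omega)]
      have : ¬ V i j := fun h => hi (L.rangeV i j h).1
      simp [v, this]
  have hg : ∀ j i, I i j = I i (j - 1) + g i j := by
    intro j i
    by_cases hi : -1 ≤ i
    · induction i, hi using Int.leInduction with
      | base =>
        have : ¬ H (-1) j := fun h => absurd (L.rangeH _ j h).1 (by norm_num)
        simp [neg, g, this]
      | succ i _ ih =>
        have h1 := hvg (i + 1) j
        rw [hv (i + 1) j, hv (i + 1) (j - 1)]
        simp only [add_sub_cancel_right] at h1 ⊢
        rw [ih]
        linear_combination h1 + two (g i j) - two (v (i + 1) (j - 1))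
    · have : ¬ H i j := fun h => hi (by linarith [(L.rangeH _ j h).1])
      rw [neg i j (by omega), neg i (j - 1) (by omega)]
      simp [g, this]
  refine ⟨I, fun i j hij => ?_, fun i j hij => ?_, fun i j hij => ?_, fun i j hij => ?_, ?_⟩
  · rw [hv]; simp [v, hij]
  · rw [hv]; simp [v, hij]
  · rw [hg]; simp [g, hij]
  · rw [hg]; simp [g, hij]
  have row : ∀ i j, (j < 0 ∨ h ≤ j) → I i j = 0 := by
    intro i j hj
    refine Finset.sum_eq_zero fun a _ => ?_
    have : ¬ V a j := fun h => by have := L.rangeV _ _ h; omega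
    simp [v, this]
  intro i j hij
  by_cases hi : w ≤ i
  · by_cases hj : -1 ≤ j
    · induction j, hj using Int.leInduction with
      | base => exact row i _ (by omega)
      | succ j _ ih =>
        have : ¬ H i (j + 1) := fun h => by have := L.rangeH _ _ h; omega
        rw [hg, add_sub_cancel_right, ih (by omega)]
        simp [g, this]
    · exact row i j (by omega)
  · rcases hij with h1 | h1 | h1 | h1
    · exact neg i j h1
    · exact absurd h1 hi
    · exact row i j (Or.inl h1)
    · exact row i j (Or.inr h1)

theorem exists_horiz_between (L : GridCurve ε η V H w h) {a i i' j j' : ℤ} (hV : V i j)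
    (hi : i ≤ a) (hV' : V i' j') (hi' : a < i') : ∃ j, H a j := by
  by_contra hcon
  push Not at hcon
  rcases L.conn (fun i _ => i ≤ a) (fun _ _ _ => Iff.rfl) (fun i j hij => by
    have : i ≠ a := by rintro rfl; exact hcon j hij
    omega) with hc | hc
  · have := hc.1 _ _ hV'
    omega
  · exact hc.1 _ _ hV hi

/-- The column of a stitch of a grid curve contains a second stitch. -/
theorem exists_ne_horiz (L : GridCurve ε η V H w h) {a b : ℤ} (hab : H a b) :
    ∃ c, c ≠ b ∧ H a c := by
  by_contra hcon
  push Not at hcon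
  obtain ⟨I, -, -, hH1, hH0, hout⟩ := L.exists_interior
  have hr := L.rangeH a b hab
  have const : ∀ c d, c ≤ d → (∀ j, c < j → j ≤ d → ¬ H a j) → I a d = I a c := by
    intro c d hcd
    induction d, hcd using Int.leInduction with
    | base => intro _; rfl
    | succ d hd ih =>
      intro hj
      rw [hH0 a (d + 1) (hj _ (by omega) le_rfl), add_sub_cancel_right]
      exact ih fun j h1 h2 => hj j h1 (by omega)
  have h1 := const (-1) (b - 1) (by omega) fun j _ _ => hcon j (by omega)
  have h2 := const b h (by omega) fun j _ _ => hcon j (by omega)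
  rw [hout a (-1) (by omega)] at h1
  rw [hout a h (by omega), hH1 a b hab, h1] at h2
  exact absurd h2 (by decide)

end GridCurve

namespace GridLoop

variable {ε η : ℤ → ZMod 2} {V H : ℤ → ℤ → Prop} {w h : ℤ}

theorem swap (L : GridLoop ε η V H w h) :
    GridLoop η ε (fun i j => H j i) (fun i j => V j i) h w where
  toGridCurve := L.toGridCurve.swap
  left := L.bot
  right := L.top
  bot := L.left
  top := L.right

theorem exists_horiz_in_column (L : GridLoop ε η V H w h) {a : ℤ} (h0 : 0 ≤ a) (h1 : a < w) :
    ∃ j, H a j := by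
  obtain ⟨j, hj⟩ := L.left
  obtain ⟨j', hj'⟩ := L.right
  exact L.exists_horiz_between hj h0 hj' h1

theorem exists_vert_in_row (L : GridLoop ε η V H w h) {b : ℤ} (h0 : 0 ≤ b) (h1 : b < h) :
    ∃ i, V i b := L.swap.exists_horiz_in_column h0 h1

/-- A function on the cells that agrees on both sides of each stitch of a loop takes a
single value next to the loop. -/
theorem exists_const (L : GridLoop ε η V H w h) {α : Type*} (F : ℤ → ℤ → α)
    (hV : ∀ i j, V i j → F i j = F (i - 1) j) (hH : ∀ i j, H i j → F i j = F i (j - 1)) :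
    ∃ c, (∀ i j, V i j → F i j = c) ∧ ∀ i j, H i j → F i j = c := by
  have gV := fun i j hij => cornerVal_vert η (L.patV i j hij) (hV i j hij)
  have gH := fun i j hij => cornerVal_horiz ε (L.patH i j hij) (hH i j hij)
  obtain ⟨j, hj⟩ := L.left
  refine ⟨F 0 j, ?_⟩
  rcases L.conn (fun a b => cornerVal ε η F a b = F 0 j)
    (fun a b hab => by rw [(gV a b hab).1, (gV a b hab).2])
    (fun a b hab => by rw [(gH a b hab).1, (gH a b hab).2]) with hc | hc
  · exact ⟨fun a b hab => (gV a b hab).1 ▸ hc.1 a b hab,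
      fun a b hab => (gH a b hab).1 ▸ hc.2 a b hab⟩
  · exact absurd (gV 0 j hj).1 (hc.1 0 j hj)

end GridLoop

/-- A loop together with its interior `I` and height functions `X`, `Y` on columns and rows:
interior cells next to the loop have height `X i + Y j = k + 1` and exterior cells next to it
have height `k`. -/
structure Frame (V H I : ℤ → ℤ → Prop) (X Y : ℤ → ℤ) (k w h : ℤ) : Prop where
  crossV : ∀ i j, ¬ V i j → (I i j ↔ I (i - 1) j)
  crossH : ∀ i j, ¬ H i j → (I i j ↔ I i (j - 1))
  edgeV : ∀ i j, V i j → (I i j ∧ ¬ I (i - 1) j ∧ X i + Y j = k + 1 ∧ X (i - 1) + Y j = k) ∨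
    (¬ I i j ∧ I (i - 1) j ∧ X i + Y j = k ∧ X (i - 1) + Y j = k + 1)
  edgeH : ∀ i j, H i j → (I i j ∧ ¬ I i (j - 1) ∧ X i + Y j = k + 1 ∧ X i + Y (j - 1) = k) ∨
    (¬ I i j ∧ I i (j - 1) ∧ X i + Y j = k ∧ X i + Y (j - 1) = k + 1)
  outside : ∀ i j, (i < 0 ∨ w ≤ i ∨ j < 0 ∨ h ≤ j) → ¬ I i j
  rangeV : ∀ i j, V i j → 0 ≤ i ∧ i ≤ w ∧ 0 ≤ j ∧ j < h
  rangeH : ∀ i j, H i j → 0 ≤ i ∧ i < w ∧ 0 ≤ j ∧ j ≤ h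
  column : ∀ a, 0 ≤ a → a < w → ∃ j, H a j
  row : ∀ b, 0 ≤ b → b < h → ∃ i, V i b
  left : ∃ j, V 0 j
  right : ∃ j, V w j
  bot : ∃ i, H i 0
  top : ∃ i, H i h

namespace Frame

variable {V H I : ℤ → ℤ → Prop} {X Y : ℤ → ℤ} {k w h : ℤ}

theorem swap (A : Frame V H I X Y k w h) :
    Frame (fun i j => H j i) (fun i j => V j i) (fun i j => I j i) Y X k h w where
  crossV i j := A.crossH j i
  crossH i j := A.crossV j i
  edgeV i j hij := by have := A.edgeH j i hij; rwa [add_comm (Y i), add_comm (Y (i - 1))]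
  edgeH i j hij := by have := A.edgeV j i hij; rwa [add_comm (Y i), add_comm (Y i)]
  outside i j hij := A.outside j i (by omega)
  rangeV i j hij := by have := A.rangeH j i hij; omega
  rangeH i j hij := by have := A.rangeV j i hij; omega
  column := A.row
  row := A.column
  left := A.bot
  right := A.top
  bot := A.left
  top := A.right

theorem pos_width (A : Frame V H I X Y k w h) : 0 < w := by
  obtain ⟨i, hi⟩ := A.bot
  have := A.rangeH i 0 hi
  omega

theorem interior_iff_of_forall_not {a b r : ℤ} (A : Frame V H I X Y k w h) (hab : a ≤ b)
    (hV : ∀ i, a < i → i ≤ b → ¬ V i r) : I b r ↔ I a r := by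
  induction b, hab using Int.leInduction with
  | base => rfl
  | succ b hb ih =>
    rw [A.crossV (b + 1) r (hV _ (by omega) le_rfl), add_sub_cancel_right]
    exact ih fun i h1 h2 => hV i h1 (by omega)

/-- Two cells of a row between which the heights exceed `k` lie on the same side. -/
theorem interior_iff_of_forall_lt {a b r : ℤ} (A : Frame V H I X Y k w h) (hab : a ≤ b)
    (hX : ∀ i, a ≤ i → i ≤ b → k < X i + Y r) : I b r ↔ I a r := by
  refine A.interior_iff_of_forall_not hab fun i h1 h2 hi => ?_
  have e1 := hX i h1.le h2
  have e2 := hX (i - 1) (by omega) (by omega)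
  have := A.edgeV i r hi
  omega

theorem exists_interior_cell (A : Frame V H I X Y k w h) {a : ℤ} (h0 : 0 ≤ a) (h1 : a < w) :
    ∃ r, I a r ∧ X a + Y r = k + 1 := by
  obtain ⟨j, hj⟩ := A.column a h0 h1
  rcases A.edgeH a j hj with hc | hc
  · exact ⟨j, hc.1, hc.2.2.1⟩
  · exact ⟨j - 1, hc.2.1, hc.2.2.2⟩

theorem lt_of_left (A : Frame V H I X Y k w h) (n : ℕ) (hn : (n : ℤ) < w) : X (-1) < X n := by
  induction n using Nat.strong_induction_on with
  | _ n ih =>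
    by_contra hcon
    obtain ⟨r, hr, hk⟩ := A.exists_interior_cell (Int.natCast_nonneg n) hn
    have := A.interior_iff_of_forall_lt (a := -1) (b := n) (r := r) (by omega) (by
      intro i h1 h2
      rcases h1.eq_or_lt with rfl | h1
      · omega
      rcases h2.eq_or_lt with rfl | h2
      · omega
      have := ih i.toNat (by omega) (by omega)
      rw [Int.toNat_of_nonneg (by omega)] at this
      omega)
    exact A.outside (-1) r (by omega) (this.1 hr)

theorem lt_of_right (A : Frame V H I X Y k w h) (n : ℕ) (hn : 0 ≤ w - 1 - n) :
    X w < X (w - 1 - n) := by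
  induction n using Nat.strong_induction_on with
  | _ n ih =>
    by_contra hcon
    obtain ⟨r, hr, hk⟩ := A.exists_interior_cell hn (by omega)
    have := A.interior_iff_of_forall_lt (a := w - 1 - n) (b := w) (r := r) (by omega) (by
      intro i h1 h2
      rcases h1.eq_or_lt with rfl | h1
      · omega
      rcases h2.eq_or_lt with rfl | h2
      · omega
      have := ih (w - 1 - i).toNat (by omega) (by omega)
      rw [Int.toNat_of_nonneg (by omega), show w - 1 - (w - 1 - i) = i by ring] at this
      omega)
    exact A.outside w r (by omega) (this.2 hr)

theorem ends_eq (A : Frame V H I X Y k w h) : X w = X (-1) := by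
  have hw := A.pos_width
  obtain ⟨j, hj⟩ := A.left
  have h1 := A.lt_of_left (w - 1).toNat (by omega)
  have h2 := A.lt_of_right (w - 1).toNat (by omega)
  rw [Int.toNat_of_nonneg (by omega)] at h1 h2
  rw [sub_self] at h2
  have h3 := A.edgeV 0 j hj
  rw [zero_sub] at h3
  obtain ⟨j', hj'⟩ := A.right
  have h4 := A.edgeV w j' hj'
  omega

theorem pos (A : Frame V H I X Y k w h) (hX : X (-1) = 0) {a : ℤ} (h0 : 0 ≤ a) (h1 : a < w) :
    0 < X a := by
  have := A.lt_of_left a.toNat (by omega)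
  rwa [Int.toNat_of_nonneg h0, hX] at this

theorem exists_eq (A : Frame V H I X Y k w h) (hX : X (-1) = 0) :
    ∃ b, 0 ≤ b ∧ b < h ∧ Y b = k := by
  obtain ⟨j, hj⟩ := A.left
  have hr := A.rangeV 0 j hj
  refine ⟨j, hr.2.2.1, hr.2.2.2, ?_⟩
  have := A.edgeV 0 j hj
  have hout := A.outside (-1) j (by omega)
  rw [zero_sub] at this
  rcases this with h | h
  · omega
  · exact absurd h.2.1 hout

theorem le (A : Frame V H I X Y k w h) (hX : X (-1) = 0) {b : ℤ} (h0 : 0 ≤ b) (h1 : b < h) :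
    Y b ≤ k := by
  obtain ⟨i, hi⟩ := A.row b h0 h1
  have hr := A.rangeV i b hi
  have nonneg : ∀ a, -1 ≤ a → a ≤ w → 0 ≤ X a := by
    intro a ha1 ha2
    rcases ha1.eq_or_lt with rfl | ha1
    · exact hX.ge
    rcases ha2.eq_or_lt with rfl | ha2
    · rw [A.ends_eq, hX]
    exact (A.pos hX (by omega) ha2).le
  have e1 := nonneg i (by omega) (by omega)
  have e2 := nonneg (i - 1) (by omega) (by omega)
  have := A.edgeV i b hi
  omega

/-- A loop passes through the bottom of every column where `X` is maximal. -/
theorem horiz_bot (A : Frame V H I X Y k w h) (hY : Y (-1) = 0) {a : ℤ}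
    (h0 : 0 ≤ a) (h1 : a < w) (ha : X a = k) : H a 0 := by
  obtain ⟨r, hr, -⟩ := A.exists_interior_cell h0 h1
  have hr1 : 0 ≤ r := by
    by_contra hcon
    exact A.outside a r (by omega) hr
  have hr2 : r < h := by
    by_contra hcon
    exact A.outside a r (by omega) hr
  have h2 : I a 0 := by
    refine (A.swap.interior_iff_of_forall_lt (a := 0) (b := r) (r := a) hr1 fun i h3 h4 => ?_).1 hr
    have := A.swap.pos hY h3 (lt_of_le_of_lt h4 hr2)
    omega
  by_contra hcon
  have := A.crossH a 0 hcon
  exact A.outside a (0 - 1) (by omega) (this.1 h2)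

end Frame

theorem cast_eq_of_step {Z : ℤ → ℤ} {n : ℤ} (P : ℤ → Prop) [DecidablePred P] (h0 : Z (-1) = 0)
    (hZ : ∀ i, 0 ≤ i → i ≤ n → Z i = Z (i - 1) + if P i then 1 else -1) {i : ℤ} (hi : -1 ≤ i)
    (hn : i ≤ n) : (Z i : ZMod 2) = i + 1 := by
  induction i, hi using Int.leInduction with
  | base => rw [h0]; decide
  | succ i hi ih =>
    have e : (-1 : ZMod 2) = 1 := by decide
    rw [hZ (i + 1) (by omega) hn, add_sub_cancel_right]
    push_cast
    rw [ih (by omega)]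
    split_ifs
    · rfl
    · rw [e]

/-- The function `X i + Y j` on the cells, lowered by one on the cells of parity `p`. -/
def level (p : ZMod 2) (X Y : ℤ → ℤ) (i j : ℤ) : ℤ :=
  if (i + j : ZMod 2) = p then X i + Y j - 1 else X i + Y j

theorem level_swap (p : ZMod 2) (X Y : ℤ → ℤ) (i j : ℤ) : level p X Y i j = level p Y X j i := by
  rw [level, level, add_comm (i : ZMod 2), add_comm (X i)]

theorem level_vert {p : ZMod 2} {X Y : ℤ → ℤ} {ε : ℤ → ZMod 2} {i j : ℤ}
    (hX : X i = X (i - 1) + if (i : ZMod 2) + ε i = p then 1 else -1) (hj : (j : ZMod 2) = ε i) :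
    level p X Y i j = level p X Y (i - 1) j := by
  have dich : ∀ p x : ZMod 2, x ≠ p → x - 1 = p := by decide
  have ne0 : ∀ p : ZMod 2, p - 1 ≠ p := by decide
  have e : ((i - 1 : ℤ) + j : ZMod 2) = i + j - 1 := by push_cast; ring
  rw [level, level, e, hX, ← hj]
  by_cases hc : (i + j : ZMod 2) = p
  · rw [if_pos hc, if_pos hc, if_neg (by rw [hc]; exact ne0 p)]
    ring
  · rw [if_neg hc, if_neg hc, if_pos (dich _ _ hc)]
    ring

theorem level_horiz {p : ZMod 2} {X Y : ℤ → ℤ} {η : ℤ → ZMod 2} {i j : ℤ}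
    (hY : Y j = Y (j - 1) + if (j : ZMod 2) + η j = p then 1 else -1) (hi : (i : ZMod 2) = η j) :
    level p X Y i j = level p X Y i (j - 1) := by
  rw [level_swap, level_swap p X Y i (j - 1)]
  exact level_vert hY hi

theorem GridLoop.exists_frame {ε η : ℤ → ZMod 2} {V H : ℤ → ℤ → Prop} {w h : ℤ}
    (L : GridLoop ε η V H w h) :
    ∃ p : ZMod 2, ∀ X Y : ℤ → ℤ, X (-1) = 0 → Y (-1) = 0 →
      (∀ i, 0 ≤ i → i ≤ w → X i = X (i - 1) + if (i : ZMod 2) + ε i = p then 1 else -1) →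
      (∀ j, 0 ≤ j → j ≤ h → Y j = Y (j - 1) + if (j : ZMod 2) + η j = p then 1 else -1) →
      ∃ (I : ℤ → ℤ → Prop) (k : ℤ), p = (k : ZMod 2) + 1 ∧ Frame V H I X Y k w h := by
  obtain ⟨I, hV1, hV0, hH1, hH0, hout⟩ := L.exists_interior
  have two : ∀ x y : ZMod 2, x + 1 + y = x + (y - 1) := by decide
  obtain ⟨q, hqV, hqH⟩ := L.exists_const (fun i j => I i j + (i + j : ZMod 2))
    (fun i j hij => by
      rw [hV1 i j hij]; push_cast; rw [two]; ring)
    (fun i j hij => by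
      rw [hH1 i j hij]; push_cast; rw [two]; ring)
  refine ⟨1 + q, fun X Y hX0 hY0 hX hY => ?_⟩
  have dich : ∀ q x : ZMod 2, x ≠ 1 + q → x = q := by decide
  obtain ⟨k, hkV, hkH⟩ := L.exists_const (level (1 + q) X Y)
    (fun i j hij => by
      have hr := L.rangeV i j hij
      exact level_vert (hX i hr.1 hr.2.1) (L.patV i j hij))
    (fun i j hij => by
      have hr := L.rangeH i j hij
      exact level_horiz (hY j hr.2.2.1 hr.2.2.2) (L.patH i j hij))
  simp only [level] at hkV hkH
  have hI : ∀ q x c : ZMod 2, x + c = q → ((c = 1 + q → x = 1) ∧ (c ≠ 1 + q → x = 0)) := by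
    decide
  have z1 : (1 : ZMod 2) + 1 = 0 := by decide
  refine ⟨fun i j => I i j = 1, k, ?_, ⟨?_, ?_, ?_, ?_, ?_, L.rangeV, L.rangeH,
    fun a => L.exists_horiz_in_column, fun b => L.exists_vert_in_row, L.left, L.right,
    L.bot, L.top⟩⟩
  · obtain ⟨j, hj⟩ := L.left
    have hr := L.rangeV 0 j hj
    have e1 := hkV 0 j hj
    have e2 := cast_eq_of_step _ hX0 hX (i := 0) (by omega) hr.2.1
    have e3 := cast_eq_of_step _ hY0 hY (i := j) (by omega) (by omega)
    have cast : ((X 0 + Y j : ℤ) : ZMod 2) = (0 : ℤ) + j := by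
      push_cast
      rw [e2, e3]
      linear_combination z1
    split_ifs at e1 with hc
    · rw [← e1, Int.cast_sub, cast, hc, Int.cast_one, sub_add_cancel]
    · rw [← e1, cast, dich _ _ hc, add_comm]
  · intro i j hij
    rw [hV0 i j hij]
  · intro i j hij
    rw [hH0 i j hij]
  · intro i j hij
    have hr := L.rangeV i j hij
    have e1 := hkV i j hij
    have e2 := hI _ _ _ (hqV i j hij)
    have e3 := hX i hr.1 hr.2.1
    have e4 := hV1 i j hij
    rw [← L.patV i j hij] at e3
    split_ifs at e1 e3 with hc
    · left
      have e5 := e2.1 hc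
      refine ⟨e5, ?_, by omega, by omega⟩
      intro e6
      rw [e5, e6] at e4
      exact absurd e4 (by decide)
    · right
      have e5 := e2.2 hc
      refine ⟨by rw [e5]; decide, ?_, by omega, by omega⟩
      rw [e5] at e4
      generalize I (i - 1) j = x at e4
      revert x; decide
  · intro i j hij
    have hr := L.rangeH i j hij
    have e1 := hkH i j hij
    have e2 := hI _ _ _ (hqH i j hij)
    have e3 := hY j hr.2.2.1 hr.2.2.2
    have e4 := hH1 i j hij
    rw [← L.patH i j hij, add_comm (j : ZMod 2)] at e3
    split_ifs at e1 e3 with hc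
    · left
      have e5 := e2.1 hc
      refine ⟨e5, ?_, by omega, by omega⟩
      intro e6
      rw [e5, e6] at e4
      exact absurd e4 (by decide)
    · right
      have e5 := e2.2 hc
      refine ⟨by rw [e5]; decide, ?_, by omega, by omega⟩
      rw [e5] at e4
      generalize I i (j - 1) = x at e4
      revert x; decide
  · intro i j hij
    rw [hout i j hij]
    decide

/-! ### Excursions -/

/-- The step `±1` encoded by a Boolean. -/
def sgn (b : Bool) : ℤ := if b then 1 else -1

/-- The height of a walk after its first `n` steps. -/
def hgt (l : List Bool) (n : ℕ) : ℤ := ((l.take n).map sgn).sum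

theorem hgt_zero (l : List Bool) : hgt l 0 = 0 := by simp [hgt]

theorem hgt_cons (b : Bool) (l : List Bool) (n : ℕ) : hgt (b :: l) (n + 1) = sgn b + hgt l n := by
  simp [hgt]

theorem hgt_succ {l : List Bool} {n : ℕ} (hn : n < l.length) :
    hgt l (n + 1) = hgt l n + sgn (l.getD n false) := by
  rw [hgt, List.take_add_one, List.map_append, List.sum_append, ← hgt]
  simp [hn]

/-- `IsPath k x l` says that the walk `l` started at `x` stays in `[1, k]` until it reaches `0`
at its last step. -/
def IsPath (k : ℕ) : ℤ → List Bool → Prop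
  | x, [] => x = 0
  | x, b :: l => 1 ≤ x ∧ x ≤ k ∧ IsPath k (x + sgn b) l

theorem isPath_iff {k : ℕ} {x : ℤ} {l : List Bool} : IsPath k x l ↔
    (∀ n < l.length, 1 ≤ x + hgt l n ∧ x + hgt l n ≤ k) ∧ x + hgt l l.length = 0 := by
  induction l generalizing x with
  | nil => simp [IsPath, hgt]
  | cons b l ih =>
    rw [IsPath, ih, List.length_cons, hgt_cons, ← add_assoc]
    constructor
    · rintro ⟨h1, h2, h3, h4⟩
      refine ⟨fun n hn => ?_, h4⟩
      cases n with
      | zero => rw [hgt_zero, add_zero]; exact ⟨h1, h2⟩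
      | succ n => rw [hgt_cons, ← add_assoc]; exact h3 n (by omega)
    · rintro ⟨h3, h4⟩
      have h0 := h3 0 (by omega)
      rw [hgt_zero, add_zero] at h0
      refine ⟨h0.1, h0.2, fun n hn => ?_, h4⟩
      have := h3 (n + 1) (by omega)
      rwa [hgt_cons, ← add_assoc] at this

/-- A positive excursion from `0` to `0` of maximal height exactly `k`. -/
def IsExc (k : ℕ) (l : List Bool) : Prop :=
  ∃ t, l = true :: t ∧ IsPath k 1 t ∧ ¬ IsPath (k - 1) 1 t

/-- The height of the walk `l` on the `i`-th column. -/
def walk (l : List Bool) (i : ℤ) : ℤ := hgt l (i + 1).toNat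

theorem walk_neg_one (l : List Bool) : walk l (-1) = 0 := hgt_zero l

theorem walk_eq {l : List Bool} {i : ℤ} (h0 : 0 ≤ i) (h1 : i < l.length) :
    walk l i = walk l (i - 1) + if l.getD i.toNat false = true then 1 else -1 := by
  rw [walk, walk, sub_add_cancel, Int.toNat_add h0 (by norm_num), Int.toNat_one,
    hgt_succ (by omega), sgn]

theorem isExc_iff {k : ℕ} {l : List Bool} : IsExc k l ↔ walk l (l.length - 1) = 0 ∧
    (∀ i : ℤ, 0 ≤ i → i < l.length - 1 → 0 < walk l i ∧ walk l i ≤ k) ∧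
    ∃ i : ℤ, 0 ≤ i ∧ i < l.length - 1 ∧ walk l i = k := by
  have cons : ∀ (t : List Bool) (i : ℤ), 0 ≤ i → walk (true :: t) i = 1 + hgt t i.toNat := by
    intro t i hi
    rw [walk, Int.toNat_add hi (by norm_num), Int.toNat_one, hgt_cons]
    rfl
  constructor
  · rintro ⟨t, rfl, h1, h2⟩
    rw [isPath_iff] at h1 h2
    have hlen : (((true :: t).length : ℕ) : ℤ) - 1 = t.length := by simp
    rw [hlen, cons _ _ (by omega), Int.toNat_natCast]
    refine ⟨h1.2, fun i hi hi' => ?_, ?_⟩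
    · rw [cons _ _ hi]
      exact h1.1 _ (by omega)
    · by_contra hcon
      push Not at hcon
      refine h2 ⟨fun n hn => ?_, h1.2⟩
      have := hcon n (by omega) (by omega)
      rw [cons _ _ (by omega), Int.toNat_natCast] at this
      have := h1.1 n hn
      omega
  · rintro ⟨h1, h2, i, h3, h4, h5⟩
    have h6 := h2 i h3 h4
    have h7 := (h2 0 le_rfl (by omega)).1
    rw [walk_eq le_rfl (by omega), zero_sub, walk_neg_one] at h7
    match l, h4 with
    | [], h4 => simp at h4; omega
    | false :: t, h4 => simp at h7
    | true :: t, h4 =>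
      have hlen : (((true :: t).length : ℕ) : ℤ) - 1 = t.length := by simp
      rw [hlen] at h1 h2 h4
      rw [cons _ _ (by omega), Int.toNat_natCast] at h1
      rw [cons _ _ h3] at h5 h6
      refine ⟨t, rfl, isPath_iff.2 ⟨fun n hn => ?_, h1⟩, fun hcon => ?_⟩
      · have := h2 n (by omega) (by omega)
        rwa [cons _ _ (by omega), Int.toNat_natCast] at this
      · have := ((isPath_iff.1 hcon).1 i.toNat (by omega)).2
        omega

/-- The label of the `i`-th line that produces the `i`-th step of the walk `l`. -/
def lab (p : ZMod 2) (l : List Bool) (i : ℤ) : ZMod 2 :=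
  i + p + if l.getD i.toNat false = true then 0 else 1

theorem add_lab_eq_iff {p : ZMod 2} {l : List Bool} {i : ℤ} :
    (i : ZMod 2) + lab p l i = p ↔ l.getD i.toNat false = true := by
  have h0 : ∀ x p : ZMod 2, x + (x + p + 0) = p := by decide
  have h1 : ∀ x p : ZMod 2, x + (x + p + 1) ≠ p := by decide
  rw [lab]
  split_ifs with hc
  · exact iff_of_true (h0 _ _) hc
  · exact iff_of_false (h1 _ _) hc

/-- The walk whose steps are up on the lines `i` where `i + ε i = p`. -/
def steps (p : ZMod 2) (ε : ℤ → ZMod 2) (n : ℕ) : List Bool :=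
  (List.range n).map fun i : ℕ => decide (((i : ℤ) : ZMod 2) + ε i = p)

theorem length_steps (p : ZMod 2) (ε : ℤ → ZMod 2) (n : ℕ) : (steps p ε n).length = n := by
  simp [steps]

theorem steps_getD {p : ZMod 2} {ε : ℤ → ZMod 2} {n : ℕ} {i : ℤ} (h0 : 0 ≤ i) (h1 : i < n) :
    (steps p ε n).getD i.toNat false = true ↔ (i : ZMod 2) + ε i = p := by
  have h2 : i.toNat < n := by omega
  simp [steps, h2, h0]

theorem lab_steps {p : ZMod 2} {ε : ℤ → ZMod 2} {n : ℕ} {i : ℤ} (h0 : 0 ≤ i) (h1 : i < n) :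
    lab p (steps p ε n) i = ε i := by
  have key : ∀ p x y z : ZMod 2, (x + y = p ↔ x + z = p) → y = z := by decide
  exact key p i _ _ (by rw [add_lab_eq_iff, steps_getD h0 h1])

/-! ### Normalized loops and pairs of excursions -/

theorem GridCurve.imp {ε η : ℤ → ZMod 2} {V H V' H' : ℤ → ℤ → Prop} {w h w' h' : ℤ}
    (L : GridCurve ε η V H w h) (L' : GridCurve ε η V' H' w' h') {a b : ℤ} (hab : H a b)
    (hab' : H' a b) : (∀ i j, V i j → V' i j) ∧ ∀ i j, H i j → H' i j := by
  have ne1 : ∀ x : ZMod 2, x - 1 ≠ x := by decide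
  have ne2 : ∀ x : ZMod 2, x + 1 ≠ x := by decide
  have v1 : ∀ i j, V i j → ¬ V' i (j - 1) := by
    intro i j h1 h2
    have h1 := L.patV _ _ h1
    have h2 := L'.patV _ _ h2
    push_cast at h2
    exact ne1 _ (h2.trans h1.symm)
  have v2 : ∀ i j, V i j → ¬ V' i (j + 1) := by
    intro i j h1 h2
    have h1 := L.patV _ _ h1
    have h2 := L'.patV _ _ h2
    push_cast at h2
    exact ne2 _ (h2.trans h1.symm)
  have g1 : ∀ i j, H i j → ¬ H' (i - 1) j := by
    intro i j h1 h2
    have h1 := L.patH _ _ h1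
    have h2 := L'.patH _ _ h2
    push_cast at h2
    exact ne1 _ (h2.trans h1.symm)
  have g2 : ∀ i j, H i j → ¬ H' (i + 1) j := by
    intro i j h1 h2
    have h1 := L.patH _ _ h1
    have h2 := L'.patH _ _ h2
    push_cast at h2
    exact ne2 _ (h2.trans h1.symm)
  rcases L.conn (fun i j => V' i j ∨ V' i (j - 1)) (fun i j hij => by
      have h1 := v1 i j hij
      have h2 := v2 i j hij
      rw [add_sub_cancel_right]
      tauto) (fun i j hij => by
      have h1 := g1 i j hij
      have h2 := g2 i j hij
      rw [L'.even, L'.even, add_sub_cancel_right]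
      tauto) with hc | hc
  · refine ⟨fun i j hij => (hc.1 i j hij).resolve_right (v1 i j hij), fun i j hij => ?_⟩
    exact ((L'.even i j).1 (hc.2 i j hij)).resolve_right (g1 i j hij)
  · exact absurd ((L'.even a b).2 (Or.inl hab')) (hc.2 a b hab)

/-- The stitches of `S`, all lying in the box `[0, w] × [0, h]`, form a grid curve. -/
theorem gridCurve_of_isCircle {ε η : ℤ → ZMod 2} {S : Finset Stitch} {w h : ℤ}
    (hS : ∀ s ∈ S, s.InPattern ε η) (hC : IsCircle (curveOf ↑S))
    (hX : ∀ s ∈ S, 0 ≤ s.minX ∧ s.maxX ≤ w) (hY : ∀ s ∈ S, 0 ≤ s.minY ∧ s.maxY ≤ h) :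
    GridCurve ε η (fun i j => .vert i j ∈ S) (fun i j => .horiz i j ∈ S) w h where
  patV i j hij := hS _ hij
  patH i j hij := hS _ hij
  even := even_iff_of_inPattern hS hC
  rangeV i j hij := ⟨(hX _ hij).1, (hX _ hij).2, (hY _ hij).1, (hY _ hij).2⟩
  rangeH i j hij := ⟨(hX _ hij).1, (hX _ hij).2, (hY _ hij).1, (hY _ hij).2⟩
  conn P hV hH := by
    rcases forall_or_forall_not_of_isCircle hC P hV hH with h | h
    · exact Or.inl ⟨fun i j hij => h _ hij i j ⟨rfl, Or.inl rfl⟩,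
        fun i j hij => h _ hij i j ⟨rfl, Or.inl rfl⟩⟩
    · exact Or.inr ⟨fun i j hij => h _ hij i j ⟨rfl, Or.inl rfl⟩,
        fun i j hij => h _ hij i j ⟨rfl, Or.inl rfl⟩⟩

theorem isLeast_sInf {S : Finset Stitch} (hS : S.Nonempty) (f : Stitch → ℤ) :
    IsLeast {x | ∃ s ∈ S, x = f s} (sInf {x | ∃ s ∈ S, x = f s}) := by
  have hf : {x | ∃ s ∈ S, x = f s} = ↑(S.image f) := by
    ext x; simp [eq_comm]
  have hb : BddBelow {x | ∃ s ∈ S, x = f s} := by rw [hf]; exact Finset.bddBelow _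
  obtain ⟨s, hs⟩ := hS
  exact ⟨Int.csInf_mem ⟨f s, s, hs, rfl⟩ hb, fun x hx => csInf_le hb hx⟩

theorem isGreatest_sSup {S : Finset Stitch} (hS : S.Nonempty) (f : Stitch → ℤ) :
    IsGreatest {x | ∃ s ∈ S, x = f s} (sSup {x | ∃ s ∈ S, x = f s}) := by
  have hf : {x | ∃ s ∈ S, x = f s} = ↑(S.image f) := by
    ext x; simp [eq_comm]
  have hb : BddAbove {x | ∃ s ∈ S, x = f s} := by rw [hf]; exact Finset.bddAbove _
  obtain ⟨s, hs⟩ := hS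
  exact ⟨Int.csSup_mem ⟨f s, s, hs, rfl⟩ hb, fun x hx => le_csSup hb hx⟩

theorem IsNormLoop.exists_gridLoop {S : Finset Stitch} (hS : IsNormLoop S) :
    ∃ ε η : ℤ → ZMod 2, GridLoop ε η (fun i j => .vert i j ∈ S) (fun i j => .horiz i j ∈ S)
      (loopW S) (loopH S) := by
  obtain ⟨⟨ε, η, hp⟩, hC, hx, hy⟩ := hS
  have hne : S.Nonempty := by
    obtain ⟨p, hp⟩ := IsCircle.isConnected hC |>.nonempty
    simp only [curveOf, Set.mem_iUnion] at hp
    obtain ⟨s, hs, -⟩ := hp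
    exact ⟨s, hs⟩
  have minX := isLeast_sInf hne Stitch.minX
  have minY := isLeast_sInf hne Stitch.minY
  have maxX := isGreatest_sSup hne Stitch.maxX
  have maxY := isGreatest_sSup hne Stitch.maxY
  have hW : loopW S = sSup {x : ℤ | ∃ s ∈ S, x = s.maxX} := by rw [loopW, hx, sub_zero]
  have hH : loopH S = sSup {x : ℤ | ∃ s ∈ S, x = s.maxY} := by rw [loopH, hy, sub_zero]
  rw [hx] at minX
  rw [hy] at minY
  rw [← hW] at maxX
  rw [← hH] at maxY
  have L := gridCurve_of_isCircle (w := loopW S) (h := loopH S) hp hC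
    (fun s hs => ⟨minX.2 ⟨s, hs, rfl⟩, maxX.2 ⟨s, hs, rfl⟩⟩)
    (fun s hs => ⟨minY.2 ⟨s, hs, rfl⟩, maxY.2 ⟨s, hs, rfl⟩⟩)
  refine ⟨ε, η, L, ?_, ?_, ?_, ?_⟩
  · obtain ⟨⟨i, j⟩ | ⟨i, j⟩, hs, he⟩ := minX.1
    · obtain rfl : i = 0 := he.symm
      exact ⟨j, hs⟩
    · obtain rfl : i = 0 := he.symm
      exact ((L.even 0 j).2 (Or.inl hs)).elim (fun h => ⟨_, h⟩) fun h => ⟨_, h⟩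
  · obtain ⟨⟨i, j⟩ | ⟨i, j⟩, hs, he⟩ := maxX.1
    · obtain rfl : loopW S = i := he
      exact ⟨j, hs⟩
    · rw [show loopW S = i + 1 from he]
      exact ((L.even (i + 1) j).2 (Or.inr (by rwa [add_sub_cancel_right]))).elim
        (fun h => ⟨_, h⟩) fun h => ⟨_, h⟩
  · obtain ⟨⟨i, j⟩ | ⟨i, j⟩, hs, he⟩ := minY.1
    · obtain rfl : j = 0 := he.symm
      exact ((L.even i 0).1 (Or.inl hs)).elim (fun h => ⟨_, h⟩) fun h => ⟨_, h⟩
    · obtain rfl : j = 0 := he.symm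
      exact ⟨i, hs⟩
  · obtain ⟨⟨i, j⟩ | ⟨i, j⟩, hs, he⟩ := maxY.1
    · rw [show loopH S = j + 1 from he]
      exact ((L.even i (j + 1)).1 (Or.inr (by rwa [add_sub_cancel_right]))).elim
        (fun h => ⟨_, h⟩) fun h => ⟨_, h⟩
    · obtain rfl : loopH S = j := he
      exact ⟨i, hs⟩

/-- The box of a grid loop is its bounding box. -/
theorem GridLoop.bounds {ε η : ℤ → ZMod 2} {S : Finset Stitch} {w h : ℤ}
    (L : GridLoop ε η (fun i j => .vert i j ∈ S) (fun i j => .horiz i j ∈ S) w h) :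
    sInf {x : ℤ | ∃ s ∈ S, x = s.minX} = 0 ∧ sInf {x : ℤ | ∃ s ∈ S, x = s.minY} = 0 ∧
      loopW S = w ∧ loopH S = h := by
  obtain ⟨j0, h0⟩ := L.left
  obtain ⟨j1, h1⟩ := L.right
  obtain ⟨i0, h2⟩ := L.bot
  obtain ⟨i1, h3⟩ := L.top
  have minX : sInf {x : ℤ | ∃ s ∈ S, x = s.minX} = 0 := IsLeast.csInf_eq
    ⟨⟨_, h0, rfl⟩, by
      rintro _ ⟨⟨i, j⟩ | ⟨i, j⟩, hs, rfl⟩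
      · exact (L.rangeV _ _ hs).1
      · exact (L.rangeH _ _ hs).1⟩
  have minY : sInf {x : ℤ | ∃ s ∈ S, x = s.minY} = 0 := IsLeast.csInf_eq
    ⟨⟨_, h2, rfl⟩, by
      rintro _ ⟨⟨i, j⟩ | ⟨i, j⟩, hs, rfl⟩
      · exact (L.rangeV _ _ hs).2.2.1
      · exact (L.rangeH _ _ hs).2.2.1⟩
  have maxX : sSup {x : ℤ | ∃ s ∈ S, x = s.maxX} = w := IsGreatest.csSup_eq
    ⟨⟨_, h1, rfl⟩, by
      rintro _ ⟨⟨i, j⟩ | ⟨i, j⟩, hs, rfl⟩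
      · exact (L.rangeV _ _ hs).2.1
      · exact (L.rangeH _ _ hs).2.1⟩
  have maxY : sSup {x : ℤ | ∃ s ∈ S, x = s.maxY} = h := IsGreatest.csSup_eq
    ⟨⟨_, h3, rfl⟩, by
      rintro _ ⟨⟨i, j⟩ | ⟨i, j⟩, hs, rfl⟩
      · exact (L.rangeV _ _ hs).2.2.2
      · exact (L.rangeH _ _ hs).2.2.2⟩
  exact ⟨minX, minY, by rw [loopW, minX, maxX, sub_zero], by rw [loopH, minY, maxY, sub_zero]⟩

theorem GridLoop.congr {ε η ε' η' : ℤ → ZMod 2} {V H : ℤ → ℤ → Prop} {w h : ℤ}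
    (L : GridLoop ε η V H w h) (hε : ∀ i, 0 ≤ i → i ≤ w → ε' i = ε i)
    (hη : ∀ i, 0 ≤ i → i ≤ h → η' i = η i) : GridLoop ε' η' V H w h where
  __ := L
  patV i j hij := by
    have := L.rangeV i j hij
    rw [L.patV i j hij, hε i (by omega) (by omega)]
  patH i j hij := by
    have := L.rangeH i j hij
    rw [L.patH i j hij, hη j (by omega) (by omega)]

/-- The normalized loop `S` is encoded by the pair of excursions `l₁`, `l₂` of height `k`. -/
structure Encodes (S : Finset Stitch) (k : ℕ) (l₁ l₂ : List Bool) : Prop where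
  isNormLoop : IsNormLoop S
  gridLoop : GridLoop (lab (k + 1) l₁) (lab (k + 1) l₂) (fun i j => .vert i j ∈ S)
    (fun i j => .horiz i j ∈ S) (l₁.length - 1) (l₂.length - 1)
  isExc₁ : IsExc k l₁
  isExc₂ : IsExc k l₂

theorem IsNormLoop.exists_encodes {S : Finset Stitch} (hS : IsNormLoop S) :
    ∃ k l₁ l₂, Encodes S k l₁ l₂ := by
  obtain ⟨ε, η, L⟩ := IsNormLoop.exists_gridLoop hS
  obtain ⟨p, hp⟩ := L.exists_frame
  obtain ⟨n₁, hn₁⟩ : ∃ n : ℕ, (n : ℤ) = loopW S + 1 := by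
    obtain ⟨j, hj⟩ := L.left
    have := L.rangeV 0 j hj
    exact ⟨(loopW S + 1).toNat, by omega⟩
  obtain ⟨n₂, hn₂⟩ : ∃ n : ℕ, (n : ℤ) = loopH S + 1 := by
    obtain ⟨j, hj⟩ := L.bot
    have := L.rangeH j 0 hj
    exact ⟨(loopH S + 1).toNat, by omega⟩
  obtain ⟨I, k, hk, A⟩ := hp (walk (steps p ε n₁)) (walk (steps p η n₂)) (walk_neg_one _)
    (walk_neg_one _) (fun i h0 h1 => by
      rw [walk_eq h0 (by rw [length_steps]; omega)]
      simp only [steps_getD (p := p) (ε := ε) h0 (show i < n₁ by omega)])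
    (fun i h0 h1 => by
      rw [walk_eq h0 (by rw [length_steps]; omega)]
      simp only [steps_getD (p := p) (ε := η) h0 (show i < n₂ by omega)])
  have hX := walk_neg_one (steps p ε n₁)
  have hY := walk_neg_one (steps p η n₂)
  obtain ⟨b, hb0, hb1, hb⟩ := A.exists_eq hX
  have hk0 := A.swap.pos hY hb0 hb1
  lift k to ℕ using by omega
  refine ⟨k, steps p ε n₁, steps p η n₂, hS, ?_, ?_, ?_⟩
  · rw [length_steps, length_steps, hn₁, hn₂, add_sub_cancel_right, add_sub_cancel_right]
    rw [Int.cast_natCast] at hk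
    rw [← hk]
    exact L.congr (fun i h0 h1 => lab_steps h0 (by omega)) fun i h0 h1 => lab_steps h0 (by omega)
  · rw [isExc_iff, length_steps, hn₁, add_sub_cancel_right]
    exact ⟨A.ends_eq.trans hX, fun i h0 h1 => ⟨A.pos hX h0 h1, A.swap.le hY h0 h1⟩,
      A.swap.exists_eq hY⟩
  · rw [isExc_iff, length_steps, hn₂, add_sub_cancel_right]
    exact ⟨A.swap.ends_eq.trans hY, fun i h0 h1 => ⟨A.swap.pos hY h0 h1, A.le hX h0 h1⟩,
      A.exists_eq hX⟩

theorem IsExc.lab_zero {k : ℕ} {l : List Bool} (hl : IsExc k l) (p : ZMod 2) : lab p l 0 = p := by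
  obtain ⟨t, rfl, -, -⟩ := hl
  simp [lab]

namespace Encodes

variable {S S' : Finset Stitch} {k k' : ℕ} {l₁ l₂ l₁' l₂' : List Bool}

theorem exists_frame (E : Encodes S k l₁ l₂) : ∃ I, Frame (fun i j => .vert i j ∈ S)
    (fun i j => .horiz i j ∈ S) I (walk l₁) (walk l₂) k (l₁.length - 1) (l₂.length - 1) := by
  obtain ⟨p, hp⟩ := E.gridLoop.exists_frame
  have e₁ := isExc_iff.1 E.isExc₁
  have e₂ := isExc_iff.1 E.isExc₂
  have hpk : p = k + 1 := by
    set n₁ := l₁.length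
    set n₂ := l₂.length
    obtain ⟨I, k', hk, A⟩ := hp (walk (steps p (lab (k + 1) l₁) n₁))
      (walk (steps p (lab (k + 1) l₂) n₂)) (walk_neg_one _)
      (walk_neg_one _) (fun i h0 h1 => by
        rw [walk_eq h0 (by rw [length_steps]; omega)]
        simp only [steps_getD (p := p) (ε := lab (k + 1) l₁) h0 (show i < n₁ by omega)])
      (fun i h0 h1 => by
        rw [walk_eq h0 (by rw [length_steps]; omega)]
        simp only [steps_getD (p := p) (ε := lab (k + 1) l₂) h0 (show i < n₂ by omega)])
    have hw := A.pos_width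
    have h0 := A.pos (walk_neg_one _) le_rfl hw
    rw [walk_eq le_rfl (by rw [length_steps]; omega), zero_sub, walk_neg_one] at h0
    simp only [steps_getD (p := p) (ε := lab (k + 1) l₁) le_rfl (show (0 : ℤ) < n₁ by omega)] at h0
    rw [E.isExc₁.lab_zero] at h0
    by_contra hcon
    rw [Int.cast_zero, zero_add, zero_add, if_neg (Ne.symm hcon)] at h0
    omega
  obtain ⟨I, k', hk, A⟩ := hp (walk l₁) (walk l₂) (walk_neg_one _) (walk_neg_one _)
    (fun i h0 h1 => by
      rw [walk_eq h0 (by omega)]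
      simp only [hpk, add_lab_eq_iff])
    (fun i h0 h1 => by
      rw [walk_eq h0 (by omega)]
      simp only [hpk, add_lab_eq_iff])
  obtain ⟨b, hb0, hb1, hb⟩ := A.exists_eq (walk_neg_one _)
  obtain ⟨-, e₃, c, hc0, hc1, hc⟩ := e₂
  have h1 := (e₃ b hb0 hb1).2
  have h2 := A.le (walk_neg_one _) hc0 hc1
  obtain rfl : k' = k := by omega
  exact ⟨I, A⟩

theorem loopW_eq (E : Encodes S k l₁ l₂) : loopW S = l₁.length - 1 := E.gridLoop.bounds.2.2.1

theorem loopH_eq (E : Encodes S k l₁ l₂) : loopH S = l₂.length - 1 := E.gridLoop.bounds.2.2.2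

theorem subset (E : Encodes S k l₁ l₂) (E' : Encodes S' k l₁ l₂) : S ⊆ S' := by
  obtain ⟨I, A⟩ := E.exists_frame
  obtain ⟨I', A'⟩ := E'.exists_frame
  obtain ⟨-, -, i, h0, h1, hi⟩ := isExc_iff.1 E.isExc₁
  have key := E.gridLoop.imp E'.gridLoop.toGridCurve (A.horiz_bot (walk_neg_one _) h0 h1 hi)
    (A'.horiz_bot (walk_neg_one _) h0 h1 hi)
  rintro (⟨i, j⟩ | ⟨i, j⟩) hs
  · exact key.1 i j hs
  · exact key.2 i j hs

end Encodes

theorem GridLoop.exists_vert_on_line {ε η : ℤ → ZMod 2} {V H : ℤ → ℤ → Prop} {w h : ℤ}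
    (L : GridLoop ε η V H w h) {i : ℤ} (h0 : 0 ≤ i) (h1 : i ≤ w) : ∃ j, V i j := by
  rcases h1.eq_or_lt with rfl | h1
  · exact L.right
  · obtain ⟨j, hj⟩ := L.exists_horiz_in_column h0 h1
    exact ((L.even i j).2 (Or.inl hj)).elim (fun h => ⟨_, h⟩) fun h => ⟨_, h⟩

theorem list_eq_of_lab_eq {k k' : ℕ} {l l' : List Bool} (hl : IsExc k l) (hl' : IsExc k' l')
    (hlen : l.length = l'.length)
    (hlab : ∀ i : ℤ, 0 ≤ i → i < l.length → lab (k + 1) l i = lab (k' + 1) l' i) : l = l' := by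
  have hpos : 0 < l.length := by
    obtain ⟨t, rfl, -, -⟩ := hl
    simp
  have hk := hlab 0 le_rfl (by omega)
  rw [hl.lab_zero, hl'.lab_zero] at hk
  refine List.ext_getElem hlen fun n h1 h2 => ?_
  have h3 := hlab n (by omega) (by omega)
  have e1 := add_lab_eq_iff (p := k + 1) (l := l) (i := n)
  have e2 := add_lab_eq_iff (p := k' + 1) (l := l') (i := n)
  rw [← h3, ← hk, e1] at e2
  simpa [h1, h2] using e2

theorem IsExc.height_unique {k k' : ℕ} {l : List Bool} (h : IsExc k l) (h' : IsExc k' l) :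
    k = k' := by
  obtain ⟨-, h1, i, h2, h3, h4⟩ := isExc_iff.1 h
  obtain ⟨-, h1', i', h2', h3', h4'⟩ := isExc_iff.1 h'
  have := (h1 i' h2' h3').2
  have := (h1' i h2 h3).2
  omega

theorem Encodes.unique {S : Finset Stitch} {k k' : ℕ} {l₁ l₂ l₁' l₂' : List Bool}
    (E : Encodes S k l₁ l₂) (E' : Encodes S k' l₁' l₂') : k = k' ∧ l₁ = l₁' ∧ l₂ = l₂' := by
  have hw := E.loopW_eq.symm.trans E'.loopW_eq
  have hh := E.loopH_eq.symm.trans E'.loopH_eq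
  have h1 : l₁ = l₁' := list_eq_of_lab_eq E.isExc₁ E'.isExc₁ (by omega) fun i h0 h1 => by
    obtain ⟨j, hj⟩ := E.gridLoop.exists_vert_on_line h0 (by omega)
    exact (E.gridLoop.patV i j hj).symm.trans (E'.gridLoop.patV i j hj)
  have h2 : l₂ = l₂' := list_eq_of_lab_eq E.isExc₂ E'.isExc₂ (by omega) fun i h0 h1 => by
    obtain ⟨j, hj⟩ := E.gridLoop.swap.exists_vert_on_line h0 (by omega)
    exact (E.gridLoop.patH j i hj).symm.trans (E'.gridLoop.patH j i hj)
  subst h1 h2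
  exact ⟨E.isExc₁.height_unique E'.isExc₁, rfl, rfl⟩

/-! ### Existence of loops -/

/-- Alternating two involutions which flip a parity runs through a cycle. -/
theorem exists_alternating_cycle {α : Type*} {σ ρ : α → α} (hσ : Function.Involutive σ)
    (hρ : Function.Involutive ρ) (hne : ∀ v, σ v ≠ ρ v) (χ : α → ZMod 2)
    (hχσ : ∀ v, χ (σ v) = χ v + 1) (hχρ : ∀ v, χ (ρ v) = χ v + 1) {B : Set α} (hB : B.Finite)
    (hBσ : ∀ v ∈ B, σ v ∈ B) (hBρ : ∀ v ∈ B, ρ v ∈ B) {v₀ : α} (hv₀ : v₀ ∈ B) :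
    ∃ (N : ℕ) (u : ℤ → α), 3 ≤ N ∧ u 0 = v₀ ∧ (∀ a b, u a = u b ↔ (N : ℤ) ∣ a - b) ∧
      (∀ a, Even a → u (a + 1) = σ (u a)) ∧ (∀ a, ¬ Even a → u (a + 1) = ρ (u a)) ∧
      ∀ a, u a ∈ B := by
  classical
  set τ : Equiv.Perm α := hσ.toPerm.trans hρ.toPerm with hτ
  have τ_apply : ∀ v, τ v = ρ (σ v) := fun _ => rfl
  set n := Function.minimalPeriod (τ • ·) v₀ with hn
  have iterB : ∀ m : ℕ, (τ ^ m) v₀ ∈ B := by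
    intro m
    induction m with
    | zero => exact hv₀
    | succ m ih =>
      rw [pow_succ', Equiv.Perm.mul_apply, τ_apply]
      exact hBρ _ (hBσ _ ih)
  have hn0 : 0 < n := by
    obtain ⟨a, b, hab, he⟩ := hB.exists_lt_map_eq_of_forall_mem iterB
    refine Function.minimalPeriod_pos_of_mem_periodicPts
      (Function.mem_periodicPts.2 ⟨b - a, by omega, ?_⟩)
    have h1 : (τ ^ (b - a)) v₀ = v₀ := by
      apply (τ ^ a).injective
      rw [← Equiv.Perm.mul_apply, ← pow_add, show a + (b - a) = b by omega, he]
    rw [Function.IsPeriodicPt, Function.IsFixedPt, smul_iterate]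
    exact h1
  have hper : ∀ a b : ℤ, (τ ^ a) v₀ = (τ ^ b) v₀ ↔ (n : ℤ) ∣ a - b := by
    intro a b
    have h1 := MulAction.zpow_smul_eq_iff_minimalPeriod_dvd (a := τ) (b := v₀)
      (n := a - b)
    rw [← hn] at h1
    rw [← h1, Equiv.Perm.smul_def, sub_eq_neg_add, zpow_add, zpow_neg, Equiv.Perm.mul_apply,
      Equiv.Perm.inv_eq_iff_eq]
  have χτ : ∀ a : ℤ, χ ((τ ^ a) v₀) = χ v₀ := by
    have two : ∀ x : ZMod 2, x + 1 + 1 = x := by decide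
    have hs : ∀ v, χ (τ v) = χ v := fun v => by rw [τ_apply, hχρ, hχσ, two]
    intro a
    induction a with
    | zero => rfl
    | succ a ih => rw [add_comm, zpow_one_add, Equiv.Perm.mul_apply, hs, ih]
    | pred a ih =>
      rw [← ih, ← hs, ← Equiv.Perm.mul_apply, ← zpow_one_add]
      congr 3
      ring
  let u : ℤ → α := fun a => if Even a then (τ ^ (a / 2)) v₀ else σ ((τ ^ (a / 2)) v₀)
  have ue : ∀ a, Even a → u a = (τ ^ (a / 2)) v₀ := fun a h => if_pos h
  have uo : ∀ a, ¬ Even a → u a = σ ((τ ^ (a / 2)) v₀) := fun a h => if_neg h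
  have hu : ∀ a b, u a = u b ↔ ((2 * n : ℕ) : ℤ) ∣ a - b := by
    have ne1 : ∀ x : ZMod 2, x + 1 ≠ x := by decide
    have dvd : ∀ m : ℤ, ((2 * n : ℕ) : ℤ) ∣ 2 * m ↔ (n : ℤ) ∣ m := by
      intro m
      rw [Nat.cast_mul, Nat.cast_ofNat]
      exact mul_dvd_mul_iff_left two_ne_zero
    have odd_sub : ∀ a b : ℤ, ¬ (Even a ↔ Even b) → ¬ ((2 * n : ℕ) : ℤ) ∣ a - b := by
      rintro a b h ⟨c, hc⟩
      apply h
      rw [← Int.even_sub, hc, Nat.cast_mul, Nat.cast_ofNat, mul_assoc]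
      exact even_two_mul _
    intro a b
    by_cases ha : Even a <;> by_cases hb : Even b
    · rw [ue a ha, ue b hb, hper, ← dvd]
      rw [Int.even_iff] at ha hb
      rw [show 2 * (a / 2 - b / 2) = a - b by omega]
    · refine iff_of_false (fun h => ?_) (odd_sub a b (by tauto))
      rw [ue a ha, uo b hb] at h
      have := congrArg χ h
      rw [hχσ, χτ, χτ] at this
      exact ne1 _ this.symm
    · refine iff_of_false (fun h => ?_) (odd_sub a b (by tauto))
      rw [uo a ha, ue b hb] at h
      have := congrArg χ h
      rw [hχσ, χτ, χτ] at this
      exact ne1 _ this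
    · rw [uo a ha, uo b hb, hσ.injective.eq_iff, hper, ← dvd]
      rw [Int.even_iff] at ha hb
      rw [show 2 * (a / 2 - b / 2) = a - b by omega]
  have hu1 : ∀ a, Even a → u (a + 1) = σ (u a) := by
    intro a ha
    rw [ue a ha, uo (a + 1) (by rw [Int.even_add_one, not_not]; exact ha)]
    rw [Int.even_iff] at ha
    rw [show (a + 1) / 2 = a / 2 by omega]
  have hu2 : ∀ a, ¬ Even a → u (a + 1) = ρ (u a) := by
    intro a ha
    rw [uo a ha, ue (a + 1) (by rw [Int.even_add_one]; exact ha), ← τ_apply,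
      ← Equiv.Perm.mul_apply, ← zpow_one_add]
    rw [Int.even_iff] at ha
    rw [show (a + 1) / 2 = 1 + a / 2 by omega]
  refine ⟨2 * n, u, ?_, ue 0 Even.zero, hu, hu1, hu2, ?_⟩
  · by_contra hcon
    have h2 : u (0 + 1 + 1) = u 0 := by
      rw [hu]
      refine ⟨1, ?_⟩
      push_cast
      omega
    rw [hu2 (0 + 1) (by decide), hu1 0 Even.zero] at h2
    exact hne (u 0) (by rw [← hρ (σ (u 0)), h2])
  · have hm : ∀ m : ℕ, u m ∈ B := by
      intro m
      induction m with
      | zero => exact hv₀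
      | succ m ih =>
        by_cases hm : Even (m : ℤ)
        · rw [Nat.cast_succ, hu1 _ hm]; exact hBσ _ ih
        · rw [Nat.cast_succ, hu2 _ hm]; exact hBρ _ ih
    intro a
    have hpos : (0 : ℤ) < (2 * n : ℕ) := by omega
    have h1 := Int.emod_nonneg a hpos.ne'
    have : u a = u ((a % (2 * n : ℕ)).toNat : ℕ) := by
      rw [hu, Int.toNat_of_nonneg h1]
      exact Int.dvd_self_sub_emod
    rw [this]
    exact hm _

/-- The other end of the vertical pattern stitch at `v`. -/
def vStep (ε : ℤ → ZMod 2) (v : ℤ × ℤ) : ℤ × ℤ :=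
  (v.1, if (v.2 : ZMod 2) = ε v.1 then v.2 + 1 else v.2 - 1)

/-- The other end of the horizontal pattern stitch at `v`. -/
def hStep (η : ℤ → ZMod 2) (v : ℤ × ℤ) : ℤ × ℤ := (vStep η v.swap).swap

theorem vStep_of_eq {ε : ℤ → ZMod 2} {v : ℤ × ℤ} (h : (v.2 : ZMod 2) = ε v.1) :
    vStep ε v = (v.1, v.2 + 1) := by rw [vStep, if_pos h]

theorem vStep_of_ne {ε : ℤ → ZMod 2} {v : ℤ × ℤ} (h : (v.2 : ZMod 2) ≠ ε v.1) :
    vStep ε v = (v.1, v.2 - 1) ∧ ((v.2 - 1 : ℤ) : ZMod 2) = ε v.1 := by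
  have dich : ∀ p x : ZMod 2, x ≠ p → x - 1 = p := by decide
  refine ⟨by rw [vStep, if_neg h], ?_⟩
  push_cast
  exact dich _ _ h

theorem vStep_involutive (ε : ℤ → ZMod 2) : Function.Involutive (vStep ε) := by
  have ne1 : ∀ x : ZMod 2, x + 1 ≠ x := by decide
  intro v
  by_cases h : (v.2 : ZMod 2) = ε v.1
  · rw [vStep_of_eq h, (vStep_of_ne _).1, add_sub_cancel_right]
    push_cast
    rw [h]
    exact ne1 _
  · obtain ⟨h1, h2⟩ := vStep_of_ne h
    rw [h1, vStep_of_eq h2, sub_add_cancel]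

theorem hStep_involutive (η : ℤ → ZMod 2) : Function.Involutive (hStep η) := by
  intro v
  rw [hStep, hStep, Prod.swap_swap, vStep_involutive, Prod.swap_swap]

theorem cast_vStep (ε : ℤ → ZMod 2) (v : ℤ × ℤ) :
    (((vStep ε v).1 + (vStep ε v).2 : ℤ) : ZMod 2) = ((v.1 + v.2 : ℤ) : ZMod 2) + 1 := by
  have e : (-1 : ZMod 2) = 1 := by decide
  by_cases h : (v.2 : ZMod 2) = ε v.1
  · rw [vStep_of_eq h]; push_cast; ring
  · rw [(vStep_of_ne h).1]; push_cast; linear_combination e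

theorem cast_hStep (η : ℤ → ZMod 2) (v : ℤ × ℤ) :
    (((hStep η v).1 + (hStep η v).2 : ℤ) : ZMod 2) = ((v.1 + v.2 : ℤ) : ZMod 2) + 1 := by
  have := cast_vStep η v.swap
  rwa [add_comm, add_comm v.swap.1] at this

theorem vStep_ne_hStep (ε η : ℤ → ZMod 2) (v : ℤ × ℤ) : vStep ε v ≠ hStep η v := by
  intro h
  have h2 : (if (v.2 : ZMod 2) = ε v.1 then v.2 + 1 else v.2 - 1) = v.2 := congrArg Prod.snd h
  split_ifs at h2 <;> omega

theorem unitStep_vStep (ε : ℤ → ZMod 2) (v : ℤ × ℤ) : UnitStep v (vStep ε v) := by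
  by_cases h : (v.2 : ZMod 2) = ε v.1
  · rw [vStep_of_eq h]; simp [UnitStep]
  · rw [(vStep_of_ne h).1]; simp [UnitStep]

theorem unitStep_hStep (η : ℤ → ZMod 2) (v : ℤ × ℤ) : UnitStep v (hStep η v) := by
  by_cases h : (v.swap.2 : ZMod 2) = η v.swap.1
  · rw [hStep, vStep_of_eq h]; simp [UnitStep]
  · rw [hStep, (vStep_of_ne h).1]; simp [UnitStep]

theorem segment_vStep {ε : ℤ → ZMod 2} {i j : ℤ} (h : (j : ZMod 2) = ε i) :
    segment ℝ (toPt (i, j)) (toPt (vStep ε (i, j))) = (Stitch.vert i j).seg := by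
  rw [vStep_of_eq (v := (i, j)) h]
  simp [toPt, Stitch.seg]

theorem segment_hStep {η : ℤ → ZMod 2} {i j : ℤ} (h : (i : ZMod 2) = η j) :
    segment ℝ (toPt (i, j)) (toPt (hStep η (i, j))) = (Stitch.horiz i j).seg := by
  rw [hStep, vStep_of_eq (v := (i, j).swap) h]
  simp [toPt, Stitch.seg]

/-- A finite set of vertices closed under following the pattern carries a loop through any
of its points. -/
theorem exists_loop_of_invariant {ε η : ℤ → ZMod 2} {B : Set (ℤ × ℤ)} (hB : B.Finite)
    (hBv : ∀ v ∈ B, vStep ε v ∈ B) (hBh : ∀ v ∈ B, hStep η v ∈ B) {a b : ℤ} (hab : (a, b) ∈ B)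
    (hp : (a : ZMod 2) = η b) :
    ∃ S : Finset Stitch, (∀ s ∈ S, s.InPattern ε η) ∧ IsCircle (curveOf ↑S) ∧
      .horiz a b ∈ S ∧ ∀ s ∈ S, (s.minX, s.minY) ∈ B := by
  classical
  obtain ⟨N, u, hN, hu0, hu, hue, huo, huB⟩ := exists_alternating_cycle (vStep_involutive ε)
    (hStep_involutive η) (vStep_ne_hStep ε η) (fun v => ((v.1 + v.2 : ℤ) : ZMod 2))
    (cast_vStep ε) (cast_hStep η) hB hBv hBh hab
  set T : Finset Stitch := hB.toFinset.image (fun v => Stitch.vert v.1 v.2) ∪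
    hB.toFinset.image (fun v => Stitch.horiz v.1 v.2)
  set S := T.filter (fun s => s.InPattern ε η ∧ ∃ c, u c = (s.minX, s.minY)) with hS
  have memV : ∀ c i j, u c = (i, j) → (j : ZMod 2) = ε i → .vert i j ∈ S := by
    intro c i j hc hj
    refine Finset.mem_filter.2 ⟨?_, hj, c, hc⟩
    exact Finset.mem_union_left _ (Finset.mem_image.2 ⟨(i, j), hB.mem_toFinset.2 (hc ▸ huB c), rfl⟩)
  have memH : ∀ c i j, u c = (i, j) → (i : ZMod 2) = η j → .horiz i j ∈ S := by
    intro c i j hc hj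
    refine Finset.mem_filter.2 ⟨?_, hj, c, hc⟩
    exact Finset.mem_union_right _
      (Finset.mem_image.2 ⟨(i, j), hB.mem_toFinset.2 (hc ▸ huB c), rfl⟩)
  have hcurve : curveOf ↑S = ⋃ c, segment ℝ (toPt (u c)) (toPt (u (c + 1))) := by
    apply subset_antisymm
    · refine Set.iUnion₂_subset fun s hs => ?_
      obtain ⟨-, hsp, c, hc⟩ := Finset.mem_filter.1 hs
      have prev : u (c - 1 + 1) = u c := by rw [sub_add_cancel]
      by_cases he : Even c
      · cases s with
        | vert i j =>
          refine subset_trans (Eq.subset ?_) (Set.subset_iUnion _ c)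
          rw [hue c he, show u c = (i, j) from hc, segment_vStep hsp]
        | horiz i j =>
          refine subset_trans (Eq.subset ?_) (Set.subset_iUnion _ (c - 1))
          rw [prev, ← hStep_involutive η (u (c - 1)), ← huo (c - 1) (by
            rw [Int.even_sub_one, not_not]; exact he), prev, segment_symm,
            show u c = (i, j) from hc, segment_hStep hsp]
      · cases s with
        | vert i j =>
          refine subset_trans (Eq.subset ?_) (Set.subset_iUnion _ (c - 1))
          rw [prev, ← vStep_involutive ε (u (c - 1)), ← hue (c - 1) (by
            rw [Int.even_sub_one]; exact he), prev, segment_symm,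
            show u c = (i, j) from hc, segment_vStep hsp]
        | horiz i j =>
          refine subset_trans (Eq.subset ?_) (Set.subset_iUnion _ c)
          rw [huo c he, show u c = (i, j) from hc, segment_hStep hsp]
    · refine Set.iUnion_subset fun c => ?_
      obtain ⟨i, j, hc⟩ : ∃ i j, u c = (i, j) := ⟨_, _, rfl⟩
      by_cases he : Even c
      · by_cases hj : (j : ZMod 2) = ε i
        · refine subset_trans (Eq.subset ?_) (Set.subset_biUnion_of_mem (memV c i j hc hj))
          rw [hue c he, hc, segment_vStep hj]
        · obtain ⟨h1, h2⟩ := vStep_of_ne (v := (i, j)) hj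
          have h3 : u (c + 1) = (i, j - 1) := by rw [hue c he, hc, h1]
          refine subset_trans (Eq.subset ?_) 
            (Set.subset_biUnion_of_mem (memV (c + 1) i (j - 1) h3 h2))
          rw [h3, ← segment_vStep h2, segment_symm, ← h1, vStep_involutive, hc]
      · by_cases hj : (i : ZMod 2) = η j
        · refine subset_trans (Eq.subset ?_) (Set.subset_biUnion_of_mem (memH c i j hc hj))
          rw [huo c he, hc, segment_hStep hj]
        · obtain ⟨h1, h2⟩ := vStep_of_ne (v := (j, i)) hj
          have h4 : hStep η (i, j) = (i - 1, j) := congrArg Prod.swap h1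
          have h3 : u (c + 1) = (i - 1, j) := by rw [huo c he, hc, h4]
          refine subset_trans (Eq.subset ?_) 
            (Set.subset_biUnion_of_mem (memH (c + 1) (i - 1) j h3 h2))
          rw [h3, ← segment_hStep h2, segment_symm, ← h4, hStep_involutive, hc]
  refine ⟨S, fun s hs => (Finset.mem_filter.1 hs).2.1, ?_, memH 0 a b hu0 hp, fun s hs => ?_⟩
  · rw [hcurve]
    refine isCircle_of_cycle hN hu fun c => ?_
    by_cases he : Even c
    · rw [hue c he]; exact unitStep_vStep ε _
    · rw [huo c he]; exact unitStep_hStep η _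
  · obtain ⟨-, -, c, hc⟩ := Finset.mem_filter.1 hs
    exact hc ▸ huB c

/-- Two height functions of maximum `k`, vanishing at both ends, driven by the labels
`ε` and `η`. -/
structure Heights (ε η : ℤ → ZMod 2) (X Y : ℤ → ℤ) (k w h : ℤ) : Prop where
  stepX : ∀ i, 0 ≤ i → i ≤ w → X i = X (i - 1) + if (i : ZMod 2) + ε i = k + 1 then 1 else -1
  stepY : ∀ j, 0 ≤ j → j ≤ h → Y j = Y (j - 1) + if (j : ZMod 2) + η j = k + 1 then 1 else -1
  startX : X (-1) = 0
  startY : Y (-1) = 0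
  endX : X w = 0
  endY : Y h = 0
  posX : ∀ i, 0 ≤ i → i < w → 0 < X i ∧ X i ≤ k
  posY : ∀ j, 0 ≤ j → j < h → 0 < Y j ∧ Y j ≤ k
  maxX : ∃ i, 0 ≤ i ∧ i < w ∧ X i = k
  maxY : ∃ j, 0 ≤ j ∧ j < h ∧ Y j = k

namespace Heights

variable {ε η : ℤ → ZMod 2} {X Y : ℤ → ℤ} {k w h : ℤ}

theorem swap (A : Heights ε η X Y k w h) : Heights η ε Y X k h w :=
  ⟨A.stepY, A.stepX, A.startY, A.startX, A.endY, A.endX, A.posY, A.posX, A.maxY, A.maxX⟩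

theorem le (A : Heights ε η X Y k w h) {i : ℤ} (h0 : -1 ≤ i) (h1 : i ≤ w) :
    0 ≤ X i ∧ X i ≤ k ∧ (X i = 0 → i = -1 ∨ i = w) := by
  obtain ⟨a, ha0, ha1, ha⟩ := A.maxX
  have := A.posX a ha0 ha1
  rcases h0.eq_or_lt with rfl | h0
  · have := A.startX
    omega
  rcases h1.eq_or_lt with rfl | h1
  · have := A.endX
    omega
  have := A.posX i (by omega) h1
  omega

theorem level_left (A : Heights ε η X Y k w h) {i j : ℤ} (h0 : 0 ≤ i) (h1 : i ≤ w)
    (hj : (j : ZMod 2) = ε i) :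
    level (k + 1) X Y i j = level (k + 1) X Y (i - 1) j :=
  level_vert (A.stepX i h0 h1) hj

/-- The heights on both sides of a vertical pattern stitch of level `k`. -/
theorem sides (A : Heights ε η X Y k w h) {i j : ℤ} (h0 : 0 ≤ i) (h1 : i ≤ w)
    (hj : (j : ZMod 2) = ε i) (hk : level (k + 1) X Y i j = k) :
    (X i + Y j = k + 1 ∧ X (i - 1) + Y j = k) ∨ (X i + Y j = k ∧ X (i - 1) + Y j = k + 1) := by
  have h2 := A.stepX i h0 h1
  rw [← hj] at h2
  rw [level] at hk
  split_ifs at h2 hk <;> omega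

/-- The vertices of the box next to cells of level `k`. -/
def region (ε η : ℤ → ZMod 2) (X Y : ℤ → ℤ) (k w h : ℤ) : Set (ℤ × ℤ) :=
  {v | (0 ≤ v.1 ∧ v.1 ≤ w) ∧ (0 ≤ v.2 ∧ v.2 ≤ h) ∧
    cornerVal ε η (level (k + 1) X Y) v.1 v.2 = k}

theorem finite_region : (region ε η X Y k w h).Finite :=
  ((Set.finite_Icc 0 w).prod (Set.finite_Icc 0 h)).subset fun _ hv => ⟨hv.1, hv.2.1⟩

theorem swap_mem_region {v : ℤ × ℤ} :
    v.swap ∈ region ε η X Y k w h ↔ v ∈ region η ε Y X k h w := by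
  have : (fun a b => level (k + 1) X Y b a) = level (k + 1) Y X := by
    ext a b; exact level_swap _ _ _ _ _
  simp only [region, Set.mem_ofPred_eq, Prod.fst_swap, Prod.snd_swap]
  rw [cornerVal_swap, this]
  tauto

theorem row_range (A : Heights ε η X Y k w h) {i j : ℤ} (h0 : 0 ≤ i) (h1 : i ≤ w)
    (hj : (j : ZMod 2) = ε i) (hk : level (k + 1) X Y i j = k) (h2 : -1 ≤ j) (h3 : j ≤ h) :
    0 ≤ j ∧ j < h := by
  have e1 := A.sides h0 h1 hj hk
  have e2 := A.le (i := i) (by omega) h1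
  have e3 := A.le (i := i - 1) (by omega) (by omega)
  constructor
  · by_contra hcon
    obtain rfl : j = -1 := by omega
    have := A.startY
    omega
  · by_contra hcon
    obtain rfl : j = h := by omega
    have := A.endY
    omega

theorem vStep_mem_region (A : Heights ε η X Y k w h) {v : ℤ × ℤ}
    (hv : v ∈ region ε η X Y k w h) : vStep ε v ∈ region ε η X Y k w h := by
  obtain ⟨i, j⟩ := v
  obtain ⟨⟨h0, h1⟩, ⟨h2, h3⟩, h4⟩ := hv
  dsimp only at h0 h1 h2 h3 h4
  by_cases hj : (j : ZMod 2) = ε i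
  · rw [vStep_of_eq (v := (i, j)) hj]
    have hc := cornerVal_vert η hj (A.level_left h0 h1 hj)
    rw [h4] at hc
    have := A.row_range h0 h1 hj hc.1.symm (by omega) h3
    exact ⟨⟨h0, h1⟩, ⟨by dsimp only; omega, by dsimp only; omega⟩, hc.2.trans hc.1.symm⟩
  · obtain ⟨e1, e2⟩ := vStep_of_ne (v := (i, j)) hj
    rw [e1]
    have hc := cornerVal_vert η e2 (A.level_left h0 h1 e2)
    dsimp only at hc e2
    rw [sub_add_cancel, h4] at hc
    have := A.row_range h0 h1 e2 hc.2.symm (by omega) (by omega)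
    exact ⟨⟨h0, h1⟩, ⟨by dsimp only; omega, by dsimp only; omega⟩, hc.1.trans hc.2.symm⟩

theorem hStep_mem_region (A : Heights ε η X Y k w h) {v : ℤ × ℤ}
    (hv : v ∈ region ε η X Y k w h) : hStep η v ∈ region ε η X Y k w h := by
  rw [hStep, swap_mem_region]
  exact A.swap.vStep_mem_region (swap_mem_region.1 (by rwa [Prod.swap_swap]))

theorem level_of_vert (A : Heights ε η X Y k w h) {i j : ℤ} (hj : (j : ZMod 2) = ε i)
    (hv : (i, j) ∈ region ε η X Y k w h) : level (k + 1) X Y i j = k := by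
  rw [← (cornerVal_vert η hj (A.level_left hv.1.1 hv.1.2 hj)).1]
  exact hv.2.2

theorem exists_isCircle (A : Heights ε η X Y k w h) : ∃ S : Finset Stitch,
    (∀ s ∈ S, s.InPattern ε η) ∧ IsCircle (curveOf ↑S) ∧ (∃ a, X a = k ∧ .horiz a 0 ∈ S) ∧
    ∀ s ∈ S, (s.minX, s.minY) ∈ region ε η X Y k w h := by
  obtain ⟨a, ha0, ha1, ha⟩ := A.maxX
  obtain ⟨b, hb0, hb1, hb⟩ := A.maxY
  have hY := A.stepY 0 le_rfl (by omega)
  have hY0 := A.posY 0 le_rfl (by omega)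
  rw [zero_sub, A.startY] at hY
  have hη : η 0 = k + 1 := by
    by_contra hcon
    rw [Int.cast_zero, zero_add, zero_add, if_neg hcon] at hY
    omega
  rw [hη, Int.cast_zero, zero_add, zero_add, if_pos rfl] at hY
  have hpar := cast_eq_of_step _ A.startX A.stepX (i := a) (by omega) ha1.le
  have hpa : (a : ZMod 2) = k + 1 := by
    have : ∀ x y : ZMod 2, x = y + 1 → y = x + 1 := by decide
    rw [ha] at hpar
    exact this _ _ hpar
  have hpη : (a : ZMod 2) = η 0 := hpa.trans hη.symm
  have hmem : (a, 0) ∈ region ε η X Y k w h := by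
    refine ⟨⟨ha0, ha1.le⟩, ⟨le_rfl, by dsimp only; omega⟩, ?_⟩
    rw [(cornerVal_horiz ε hpη (level_horiz (A.stepY 0 le_rfl (by omega)) hpη)).1, level,
      Int.cast_zero, add_zero, if_pos hpa, ha, hY]
    ring
  obtain ⟨S, h1, h2, h3, h4⟩ := exists_loop_of_invariant finite_region
    (fun v => A.vStep_mem_region) (fun v => A.hStep_mem_region) hmem hpη
  exact ⟨S, h1, h2, ⟨a, ha, h3⟩, h4⟩

theorem exists_gridLoop (A : Heights ε η X Y k w h) : ∃ S : Finset Stitch,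
    (∀ s ∈ S, s.InPattern ε η) ∧ IsCircle (curveOf ↑S) ∧
    GridLoop ε η (fun i j => .vert i j ∈ S) (fun i j => .horiz i j ∈ S) w h := by
  obtain ⟨S, hS, hC, ⟨a, ha, ha0⟩, hreg⟩ := A.exists_isCircle
  have levV : ∀ i j, .vert i j ∈ S → level (k + 1) X Y i j = k := fun i j hij =>
    A.level_of_vert (hS _ hij) (hreg _ hij)
  have levH : ∀ i j, .horiz i j ∈ S → level (k + 1) Y X j i = k := fun i j hij =>
    A.swap.level_of_vert (hS _ hij) (swap_mem_region (v := (j, i)).1 (hreg _ hij))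
  have rangeV : ∀ i j, .vert i j ∈ S → (0 ≤ i ∧ i ≤ w) ∧ 0 ≤ j ∧ j < h := fun i j hij => by
    obtain ⟨h1, h2, -⟩ := hreg _ hij
    dsimp only [Stitch.minX, Stitch.minY] at h1 h2
    exact ⟨h1, A.row_range h1.1 h1.2 (hS _ hij) (levV i j hij) (by omega) h2.2⟩
  have rangeH : ∀ i j, .horiz i j ∈ S → (0 ≤ i ∧ i < w) ∧ 0 ≤ j ∧ j ≤ h := fun i j hij => by
    obtain ⟨h1, h2, -⟩ := hreg _ hij
    dsimp only [Stitch.minX, Stitch.minY] at h1 h2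
    exact ⟨A.swap.row_range h2.1 h2.2 (hS _ hij) (levH i j hij) (by omega) h1.2, h2⟩
  have L : GridCurve ε η (fun i j => .vert i j ∈ S) (fun i j => .horiz i j ∈ S) w h := by
    refine gridCurve_of_isCircle hS hC ?_ ?_ <;> rintro (⟨i, j⟩ | ⟨i, j⟩) hs
    · exact (rangeV i j hs).1
    · exact (rangeH i j hs).1
    · exact (rangeV i j hs).2
    · exact (rangeH i j hs).2
  have top : .horiz a h ∈ S := by
    obtain ⟨c, hc0, hc⟩ := L.exists_ne_horiz ha0
    have hr := rangeH a c hc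
    have e1 := A.swap.sides hr.2.1 hr.2.2 (hS _ hc) (levH a c hc)
    have e2 := A.swap.le (i := c) (by omega) hr.2.2
    have e3 := A.swap.le (i := c - 1) (by omega) (by omega)
    obtain rfl : c = h := by omega
    exact hc
  obtain ⟨b, hb0, hb1, hb⟩ := A.maxY
  obtain ⟨i, hi⟩ := L.swap.exists_horiz_between (a := b) ha0 hb0 top hb1
  have ends : ∀ i, .vert i b ∈ S → i = 0 ∨ i = w := by
    intro i hi
    have hr := rangeV i b hi
    have e1 := A.sides hr.1.1 hr.1.2 (hS _ hi) (levV i b hi)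
    have e2 := A.le (i := i) (by omega) hr.1.2
    have e3 := A.le (i := i - 1) (by omega) (by omega)
    omega
  obtain ⟨i', hne, hi'⟩ := L.swap.exists_ne_horiz hi
  have hi0 := ends i hi
  have hi0' := ends i' hi'
  refine ⟨S, hS, hC, L, ?_, ?_, ⟨a, ha0⟩, ⟨a, top⟩⟩
  · rcases hi0 with rfl | rfl
    · exact ⟨b, hi⟩
    · obtain rfl : i' = 0 := by omega
      exact ⟨b, hi'⟩
  · rcases hi0 with rfl | rfl
    · obtain rfl : i' = w := by omega
      exact ⟨b, hi'⟩
    · exact ⟨b, hi⟩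

end Heights

theorem exists_encodes {k : ℕ} {l₁ l₂ : List Bool} (h₁ : IsExc k l₁) (h₂ : IsExc k l₂) :
    ∃ S, Encodes S k l₁ l₂ := by
  obtain ⟨a1, a2, a3⟩ := isExc_iff.1 h₁
  obtain ⟨b1, b2, b3⟩ := isExc_iff.1 h₂
  have A : Heights (lab (k + 1) l₁) (lab (k + 1) l₂) (walk l₁) (walk l₂) k (l₁.length - 1)
      (l₂.length - 1) :=
    { stepX := fun i h0 h1 => by
        rw [walk_eq h0 (by omega), Int.cast_natCast]
        simp only [add_lab_eq_iff]
      stepY := fun i h0 h1 => by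
        rw [walk_eq h0 (by omega), Int.cast_natCast]
        simp only [add_lab_eq_iff]
      startX := walk_neg_one _
      startY := walk_neg_one _
      endX := a1
      endY := b1
      posX := a2
      posY := b2
      maxX := a3
      maxY := b3 }
  obtain ⟨S, hS, hC, L⟩ := A.exists_gridLoop
  exact ⟨S, ⟨⟨_, _, hS⟩, hC, L.bounds.1, L.bounds.2.1⟩, L, h₁, h₂⟩

/-! ### Weighted counting of excursions -/

open ENNReal

open Classical in
/-- The total weight of the words satisfying `P`, where a word of length `n` has weight `2⁻ⁿ`. -/
noncomputable def wordSum (P : List Bool → Prop) : ℝ≥0∞ :=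
  ∑' l : List Bool, if P l then 2⁻¹ ^ l.length else 0

theorem wordSum_congr {P Q : List Bool → Prop} (h : ∀ l, P l ↔ Q l) : wordSum P = wordSum Q := by
  rw [funext fun l => propext (h l)]

theorem wordSum_false : wordSum (fun _ => False) = 0 := by simp [wordSum]

theorem wordSum_eq_add (P : List Bool → Prop) [Decidable (P [])] :
    wordSum P = (if P [] then 1 else 0) +
      2⁻¹ * (wordSum (fun l => P (true :: l)) + wordSum fun l => P (false :: l)) := by
  classical
  rw [wordSum, ENNReal.tsum_eq_add_tsum_ite []]
  congr 1
  · simp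
  · have hinj : Function.Injective fun p : Bool × List Bool => p.1 :: p.2 := by
      rintro ⟨a, l⟩ ⟨b, m⟩ h
      simpa using h
    rw [← hinj.tsum_eq, ENNReal.tsum_prod', tsum_bool, add_comm, mul_add]
    · simp only [wordSum, ← ENNReal.tsum_mul_left, reduceCtorEq, if_false, List.length_cons,
        mul_ite, mul_zero, pow_succ']
    · intro l hl
      cases l with
      | nil => simp at hl
      | cons b l => exact ⟨(b, l), rfl⟩

theorem wordSum_add_of_disjoint {P Q : List Bool → Prop} (h : ∀ l, P l → ¬ Q l) :
    wordSum (fun l => P l ∨ Q l) = wordSum P + wordSum Q := by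
  classical
  rw [wordSum, wordSum, wordSum, ← ENNReal.tsum_add]
  refine tsum_congr fun l => ?_
  by_cases hP : P l
  · simp [hP, h l hP]
  · simp [hP]

theorem wordSum_isPath_lt_le (k n : ℕ) (x : ℤ) :
    wordSum (fun l => IsPath k x l ∧ l.length < n) ≤ 1 := by
  induction n generalizing x with
  | zero => simp [wordSum]
  | succ n ih =>
    classical
    rw [wordSum_eq_add]
    by_cases hx : x = 0
    · subst hx
      simp [IsPath, wordSum_false]
    · have key (b : Bool) :
          wordSum (fun l => IsPath k x (b :: l) ∧ (b :: l).length < n + 1) ≤ 1 := by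
        by_cases h : 1 ≤ x ∧ x ≤ k
        · rw [wordSum_congr (Q := fun l => IsPath k (x + sgn b) l ∧ l.length < n)
            fun l => by simp [IsPath, h]]
          exact ih _
        · rw [wordSum_congr (Q := fun _ => False) fun l => by simp only [IsPath]; tauto,
            wordSum_false]
          exact zero_le_one
      have h0 : ¬ (IsPath k x [] ∧ ([] : List Bool).length < n + 1) := fun h => hx h.1
      rw [if_neg h0, zero_add]
      calc _ ≤ (2⁻¹ : ℝ≥0∞) * (1 + 1) := by gcongr <;> apply key
        _ = 1 := by rw [one_add_one_eq_two, ENNReal.inv_mul_cancel (by simp) (by simp)]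

theorem wordSum_isPath_le (k : ℕ) (x : ℤ) : wordSum (IsPath k x) ≤ 1 := by
  classical
  rw [wordSum, ENNReal.tsum_eq_iSup_sum]
  refine iSup_le fun s => ?_
  refine le_trans (le_trans (Finset.sum_le_sum fun l hl => ?_) (ENNReal.sum_le_tsum s))
    (wordSum_isPath_lt_le k (s.sup List.length + 1) x)
  have := Finset.le_sup (f := List.length) hl
  simp [this]

theorem wordSum_isPath_ne_top (k : ℕ) (x : ℤ) : wordSum (IsPath k x) ≠ ∞ :=
  ne_top_of_le_ne_top one_ne_top (wordSum_isPath_le k x)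

theorem wordSum_isPath_zero (k : ℕ) : wordSum (IsPath k 0) = 1 := by
  classical
  rw [wordSum_eq_add]
  simp [IsPath, wordSum_false]

theorem wordSum_isPath_succ (k : ℕ) : wordSum (IsPath k (k + 1)) = 0 := by
  classical
  have : (k : ℤ) + 1 ≠ 0 := by omega
  rw [wordSum_eq_add]
  simp [IsPath, wordSum_false, this]

theorem toReal_wordSum_isPath {k : ℕ} {x : ℤ} (h1 : 1 ≤ x) (h2 : x ≤ k) :
    2 * (wordSum (IsPath k x)).toReal =
      (wordSum (IsPath k (x + 1))).toReal + (wordSum (IsPath k (x - 1))).toReal := by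
  classical
  have h0 : x ≠ 0 := by omega
  rw [wordSum_eq_add, ← ENNReal.toReal_add (wordSum_isPath_ne_top _ _) (wordSum_isPath_ne_top _ _)]
  simp only [IsPath, h0, h1, h2, true_and, if_false, zero_add, toReal_mul, toReal_inv, sgn,
    if_true, toReal_ofNat, Bool.false_eq_true, ← sub_eq_add_neg]
  ring

theorem toReal_wordSum_isPath_one (k : ℕ) :
    (wordSum (IsPath k 1)).toReal = 1 - 1 / (k + 1) := by
  set u : ℕ → ℝ := fun n => (wordSum (IsPath k n)).toReal with hu
  have key (n : ℕ) (hn : n ≤ k) :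
      u n = 1 - n * (1 - u 1) ∧ u (n + 1) = 1 - (n + 1) * (1 - u 1) := by
    induction n with
    | zero => simp [hu, wordSum_isPath_zero]
    | succ n ih =>
      obtain ⟨a, b⟩ := ih (by omega)
      have := toReal_wordSum_isPath (k := k) (x := (n + 1 : ℕ)) (by omega) (by omega)
      rw [show ((n + 1 : ℕ) : ℤ) - 1 = (n : ℕ) by omega,
        show ((n + 1 : ℕ) : ℤ) + 1 = (n + 1 + 1 : ℕ) by omega] at this
      change 2 * u (n + 1) = u (n + 1 + 1) + u n at this
      push_cast
      exact ⟨b, by linarith⟩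
  have h1 : u (k + 1) = 0 := by
    simp only [hu, Nat.cast_add, Nat.cast_one, wordSum_isPath_succ, toReal_zero]
  have h2 := (key k le_rfl).2
  rw [h1] at h2
  change u 1 = _
  field_simp
  linarith

theorem IsPath.mono {k m : ℕ} (h : k ≤ m) {x : ℤ} {l : List Bool} (hl : IsPath k x l) :
    IsPath m x l := by
  rw [isPath_iff] at hl ⊢
  exact ⟨fun n hn => ⟨(hl.1 n hn).1, (hl.1 n hn).2.trans (by exact_mod_cast h)⟩, hl.2⟩

theorem wordSum_isExc (k : ℕ) :
    wordSum (IsExc k) = ENNReal.ofReal (1 / (2 * k * (k + 1))) := by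
  classical
  set P : List Bool → Prop := fun t => IsPath k 1 t ∧ ¬ IsPath (k - 1) 1 t with hP
  have h1 : wordSum (IsExc k) = 2⁻¹ * wordSum P := by
    rw [wordSum_eq_add]
    simp [IsExc, wordSum_false, hP]
  have h2 : wordSum (IsPath k 1) = wordSum P + wordSum (IsPath (k - 1) 1) := by
    rw [← wordSum_add_of_disjoint fun l hl => hl.2]
    refine wordSum_congr fun l => ?_
    have := @IsPath.mono (k - 1) k (Nat.sub_le k 1) 1 l
    tauto
  have h3 : wordSum P ≠ ∞ := fun h =>
    wordSum_isPath_ne_top k 1 (by rw [h2, h, top_add])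
  have h4 := congrArg ENNReal.toReal h2
  rw [toReal_add h3 (wordSum_isPath_ne_top _ _), toReal_wordSum_isPath_one,
    toReal_wordSum_isPath_one] at h4
  rw [h1, ← ENNReal.ofReal_toReal (mul_ne_top (by simp) h3)]
  congr 1
  rw [toReal_mul, toReal_inv, toReal_ofNat]
  cases k with
  | zero => simpa using h4.symm
  | succ k =>
    simp only [Nat.add_sub_cancel] at h4
    rw [← sub_eq_iff_eq_add] at h4
    rw [← h4]
    push_cast
    field_simp
    ring

theorem hasSum_sq_one_div_mul_succ :
    HasSum (fun k : ℕ => (1 / (2 * k * (k + 1)) : ℝ) ^ 2) ((Real.pi ^ 2 - 9) / 12) := by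
  have hz := hasSum_zeta_two
  have hs := (hasSum_nat_add_iff' 1).2 hz
  have hs2 := (hasSum_nat_add_iff' 2).2 hz
  simp only [Finset.sum_range_succ, Finset.sum_range_zero] at hs hs2
  have ht : HasSum (fun k : ℕ => 1 / ((k : ℝ) + 1) - 1 / ((k : ℝ) + 2)) 1 := by
    rw [hasSum_iff_tendsto_nat_of_nonneg]
    · have (n : ℕ) : ∑ k ∈ Finset.range n, (1 / ((k : ℝ) + 1) - 1 / ((k : ℝ) + 2)) =
          1 - 1 / ((n : ℝ) + 1) := by
        have h := Finset.sum_range_sub' (fun k : ℕ => 1 / ((k : ℝ) + 1)) n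
        simp only [Nat.cast_add, Nat.cast_one, Nat.cast_zero, add_assoc, one_add_one_eq_two] at h
        rw [h]
        norm_num
      simp only [this]
      simpa using tendsto_one_div_add_atTop_nhds_zero_nat.const_sub (1 : ℝ)
    · intro k
      rw [sub_nonneg]
      gcongr
      norm_num
  rw [← hasSum_nat_add_iff' 1]
  have H := ((hs.add hs2).sub (ht.mul_left 2)).mul_left (1 / 4)
  have e : (Real.pi ^ 2 - 9) / 12 -
      ∑ k ∈ Finset.range 1, (1 / (2 * (k : ℝ) * (k + 1)) : ℝ) ^ 2 = 1 / 4 * (Real.pi ^ 2 / 6 -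
      (0 + 1 / ((0 : ℕ) : ℝ) ^ 2) + (Real.pi ^ 2 / 6 - (0 + 1 / ((0 : ℕ) : ℝ) ^ 2 +
      1 / ((1 : ℕ) : ℝ) ^ 2)) - 2 * 1) := by
    norm_num
    ring
  rw [e]
  refine (congrArg (HasSum · _) (funext fun k => ?_)).mp H
  push_cast
  have h1 : (k : ℝ) + 1 ≠ 0 := by positivity
  have h2 : (k : ℝ) + 2 ≠ 0 := by positivity
  have h3 : (k : ℝ) + 1 + 1 ≠ 0 := by positivity
  field_simp
  ring

/-- The words encoding a normalized loop, together with their common maximal height. -/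
noncomputable def code (S : {S : Finset Stitch // IsNormLoop S}) : ℕ × List Bool × List Bool :=
  ((IsNormLoop.exists_encodes S.2).choose,
    (IsNormLoop.exists_encodes S.2).choose_spec.choose,
    (IsNormLoop.exists_encodes S.2).choose_spec.choose_spec.choose)

theorem encodes_code (S : {S : Finset Stitch // IsNormLoop S}) :
    Encodes S.1 (code S).1 (code S).2.1 (code S).2.2 :=
  (IsNormLoop.exists_encodes S.2).choose_spec.choose_spec.choose_spec

theorem code_injective : Function.Injective code := by
  intro S T h
  have hS := encodes_code S
  have hT := encodes_code T
  rw [← h] at hT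
  exact Subtype.ext ((hS.subset hT).antisymm (hT.subset hS))

theorem mem_range_code {p : ℕ × List Bool × List Bool} (h₁ : IsExc p.1 p.2.1)
    (h₂ : IsExc p.1 p.2.2) : p ∈ Set.range code := by
  obtain ⟨S, E⟩ := exists_encodes h₁ h₂
  obtain ⟨a, b, c⟩ := (encodes_code ⟨S, E.isNormLoop⟩).unique E
  exact ⟨⟨S, E.isNormLoop⟩, Prod.ext a (Prod.ext b c)⟩

theorem ofReal_zpow_eq (S : {S : Finset Stitch // IsNormLoop S}) :
    ENNReal.ofReal ((2 : ℝ) ^ (-(loopW S.1 + loopH S.1 + 2))) =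
      2⁻¹ ^ (code S).2.1.length * 2⁻¹ ^ (code S).2.2.length := by
  have E := encodes_code S
  rw [E.loopW_eq, E.loopH_eq, ← pow_add, show (2⁻¹ : ℝ≥0∞) = ENNReal.ofReal 2⁻¹ by
    rw [ENNReal.ofReal_inv_of_pos two_pos, ENNReal.ofReal_ofNat],
    ← ENNReal.ofReal_pow (by norm_num), inv_pow, ← zpow_natCast, ← zpow_neg]
  congr 2
  push_cast
  ring

theorem tsum_ofReal_loop : ∑' S : {S : Finset Stitch // IsNormLoop S},
    ENNReal.ofReal ((2 : ℝ) ^ (-(loopW S.1 + loopH S.1 + 2))) =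
      ENNReal.ofReal ((Real.pi ^ 2 - 9) / 12) := by
  classical
  set w : ℕ → List Bool → ℝ≥0∞ := fun k l => if IsExc k l then 2⁻¹ ^ l.length else 0 with hw
  calc _ = ∑' S, w (code S).1 (code S).2.1 * w (code S).1 (code S).2.2 := by
        refine tsum_congr fun S => ?_
        rw [ofReal_zpow_eq, hw]
        simp only [(encodes_code S).isExc₁, (encodes_code S).isExc₂, if_true]
    _ = ∑' p : ℕ × List Bool × List Bool, w p.1 p.2.1 * w p.1 p.2.2 :=
        code_injective.tsum_eq (f := fun p => w p.1 p.2.1 * w p.1 p.2.2) fun p hp => by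
          refine mem_range_code ?_ ?_ <;> by_contra h <;> simp [hw, h] at hp
    _ = ∑' k, wordSum (IsExc k) * wordSum (IsExc k) := by
        simp only [ENNReal.tsum_prod', ENNReal.tsum_mul_left, ENNReal.tsum_mul_right]
        rfl
    _ = ∑' k : ℕ, ENNReal.ofReal ((1 / (2 * k * (k + 1)) : ℝ) ^ 2) := by
        refine tsum_congr fun k => ?_
        rw [wordSum_isExc, ← sq, ENNReal.ofReal_pow (by positivity)]
    _ = _ := by
        rw [← ENNReal.ofReal_tsum_of_nonneg (fun k => by positivity)
          hasSum_sq_one_div_mul_succ.summable, hasSum_sq_one_div_mul_succ.tsum_eq]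

theorem hasSum_loop : HasSum (fun S : {S : Finset Stitch // IsNormLoop S} =>
    (2 : ℝ) ^ (-(loopW S.1 + loopH S.1 + 2))) ((Real.pi ^ 2 - 9) / 12) := by
  have h := tsum_ofReal_loop
  have hpos (S : {S : Finset Stitch // IsNormLoop S}) :
      0 ≤ (2 : ℝ) ^ (-(loopW S.1 + loopH S.1 + 2)) := by positivity
  have hs : Summable fun S : {S : Finset Stitch // IsNormLoop S} =>
      (2 : ℝ) ^ (-(loopW S.1 + loopH S.1 + 2)) := by
    have := ENNReal.summable_toReal (h.trans_ne ofReal_ne_top)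
    simpa only [toReal_ofReal (hpos _)] using this
  rw [← ENNReal.ofReal_tsum_of_nonneg hpos hs,
    ENNReal.ofReal_eq_ofReal_iff (tsum_nonneg hpos)
      (hasSum_sq_one_div_mul_succ.nonneg fun k => by positivity)] at h
  exact h ▸ hs.hasSum

end Hitomezashi

/-- The constant `c = Σ_{L ∈ 𝐋} 2^{-(width(L)+height(L)+2)}`, summed
over hitomezashi loops modulo translation, equals `(π² − 9)/12`. -/
theorem hitomezashi_constant_value :
    Summable (fun S : {S : Finset Stitch // IsNormLoop S} =>
      (2 : ℝ) ^ (-(loopW S.1 + loopH S.1 + 2))) ∧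
    loopConst = (Real.pi ^ 2 - 9) / 12 := by
  exact ⟨Hitomezashi.hasSum_loop.summable, Hitomezashi.hasSum_loop.tsum_eq⟩
end
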